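/- Let F ∈ S^♯♭(σ0,σ1) and let τ ∈ [σ1, 2σ0] be a real number such that 0 ∉ Z(F) and τ ∉ Z(F). Then for every positive integer n, λ_F(n,τ) = ∑_{k=1}^{n} binom(n,k)·(τ^k/(k−1)!)·D^{(k−1)}(ξ_F′/ξ_F)(τ), where D^{(m)} denotes the m-th complex derivative; equivalently, λ_F(n,τ) = (τ/(n−1)!)·[d^n/ds^n ( s^{n−1}·log ξ_F(s) )]_{s=τ} for any branch of log ξ_F near τ. -/

import Mathlib

open Complex Filter MeasureTheory Finset

noncomputable section

/-- The order of vanishing of `f` at `ρ`. -/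
noncomputable def zeroOrder (f : ℂ → ℂ) (ρ : ℂ) : ℕ :=
  sInf {k : ℕ | iteratedDeriv k f ρ ≠ 0}

/-- The class `S^♯♭(σ₀,σ₁)` of `L`-functions. -/
structure SSF (σ0 σ1 : ℝ) : Type where
  hσ1pos : 0 < σ1
  hσ : σ1 ≤ σ0
  /-- The `L`-function itself (as a function, analytic away from the poles). -/
  F : ℂ → ℂ
  /-- Dirichlet series coefficients. -/
  a : ℕ → ℂ
  hDir : ∀ s : ℂ, σ0 < s.re →
    HasSum (fun n : ℕ => a (n + 1) * ((n + 1 : ℕ) : ℂ) ^ (-s)) (F s)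
  hDirAbs : ∀ s : ℂ, σ0 < s.re →
    Summable (fun n : ℕ => ‖a (n + 1) * ((n + 1 : ℕ) : ℂ) ^ (-s)‖)
  /-- The number of poles. -/
  N : ℕ
  /-- The poles `s₁, …, s_N`. -/
  pole : Fin N → ℂ
  /-- Their orders `m₁, …, m_N`. -/
  m : Fin N → ℕ
  hm : ∀ i, 0 < m i
  /-- Entire continuation of `∏ (s - sᵢ)^{mᵢ} · F s`, of finite order. -/
  G : ℂ → ℂ
  hGdiff : Differentiable ℂ G
  hGord : ∃ c B : ℝ, ∀ s : ℂ, ‖G s‖ ≤ c * Real.exp (‖s‖ ^ B)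
  hGF : ∀ s : ℂ, (∀ i, s ≠ pole i) → G s = (∏ i, (s - pole i) ^ m i) * F s
  Q : ℝ
  hQ : 0 < Q
  r : ℕ
  lam : Fin r → ℝ
  hlam : ∀ j, 0 < lam j
  mu : Fin r → ℂ
  ω : ℂ
  hω : ‖ω‖ = 1
  M : ℕ
  /-- `δ(σ₁) ∈ {0,1}`. -/
  dlt : ℕ
  hdlt : dlt ≤ 1
  hMN : 2 * M + dlt ≤ N
  hpair : ∀ (j : ℕ) (h1 : 2 * j < N) (h2 : 2 * j + 1 < N), j < M →
    pole ⟨2 * j, h1⟩ + (starRingEnd ℂ) (pole ⟨2 * j + 1, h2⟩) = (σ1 : ℂ)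
  hdelta : dlt = 1 ↔ ∃ i, pole i = (σ1 / 2 : ℂ)
  hdeltaPos : dlt = 1 → ∀ h2 : 2 * M < N, pole ⟨2 * M, h2⟩ = (σ1 / 2 : ℂ)
  /-- The completed function `ξ_F` (the analytic continuation of the completed product). -/
  xi : ℂ → ℂ
  hxiDiff : Differentiable ℂ xi
  hxiEq : ∀ s : ℂ, (∀ i, s ≠ pole i) →
    (∀ (j : Fin r) (k : ℕ), (lam j : ℂ) * s + mu j ≠ -(k : ℂ)) →
    xi s = F s * (Q : ℂ) ^ s * (∏ j, Complex.Gamma ((lam j : ℂ) * s + mu j)) *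
      (∏ i, (s - pole i) ^ m i) *
      ∏ i : Fin N, (if 2 * M + dlt ≤ (i : ℕ) then ((σ1 : ℂ) - s - (starRingEnd ℂ) (pole i)) ^ m i else 1)
  hFE : ∀ s : ℂ, xi s = ω * (starRingEnd ℂ) (xi ((σ1 : ℂ) - (starRingEnd ℂ) s))
  /-- The coefficients of the Dirichlet series of `-F'/F`. -/
  c : ℕ → ℂ
  hEuler : ∀ s : ℂ, σ0 < s.re →
    HasSum (fun n : ℕ => c (n + 2) * ((n + 2 : ℕ) : ℂ) ^ (-s)) (-(deriv F s / F s))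
  hEulerAbs : ∀ s : ℂ, σ0 < s.re →
    Summable (fun n : ℕ => ‖c (n + 2) * ((n + 2 : ℕ) : ℂ) ^ (-s)‖)

namespace SSF

variable {σ0 σ1 : ℝ}

/-- Truncated sum over the nontrivial zeros (zeros of `ξ_F`) with `|Im ρ| ≤ T`,
counted with multiplicity. -/
noncomputable def zsum (S : SSF σ0 σ1) (w : ℂ → ℂ) (T : ℝ) : ℂ :=
  ∑' ρ : {ρ : ℂ // S.xi ρ = 0 ∧ |ρ.im| ≤ T}, (zeroOrder S.xi ρ : ℂ) * w ρ

end SSF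

/-- A zero of finite order of an entire function can be divided out. -/
theorem exists_entire_div_pow {f : ℂ → ℂ} (hf : Differentiable ℂ f) {a : ℂ}
    (ha : analyticOrderAt f a ≠ ⊤) :
    ∃ g : ℂ → ℂ, Differentiable ℂ g ∧ g a ≠ 0 ∧
      ∀ z, f z = (z - a) ^ analyticOrderNatAt f a * g z := by
  obtain ⟨g₀, hg₀, hg₀a, hev⟩ := (hf.analyticAt a).analyticOrderAt_ne_top.1 ha
  set m := analyticOrderNatAt f a with hm
  classical
  let g : ℂ → ℂ := fun z => if z = a then g₀ a else f z / (z - a) ^ m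
  have hgev : g =ᶠ[nhds a] g₀ := by
    filter_upwards [hev] with z hz
    by_cases h : z = a
    · simp [g, h]
    · simp only [g, if_neg h]
      rw [hz, smul_eq_mul, mul_div_cancel_left₀ _ (pow_ne_zero _ (sub_ne_zero.2 h))]
  have hfa := hev.self_of_nhds
  refine ⟨g, fun z => ?_, by simpa [g] using hg₀a, fun z => ?_⟩
  · by_cases h : z = a
    · subst h
      exact hg₀.differentiableAt.congr_of_eventuallyEq hgev
    · have : g =ᶠ[nhds z] fun z => f z / (z - a) ^ m := by
        filter_upwards [isOpen_ne.mem_nhds h] with w hw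
        simp only [g]
        rw [if_neg hw]
      refine DifferentiableAt.congr_of_eventuallyEq ?_ this
      exact (hf z).div (by fun_prop) (pow_ne_zero _ (sub_ne_zero.2 h))
  · by_cases h : z = a
    · subst h
      simpa [g] using hfa
    · simp only [g, if_neg h]
      rw [mul_div_cancel₀ _ (pow_ne_zero _ (sub_ne_zero.2 h))]

theorem analyticOrderAt_ne_top_of_entire {f : ℂ → ℂ} (hf : Differentiable ℂ f) {b : ℂ}
    (hb : f b ≠ 0) (a : ℂ) : analyticOrderAt f a ≠ ⊤ := by
  intro h
  rw [analyticOrderAt_eq_top] at h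
  have h1 : AnalyticOnNhd ℂ f Set.univ := fun z _ => hf.analyticAt z
  exact hb (h1.eqOn_zero_of_preconnected_of_eventuallyEq_zero isPreconnected_univ
    (Set.mem_univ a) h (Set.mem_univ b))

/-- Finitely many zeros of an entire function can be divided out. -/
theorem exists_entire_div_prod {f : ℂ → ℂ} (hf : Differentiable ℂ f) {b : ℂ} (hb : f b ≠ 0)
    (S : Finset ℂ) :
    ∃ g : ℂ → ℂ, Differentiable ℂ g ∧ (∀ a ∈ S, g a ≠ 0) ∧
      ∀ z, f z = (∏ a ∈ S, (z - a) ^ analyticOrderNatAt f a) * g z := by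
  classical
  induction S using Finset.induction_on with
  | empty => exact ⟨f, hf, by simp, by simp⟩
  | insert a S haS ih =>
    obtain ⟨g, hg, hgS, hfg⟩ := ih
    have hgb : g b ≠ 0 := fun h => hb (by rw [hfg, h, mul_zero])
    obtain ⟨k, hk, hka, hgk⟩ := exists_entire_div_pow hg
      (analyticOrderAt_ne_top_of_entire hg hgb a)
    have hord : analyticOrderAt f a = analyticOrderAt g a := by
      have hfun : f = (fun z => ∏ a ∈ S, (z - a) ^ analyticOrderNatAt f a) * g := by
        ext z; exact hfg z
      have hd : Differentiable ℂ (fun z => ∏ a ∈ S, (z - a) ^ analyticOrderNatAt f a) := by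
        fun_prop
      conv_lhs => rw [hfun]
      rw [analyticOrderAt_mul (hd.analyticAt a) (hg.analyticAt a)]
      rw [(hd.analyticAt a).analyticOrderAt_eq_zero.2 ?_, zero_add]
      rw [Finset.prod_ne_zero_iff]
      intro c hc
      exact pow_ne_zero _ (sub_ne_zero.2 fun h => haS (h ▸ hc))
    have hord' : analyticOrderNatAt g a = analyticOrderNatAt f a := by
      simp [analyticOrderNatAt, hord]
    refine ⟨k, hk, ?_, fun z => ?_⟩
    · intro c hc
      rcases Finset.mem_insert.1 hc with rfl | hc
      · exact hka
      · intro h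
        exact hgS c hc (by rw [hgk, h, mul_zero])
    · rw [Finset.prod_insert haS, hfg z, hgk z, hord']
      ring

theorem finite_zeros_closedBall {f : ℂ → ℂ} (hf : Differentiable ℂ f) {b : ℂ} (hb : f b ≠ 0)
    (R : ℝ) : {z : ℂ | f z = 0 ∧ ‖z‖ ≤ R}.Finite := by
  have h1 : AnalyticOnNhd ℂ f Set.univ := fun z _ => hf.analyticAt z
  have h2 := h1.preimage_zero_mem_codiscrete hb
  rw [mem_codiscrete'] at h2
  have hset : {z : ℂ | f z = 0 ∧ ‖z‖ ≤ R} = (f ⁻¹' {0}) ∩ Metric.closedBall 0 R := by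
    ext z; simp
  rw [hset]
  have hc : IsCompact ((f ⁻¹' {0}) ∩ Metric.closedBall 0 R) :=
    (isCompact_closedBall 0 R).inter_left (isClosed_singleton.preimage hf.continuous)
  refine hc.finite ?_
  have := h2.2
  simp only [Set.preimage_compl, compl_compl] at this
  exact this.mono Set.inter_subset_left

/-- The zeros of `f` in the open disc of radius `R` about the origin. -/
def zerosBall (f : ℂ → ℂ) (R : ℝ) : Finset ℂ :=
  open Classical in
  if h : {z : ℂ | f z = 0 ∧ ‖z‖ < R}.Finite then h.toFinset else ∅

theorem mem_zerosBall {f : ℂ → ℂ} (hf : Differentiable ℂ f) {b : ℂ} (hb : f b ≠ 0) {R : ℝ}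
    {z : ℂ} : z ∈ zerosBall f R ↔ f z = 0 ∧ ‖z‖ < R := by
  have h : {z : ℂ | f z = 0 ∧ ‖z‖ < R}.Finite :=
    (finite_zeros_closedBall hf hb R).subset fun z hz => ⟨hz.1, hz.2.le⟩
  rw [zerosBall, dif_pos h]
  simp

/-- A holomorphic function without zeros on a closed disc has a holomorphic logarithm on a larger
disc. -/
theorem exists_log_of_ne_zero {g : ℂ → ℂ} (hg : Differentiable ℂ g) {R : ℝ} (hR : 0 < R)
    (h0 : ∀ z, ‖z‖ ≤ R → g z ≠ 0) :
    ∃ (R' : ℝ) (h : ℂ → ℂ), R < R' ∧ DifferentiableOn ℂ h (Metric.ball 0 R') ∧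
      (∀ z ∈ Metric.ball (0 : ℂ) R', g z = Complex.exp (h z)) ∧
      ∀ z ∈ Metric.ball (0 : ℂ) R', deriv h z = deriv g z / g z := by
  have hopen : IsOpen {z | g z ≠ 0} := isOpen_ne.preimage hg.continuous
  obtain ⟨δ, hδ, hsub⟩ := (isCompact_closedBall (0 : ℂ) R).exists_thickening_subset_open hopen
    (fun z hz => h0 z (by simpa using hz))
  rw [thickening_closedBall hδ hR.le] at hsub
  have hd : DifferentiableOn ℂ (fun z => deriv g z / g z) (Metric.ball 0 (δ + R)) := by
    intro z hz
    have h1 : DifferentiableAt ℂ (deriv g) z := by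
      exact (hg.analyticAt z).deriv.differentiableAt
    exact (h1.div (hg z) (hsub hz)).differentiableWithinAt
  have hne : g 0 ≠ 0 := h0 0 (by simpa using hR.le)
  obtain ⟨h, hh0, hh⟩ := hd.isExactOn_ball.with_val_at 0 (Complex.log (g 0))
  have hball0 : (0 : ℂ) ∈ Metric.ball (0 : ℂ) (δ + R) := by simp; positivity
  refine ⟨δ + R, h, by linarith, fun z hz => (hh z hz).differentiableAt.differentiableWithinAt,
    ?_, fun z hz => (hh z hz).deriv⟩
  have hder : ∀ z ∈ Metric.ball (0 : ℂ) (δ + R),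
      HasDerivAt (fun z => g z * Complex.exp (-h z)) 0 z := by
    intro z hz
    have h1 := (hg z).hasDerivAt.mul ((hh z hz).neg.cexp)
    have h3 : g z ≠ 0 := hsub hz
    have h2 : g z * (deriv g z / g z) = deriv g z := mul_div_cancel₀ _ h3
    have h4 : deriv g z * Complex.exp (-h z) +
        g z * (Complex.exp (-h z) * -(deriv g z / g z)) = 0 := by
      calc _ = Complex.exp (-h z) * (deriv g z - g z * (deriv g z / g z)) := by ring
        _ = 0 := by rw [h2, sub_self, mul_zero]
    exact h1.congr_deriv h4
  intro z hz
  have hconst : (fun z => g z * Complex.exp (-h z)) z = (fun z => g z * Complex.exp (-h z)) 0 := by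
    refine (convex_ball (0 : ℂ) (δ + R)).is_const_of_fderivWithin_eq_zero (𝕜 := ℂ)
      (fun w hw => (hder w hw).differentiableAt.differentiableWithinAt) ?_ hz hball0
    intro w hw
    rw [fderivWithin_of_isOpen Metric.isOpen_ball hw]
    ext
    simp [(hder w hw).deriv]
  simp only [hh0, Complex.exp_neg, Complex.exp_log hne] at hconst
  rw [mul_inv_cancel₀ hne] at hconst
  field_simp at hconst
  exact hconst

theorem iteratedDeriv_div_one_sub_mul (b : ℂ) (k : ℕ) :
    ∀ z : ℂ, 1 - b * z ≠ 0 → iteratedDeriv k (fun z => b / (1 - b * z)) z =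
      (k.factorial : ℂ) * (b / (1 - b * z)) ^ (k + 1) := by
  induction k with
  | zero => intro z hz; simp
  | succ k ih =>
    intro z hz
    rw [iteratedDeriv_succ]
    have hopen : IsOpen {z : ℂ | 1 - b * z ≠ 0} := isOpen_ne.preimage (by fun_prop)
    have hev : iteratedDeriv k (fun z => b / (1 - b * z)) =ᶠ[nhds z]
        fun z => (k.factorial : ℂ) * (b / (1 - b * z)) ^ (k + 1) := by
      filter_upwards [hopen.mem_nhds hz] with w hw using ih w hw
    rw [hev.deriv_eq]
    have h1 : HasDerivAt (fun z : ℂ => 1 - b * z) (-b) z := by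
      simpa using ((hasDerivAt_id z).const_mul b).const_sub 1
    have h2 := (((hasDerivAt_const z b).fun_div h1 hz).fun_pow (k + 1)).const_mul (k.factorial : ℂ)
    rw [h2.deriv, Nat.factorial_succ]
    push_cast
    generalize 1 - b * z = u
    ring

theorem norm_sub_le_blaschke {a z : ℂ} {R : ℝ} (hR : 0 < R) (ha : ‖a‖ ≤ R) (hz : ‖z‖ ≤ R) :
    ‖z - a‖ ≤ ‖((R : ℂ) ^ 2 - (starRingEnd ℂ) a * z) / R‖ := by
  rw [norm_div, norm_real, Real.norm_of_nonneg hR.le, le_div_iff₀ hR]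
  refine le_of_sq_le_sq ?_ (norm_nonneg _) |> id
  have h1 : 0 ≤ (R ^ 2 - ‖z‖ ^ 2) * (R ^ 2 - ‖a‖ ^ 2) :=
    mul_nonneg (by nlinarith [norm_nonneg z]) (by nlinarith [norm_nonneg a])
  rw [mul_pow]
  rw [← normSq_eq_norm_sq, ← normSq_eq_norm_sq] at h1 ⊢
  simp only [normSq_apply, sub_re, sub_im, mul_re, mul_im, conj_re, conj_im, ← ofReal_pow,
    ofReal_re, ofReal_im] at h1 ⊢
  nlinarith

theorem norm_sub_eq_blaschke {a z : ℂ} {R : ℝ} (hR : 0 < R) (hz : ‖z‖ = R) :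
    ‖((R : ℂ) ^ 2 - (starRingEnd ℂ) a * z) / R‖ = ‖z - a‖ := by
  rw [norm_div, norm_real, Real.norm_of_nonneg hR.le, div_eq_iff hR.ne']
  have h : (R : ℂ) ^ 2 - (starRingEnd ℂ) a * z = z * (starRingEnd ℂ) (z - a) := by
    rw [map_sub, mul_sub, mul_conj, normSq_eq_norm_sq, hz]
    push_cast; ring
  rw [h, norm_mul, norm_conj, hz, mul_comm]

/-- The Poisson–Jensen regularisation of an entire function on a disc: a holomorphic `h` on a
neighbourhood of the closed disc with `Re h = log ‖f‖` on the boundary circle. -/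
theorem exists_poissonJensen {f : ℂ → ℂ} (hf : Differentiable ℂ f) (h0 : f 0 ≠ 0) {R : ℝ}
    (hR : 0 < R) (hs : ∀ z, ‖z‖ = R → f z ≠ 0) :
    ∃ (R' : ℝ) (h : ℂ → ℂ), R < R' ∧ DifferentiableOn ℂ h (Metric.ball 0 R') ∧
      (∀ z, ‖z‖ = R → (h z).re = Real.log ‖f z‖) ∧
      (∀ z, ‖z‖ < R → f z ≠ 0 → Real.log ‖f z‖ ≤ (h z).re) ∧
      (h 0).re = Real.log ‖f 0‖ +
        ∑ a ∈ zerosBall f R, (analyticOrderNatAt f a : ℝ) * Real.log (R / ‖a‖) ∧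
      ∀ k : ℕ, iteratedDeriv k (deriv h) 0 =
        iteratedDeriv k (fun z => deriv f z / f z) 0 +
          (k.factorial : ℂ) * ∑ a ∈ zerosBall f R, (analyticOrderNatAt f a : ℂ) *
            (a⁻¹ ^ (k + 1) - ((starRingEnd ℂ) a / (R : ℂ) ^ 2) ^ (k + 1)) := by
  obtain ⟨g, hg, hgZ, hfg⟩ := exists_entire_div_prod hf h0 (zerosBall f R)
  set Z := zerosBall f R with hZ
  have hmem : ∀ a, a ∈ Z ↔ f a = 0 ∧ ‖a‖ < R := fun a => mem_zerosBall hf h0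
  have hZ0 : ∀ a ∈ Z, a ≠ 0 := fun a ha h => h0 (h ▸ ((hmem a).1 ha).1)
  have hRC : (R : ℂ) ≠ 0 := by exact_mod_cast hR.ne'
  have hgne : ∀ z, ‖z‖ ≤ R → g z ≠ 0 := by
    intro z hz hgz
    have hfz : f z = 0 := by rw [hfg, hgz, mul_zero]
    rcases hz.lt_or_eq with h | h
    · exact hgZ z ((hmem z).2 ⟨hfz, h⟩) hgz
    · exact hs z h hfz
  set B : ℂ → ℂ → ℂ := fun a z => ((R : ℂ) ^ 2 - (starRingEnd ℂ) a * z) / R with hB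
  have hBne : ∀ a ∈ Z, ∀ z, ‖z‖ ≤ R → B a z ≠ 0 := by
    intro a ha z hz hzero
    simp only [hB, div_eq_zero_iff, hRC, or_false, sub_eq_zero] at hzero
    have := congrArg norm hzero
    rw [norm_pow, norm_mul, norm_conj, norm_real, Real.norm_of_nonneg hR.le] at this
    have h1 := ((hmem a).1 ha).2
    nlinarith [norm_nonneg a, norm_nonneg z]
  set G : ℂ → ℂ := fun z => (∏ a ∈ Z, B a z ^ analyticOrderNatAt f a) * g z with hG
  have hGd : Differentiable ℂ G := by simp only [hG, hB]; fun_prop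
  have hGne : ∀ z, ‖z‖ ≤ R → G z ≠ 0 := fun z hz =>
    mul_ne_zero (Finset.prod_ne_zero_iff.2 fun a ha => pow_ne_zero _ (hBne a ha z hz)) (hgne z hz)
  obtain ⟨R', h, hRR', hh, hexp, hder⟩ := exists_log_of_ne_zero hGd hR hGne
  have hre : ∀ z, ‖z‖ ≤ R → (h z).re = Real.log ‖G z‖ := by
    intro z hz
    rw [hexp z (by simpa using hz.trans_lt hRR'), norm_exp, Real.log_exp]
  refine ⟨R', h, hRR', hh, ?_, ?_, ?_, ?_⟩
  · intro z hz
    rw [hre z hz.le, hfg z]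
    simp only [hG, norm_mul, norm_prod, norm_pow]
    congr 2
    refine Finset.prod_congr rfl fun a _ => ?_
    rw [norm_sub_eq_blaschke hR hz]
  · intro z hz hfz
    rw [hre z hz.le]
    refine Real.log_le_log (norm_pos_iff.2 hfz) ?_
    rw [hfg z]
    simp only [hG, norm_mul, norm_prod, norm_pow]
    gcongr with a ha
    exact norm_sub_le_blaschke hR ((hmem a).1 ha).2.le hz.le
  · have hn0 : ‖(0 : ℂ)‖ ≤ R := by simpa using hR.le
    rw [hre 0 hn0, hfg 0]
    simp only [hG, norm_mul, norm_prod, norm_pow]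
    have hg0 : ‖g 0‖ ≠ 0 := norm_ne_zero_iff.2 (hgne 0 hn0)
    rw [Real.log_mul _ hg0, Real.log_mul _ hg0, Real.log_prod, Real.log_prod]
    · rw [add_right_comm, add_left_inj, ← Finset.sum_add_distrib]
      refine Finset.sum_congr rfl fun a ha => ?_
      have ha0 := norm_pos_iff.2 (hZ0 a ha)
      simp only [hB, mul_zero, sub_zero, zero_sub, norm_neg, Real.log_pow]
      rw [← mul_add, Real.log_div hR.ne' ha0.ne', pow_two, mul_div_assoc, div_self hRC, mul_one,
        norm_real, Real.norm_of_nonneg hR.le]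
      ring
    · intro a ha
      exact pow_ne_zero _ (norm_ne_zero_iff.2 (by simpa using hZ0 a ha))
    · intro a ha
      exact pow_ne_zero _ (norm_ne_zero_iff.2 (hBne a ha 0 hn0))
    · exact Finset.prod_ne_zero_iff.2 fun a ha =>
        pow_ne_zero _ (norm_ne_zero_iff.2 (by simpa using hZ0 a ha))
    · exact Finset.prod_ne_zero_iff.2 fun a ha =>
        pow_ne_zero _ (norm_ne_zero_iff.2 (hBne a ha 0 hn0))
  · intro k
    have hball : Metric.ball (0 : ℂ) R ∈ nhds (0 : ℂ) := Metric.ball_mem_nhds _ hR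
    have hfne : ∀ᶠ z in nhds (0 : ℂ), f z ≠ 0 :=
      hf.continuous.continuousAt.eventually_ne h0
    set b : ℂ → ℂ := fun a => (starRingEnd ℂ) a / (R : ℂ) ^ 2 with hb
    have hev : deriv h =ᶠ[nhds 0] fun z => deriv f z / f z +
        ∑ a ∈ Z, (analyticOrderNatAt f a : ℂ) *
          (a⁻¹ / (1 - a⁻¹ * z) - b a / (1 - b a * z)) := by
      filter_upwards [hball, hfne] with z hz hfz
      have hzR : ‖z‖ < R := by simpa using hz
      rw [hder z (by simpa using hzR.trans hRR')]
      have hfa : ∀ a ∈ Z, z - a ≠ 0 := by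
        intro a ha h
        rw [sub_eq_zero] at h
        exact hfz (h ▸ ((hmem a).1 ha).1)
      have e1 : logDeriv G z = ∑ a ∈ Z, (analyticOrderNatAt f a : ℂ) *
          (-(b a / (1 - b a * z))) + logDeriv g z := by
        rw [hG, logDeriv_mul z
          (Finset.prod_ne_zero_iff.2 fun a ha => pow_ne_zero _ (hBne a ha z hzR.le))
          (hgne z hzR.le) (by simp only [hB]; fun_prop) (hg z)]
        congr 1
        rw [logDeriv_prod (f := fun a z => B a z ^ analyticOrderNatAt f a)
          (fun a ha => pow_ne_zero _ (hBne a ha z hzR.le))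
          (fun a ha => by simp only [hB]; fun_prop)]
        refine Finset.sum_congr rfl fun a ha => ?_
        rw [logDeriv_fun_pow (by simp only [hB]; fun_prop)]
        congr 1
        have hd : HasDerivAt (B a) (-(starRingEnd ℂ) a / R) z := by
          have := (((hasDerivAt_id z).const_mul ((starRingEnd ℂ) a)).const_sub
            ((R : ℂ) ^ 2)).div_const (R : ℂ)
          simpa [hB] using this
        rw [logDeriv_apply, hd.deriv]
        have hne := hBne a ha z hzR.le
        simp only [hB, hb] at hne ⊢
        have hne' : (R : ℂ) ^ 2 - (starRingEnd ℂ) a * z ≠ 0 := fun h => hne (by rw [h, zero_div])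
        have e : (1 - (starRingEnd ℂ) a / (R : ℂ) ^ 2 * z) =
          ((R : ℂ) ^ 2 - (starRingEnd ℂ) a * z) / (R : ℂ) ^ 2 := by field_simp
        rw [e]
        field_simp
      have e2 : logDeriv f z = ∑ a ∈ Z, (analyticOrderNatAt f a : ℂ) *
          (-(a⁻¹ / (1 - a⁻¹ * z))) + logDeriv g z := by
        have hfun : f = fun z => (∏ a ∈ Z, (z - a) ^ analyticOrderNatAt f a) * g z :=
          funext hfg
        conv_lhs => rw [hfun]
        rw [logDeriv_mul z
          (Finset.prod_ne_zero_iff.2 fun a ha => pow_ne_zero _ (hfa a ha))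
          (hgne z hzR.le) (by fun_prop) (hg z)]
        congr 1
        rw [logDeriv_prod (f := fun a z => (z - a) ^ analyticOrderNatAt f a)
          (fun a ha => pow_ne_zero _ (hfa a ha))
          (fun a ha => by fun_prop)]
        refine Finset.sum_congr rfl fun a ha => ?_
        rw [logDeriv_fun_pow (by fun_prop)]
        congr 1
        rw [logDeriv_apply]
        have ha0 := hZ0 a ha
        have hza := hfa a ha
        have e : (1 - a⁻¹ * z) = (a - z) / a := by field_simp
        have hza' : a - z ≠ 0 := fun h => hza (by linear_combination -h)
        rw [e]
        simp only [deriv_sub_const_fun, deriv_id'']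
        rw [one_div, ← neg_sub a z, inv_neg]
        field_simp
      rw [logDeriv_apply] at e1 e2
      rw [e1, e2, add_right_comm, ← Finset.sum_add_distrib]
      congr 1
      refine Finset.sum_congr rfl fun a ha => ?_
      ring
    rw [hev.iteratedDeriv_eq]
    have hcd : ∀ c : ℂ, ContDiffAt ℂ k (fun z => c / (1 - c * z)) 0 := by
      intro c
      exact contDiffAt_const.div (by fun_prop) (by simp)
    have hcf : ContDiffAt ℂ k (fun z => deriv f z / f z) 0 := by
      have : AnalyticAt ℂ (fun z => deriv f z / f z) 0 :=
        (hf.analyticAt 0).deriv.div (hf.analyticAt 0) h0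
      exact this.contDiffAt
    have hcs : ∀ a ∈ Z, ContDiffAt ℂ k (fun z => (analyticOrderNatAt f a : ℂ) *
          (a⁻¹ / (1 - a⁻¹ * z) - b a / (1 - b a * z))) 0 := fun a _ =>
      contDiffAt_const.mul ((hcd _).sub (hcd _))
    rw [iteratedDeriv_fun_add hcf (ContDiffAt.sum hcs), iteratedDeriv_fun_sum hcs]
    rw [Finset.mul_sum]
    congr 1
    refine Finset.sum_congr rfl fun a ha => ?_
    rw [iteratedDeriv_const_mul_field, iteratedDeriv_fun_sub (hcd _) (hcd _),
      iteratedDeriv_div_one_sub_mul _ _ _ (by simp), iteratedDeriv_div_one_sub_mul _ _ _ (by simp)]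
    simp
    ring

theorem continuousOn_log_norm_sphere {f : ℂ → ℂ} (hf : Differentiable ℂ f) {R : ℝ}
    (hs : ∀ z, ‖z‖ = R → f z ≠ 0) :
    ContinuousOn (fun z => Real.log ‖f z‖) (Metric.sphere 0 R) := by
  refine ContinuousOn.log hf.continuous.norm.continuousOn fun z hz => ?_
  exact norm_ne_zero_iff.2 (hs z (by simpa using hz))

/-- The real part commutes with circle averages. -/
theorem re_circleAverage {u : ℂ → ℂ} {c : ℂ} {R : ℝ} (hu : CircleIntegrable u c R) :
    (Real.circleAverage u c R).re = Real.circleAverage (fun z => (u z).re) c R :=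
  (reCLM.circleAverage_comp_comm hu).symm

theorem ofReal_circleAverage {u : ℂ → ℝ} {c : ℂ} {R : ℝ} (hu : CircleIntegrable u c R) :
    ((Real.circleAverage u c R : ℝ) : ℂ) = Real.circleAverage (fun z => (u z : ℂ)) c R :=
  (ofRealCLM.circleAverage_comp_comm hu).symm

theorem conj_circleAverage {u : ℂ → ℂ} {c : ℂ} {R : ℝ} (hu : CircleIntegrable u c R) :
    (starRingEnd ℂ) (Real.circleAverage u c R) =
      Real.circleAverage (fun z => (starRingEnd ℂ) (u z)) c R :=
  ((conjCLE : ℂ →L[ℝ] ℂ).circleAverage_comp_comm hu).symm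

theorem diffContOnCl_of_ball {h : ℂ → ℂ} {R R' : ℝ} (hR : 0 < R) (hRR' : R < R')
    (hh : DifferentiableOn ℂ h (Metric.ball 0 R')) : DiffContOnCl ℂ h (Metric.ball 0 R) := by
  refine DifferentiableOn.diffContOnCl ?_
  rw [closure_ball _ hR.ne']
  exact hh.mono (Metric.closedBall_subset_ball hRR')

/-- Jensen's formula, with the zeros enumerated. -/
theorem circleAverage_log_norm_eq {f : ℂ → ℂ} (hf : Differentiable ℂ f) (h0 : f 0 ≠ 0) {R : ℝ}
    (hR : 0 < R) (hs : ∀ z, ‖z‖ = R → f z ≠ 0) :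
    Real.circleAverage (fun z => Real.log ‖f z‖) 0 R = Real.log ‖f 0‖ +
        ∑ a ∈ zerosBall f R, (analyticOrderNatAt f a : ℝ) * Real.log (R / ‖a‖) := by
  obtain ⟨R', h, hRR', hh, hb, -, hc, -⟩ := exists_poissonJensen hf h0 hR hs
  have hd := diffContOnCl_of_ball hR hRR' hh
  rw [← hc, ← (show Real.circleAverage h 0 R = h 0 from
    DiffContOnCl.circleAverage (by rwa [abs_of_pos hR])), re_circleAverage]
  · refine Real.circleAverage_congr_sphere fun z hz => ?_
    rw [abs_of_pos hR] at hz
    exact (hb z (by simpa using hz)).symm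
  · refine ContinuousOn.circleIntegrable hR.le (hh.continuousOn.mono fun z hz => ?_)
    simp only [mem_sphere_iff_norm, sub_zero] at hz
    simp [hz, hRR']

theorem continuousOn_poisson {R : ℝ} {p : ℂ} (hp : ‖p‖ < R) :
    ContinuousOn (fun z : ℂ => (‖z‖ ^ 2 - ‖p‖ ^ 2) / ‖z - p‖ ^ 2) (Metric.sphere 0 R) := by
  refine ContinuousOn.div (by fun_prop) (by fun_prop) fun z hz => ?_
  simp only [mem_sphere_iff_norm, sub_zero] at hz
  refine pow_ne_zero _ (norm_ne_zero_iff.2 ?_)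
  rw [sub_ne_zero]
  rintro rfl
  exact hp.ne hz

/-- The Poisson kernel majorisation of `log ‖f‖`. -/
theorem log_norm_le_circleAverage_poisson {f : ℂ → ℂ} (hf : Differentiable ℂ f) (h0 : f 0 ≠ 0)
    {R : ℝ} (hR : 0 < R) (hs : ∀ z, ‖z‖ = R → f z ≠ 0) {p : ℂ} (hp : ‖p‖ < R) (hfp : f p ≠ 0) :
    Real.log ‖f p‖ ≤ Real.circleAverage
      (fun z => (‖z‖ ^ 2 - ‖p‖ ^ 2) / ‖z - p‖ ^ 2 * Real.log ‖f z‖) 0 R := by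
  obtain ⟨R', h, hRR', hh, hb, hle, -, -⟩ := exists_poissonJensen hf h0 hR hs
  have hd := diffContOnCl_of_ball hR hRR' hh
  refine (hle p hp hfp).trans (le_of_eq ?_)
  rw [← hd.circleAverage_poissonKernel_smul' (w := p) (by simpa using hp), re_circleAverage]
  · refine Real.circleAverage_congr_sphere fun z hz => ?_
    rw [abs_of_pos hR] at hz
    simp only [sub_zero, real_smul, re_ofReal_mul]
    rw [hb z (by simpa using hz)]
  · refine ContinuousOn.circleIntegrable hR.le ?_
    have hc : ContinuousOn h (Metric.sphere 0 R) := hh.continuousOn.mono fun z hz => by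
      simp only [mem_sphere_iff_norm, sub_zero] at hz
      simp [hz, hRR']
    simp only [sub_zero]
    exact (continuousOn_poisson hp).smul hc

theorem circleAverage_poisson {R : ℝ} {p : ℂ} (hp : ‖p‖ < R) :
    Real.circleAverage (fun z => (‖z‖ ^ 2 - ‖p‖ ^ 2) / ‖z - p‖ ^ 2) 0 R = 1 := by
  have h := (diffContOnCl_const (𝕜 := ℂ) (c := (1 : ℂ)) (s := Metric.ball (0:ℂ) R)
    ).circleAverage_poissonKernel_smul' (w := p) (by simpa using hp)
  have h2 : CircleIntegrable (fun z : ℂ => (‖z‖ ^ 2 - ‖p‖ ^ 2) / ‖z - p‖ ^ 2) 0 R := by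
    exact ContinuousOn.circleIntegrable ((norm_nonneg p).trans hp.le) (continuousOn_poisson hp)
  have h3 := ofReal_circleAverage h2
  simp only [sub_zero, real_smul, mul_one] at h
  rw [h] at h3
  exact_mod_cast h3

/-- The Fourier coefficients of the boundary values of `Re h`. -/
theorem circleAverage_re_mul_pow {h : ℂ → ℂ} {R R' : ℝ} (hR : 0 < R) (hRR' : R < R')
    (hh : DifferentiableOn ℂ h (Metric.ball 0 R')) (k : ℕ) :
    Real.circleAverage (fun z => ((h z).re : ℂ) * ((R : ℂ) / z) ^ (k + 1)) 0 R =
      (R : ℂ) ^ (k + 1) / (2 * ((k + 1).factorial : ℂ)) * iteratedDeriv k (deriv h) 0 := by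
  have hd := diffContOnCl_of_ball hR hRR' hh
  have hRC : (R : ℂ) ≠ 0 := by exact_mod_cast hR.ne'
  have hc : ContinuousOn h (Metric.sphere 0 R) := hh.continuousOn.mono fun z hz => by
    simp only [mem_sphere_iff_norm, sub_zero] at hz
    simp [hz, hRR']
  have hz0 : ∀ z ∈ Metric.sphere (0 : ℂ) R, z ≠ 0 := by
    rintro z hz rfl
    simp only [mem_sphere_iff_norm, sub_zero, norm_zero] at hz
    exact hR.ne hz
  have hpow : ContinuousOn (fun z : ℂ => ((R : ℂ) / z) ^ (k + 1)) (Metric.sphere 0 R) :=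
    (continuousOn_const.div continuousOn_id hz0).pow _
  have e1 : Real.circleAverage (fun z => h z * ((R : ℂ) / z) ^ (k + 1)) 0 R =
      (R : ℂ) ^ (k + 1) / ((k + 1).factorial : ℂ) * iteratedDeriv k (deriv h) 0 := by
    rw [Real.circleAverage_eq_circleIntegral hR.ne', ← iteratedDeriv_succ']
    have h1 := hd.circleIntegral_one_div_sub_center_pow_smul hR (k + 1)
    have h2 : (∮ z in C(0, R), (z - 0)⁻¹ • (h z * ((R : ℂ) / z) ^ (k + 1))) =
        (R : ℂ) ^ (k + 1) • ∮ z in C(0, R), (1 / (z - 0) ^ (k + 1 + 1)) • h z := by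
      rw [← circleIntegral.integral_smul]
      refine circleIntegral.integral_congr hR.le fun z hz => ?_
      have := hz0 z hz
      simp only [sub_zero, smul_eq_mul, div_pow]
      field_simp
      ring
    rw [h2, h1]
    simp only [smul_eq_mul]
    have := two_pi_I_ne_zero
    field_simp
  have e2 : Real.circleAverage (fun z => (starRingEnd ℂ) (h z) * ((R : ℂ) / z) ^ (k + 1)) 0 R
      = 0 := by
    have h1 : Real.circleAverage (fun z => h z * (z / (R : ℂ)) ^ (k + 1)) 0 R = 0 := by
      have hdd : DiffContOnCl ℂ (fun z => h z * (z / (R : ℂ)) ^ (k + 1)) (Metric.ball 0 |R|) := by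
        rw [abs_of_pos hR]
        refine diffContOnCl_of_ball hR hRR' (hh.mul (by fun_prop))
      rw [hdd.circleAverage]
      simp
    have h2 := conj_circleAverage (u := fun z => h z * (z / (R : ℂ)) ^ (k + 1)) (c := 0) (R := R)
      (ContinuousOn.circleIntegrable hR.le (hc.mul (by fun_prop)))
    rw [h1, map_zero] at h2
    refine Eq.trans ?_ h2.symm
    refine Real.circleAverage_congr_sphere fun z hz => ?_
    rw [abs_of_pos hR] at hz
    have hzz := hz0 z hz
    simp only [mem_sphere_iff_norm, sub_zero] at hz
    simp only [map_mul, map_pow, map_div₀, conj_ofReal]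
    congr 2
    rw [div_eq_div_iff hzz hRC, mul_comm ((starRingEnd ℂ) z), mul_conj, normSq_eq_norm_sq, hz]
    push_cast; ring
  have e3 : (fun z => ((h z).re : ℂ) * ((R : ℂ) / z) ^ (k + 1)) = fun z => (2 : ℂ)⁻¹ •
      (h z * ((R : ℂ) / z) ^ (k + 1) + (starRingEnd ℂ) (h z) * ((R : ℂ) / z) ^ (k + 1)) := by
    ext z
    rw [← add_mul, add_conj, smul_eq_mul]
    push_cast
    ring
  have e4 : Real.circleAverage (fun z => h z * ((R : ℂ) / z) ^ (k + 1) +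
      (starRingEnd ℂ) (h z) * ((R : ℂ) / z) ^ (k + 1)) 0 R =
      Real.circleAverage (fun z => h z * ((R : ℂ) / z) ^ (k + 1)) 0 R +
      Real.circleAverage (fun z => (starRingEnd ℂ) (h z) * ((R : ℂ) / z) ^ (k + 1)) 0 R :=
    Real.circleAverage_fun_add
    (ContinuousOn.circleIntegrable hR.le (hc.mul hpow))
    (ContinuousOn.circleIntegrable hR.le ((continuous_conj.comp_continuousOn hc).mul hpow))
  rw [e3, Real.circleAverage_fun_smul, e4, e1, e2, smul_eq_mul]
  field_simp
  ring

/-- Power sums over the zeros in a disc, in terms of the boundary values of `log ‖f‖`. -/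
theorem sum_zerosBall_pow_eq {f : ℂ → ℂ} (hf : Differentiable ℂ f) (h0 : f 0 ≠ 0) {R : ℝ}
    (hR : 0 < R) (hs : ∀ z, ‖z‖ = R → f z ≠ 0) (k : ℕ) :
    ∑ a ∈ zerosBall f R, (analyticOrderNatAt f a : ℂ) *
        (a⁻¹ ^ (k + 1) - ((starRingEnd ℂ) a / (R : ℂ) ^ 2) ^ (k + 1)) =
      -(iteratedDeriv k (fun z => deriv f z / f z) 0 / (k.factorial : ℂ)) +
        2 * (k + 1) / (R : ℂ) ^ (k + 1) *
          Real.circleAverage (fun z => (Real.log ‖f z‖ : ℂ) * ((R : ℂ) / z) ^ (k + 1)) 0 R := by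
  obtain ⟨R', h, hRR', hh, hb, -, -, hk⟩ := exists_poissonJensen hf h0 hR hs
  have hRC : (R : ℂ) ≠ 0 := by exact_mod_cast hR.ne'
  have e : Real.circleAverage (fun z => (Real.log ‖f z‖ : ℂ) * ((R : ℂ) / z) ^ (k + 1)) 0 R =
      Real.circleAverage (fun z => ((h z).re : ℂ) * ((R : ℂ) / z) ^ (k + 1)) 0 R := by
    refine Real.circleAverage_congr_sphere fun z hz => ?_
    rw [abs_of_pos hR] at hz
    exact congrArg (fun x : ℝ => (x : ℂ) * ((R : ℂ) / z) ^ (k + 1)) (hb z (by simpa using hz)).symm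
  rw [e, circleAverage_re_mul_pow hR hRR' hh k, hk k, Nat.factorial_succ]
  have hkf : (k.factorial : ℂ) ≠ 0 := by exact_mod_cast k.factorial_ne_zero
  have hk1 : (k : ℂ) + 1 ≠ 0 := by exact_mod_cast k.succ_ne_zero
  push_cast
  field_simp
  ring

/-- The main term `log ‖z‖ · A z + B z` in the growth of an entire function. -/
def growthMain (A B : ℂ → ℝ) (z : ℂ) : ℝ := Real.log ‖z‖ * A z + B z

/-- Growth of an entire function like that of a completed `L`-function: away from a vertical strip
`log ‖f‖` is `growthMain A B` up to a logarithm, and in the strip it is `O(‖z‖ log ‖z‖)` from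
above. -/
structure GrowthHyp (f : ℂ → ℂ) (A B : ℂ → ℝ) (C : ℝ) : Prop where
  diff : Differentiable ℂ f
  ne : f 0 ≠ 0
  three_le : 3 ≤ C
  contA : Continuous A
  contB : Continuous B
  homA : ∀ (t : ℝ) (z : ℂ), 0 < t → A (t * z) = t * A z
  homB : ∀ (t : ℝ) (z : ℂ), 0 < t → B (t * z) = t * B z
  evenA : ∀ z, A (-z) = A z
  evenB : ∀ z, B (-z) = B z
  boundA : ∀ z, |A z| ≤ C * ‖z‖
  boundB : ∀ z, |B z| ≤ C * ‖z‖
  out : ∀ z : ℂ, C ≤ |z.re| → f z ≠ 0 ∧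
    |Real.log ‖f z‖ - growthMain A B z| ≤ C * Real.log ‖z‖
  strip : ∀ z : ℂ, |z.re| ≤ C → C ≤ ‖z‖ → Real.log ‖f z‖ ≤ C * (‖z‖ * Real.log ‖z‖)

theorem one_le_log_of_three_le {R : ℝ} (hR : 3 ≤ R) : 1 ≤ Real.log R := by
  rw [Real.le_log_iff_exp_le (by linarith)]
  exact (Real.exp_one_lt_d9.le.trans (by norm_num)).trans hR

theorem continuousOn_growthMain {A B : ℂ → ℝ} (hA : Continuous A) (hB : Continuous B) {R : ℝ}
    (hR : 0 < R) : ContinuousOn (growthMain A B) (Metric.sphere 0 R) := by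
  refine ContinuousOn.add (ContinuousOn.mul (ContinuousOn.log (by fun_prop) fun z hz => ?_)
    hA.continuousOn) hB.continuousOn
  simp only [mem_sphere_iff_norm, sub_zero] at hz
  rw [hz]
  exact hR.ne'

namespace GrowthHyp

variable {f : ℂ → ℂ} {A B : ℂ → ℝ} {C : ℝ}

theorem abs_growthMain_le (H : GrowthHyp f A B C) {z : ℂ} (hz : 3 ≤ ‖z‖) :
    |growthMain A B z| ≤ 2 * C * (‖z‖ * Real.log ‖z‖) := by
  have h1 := one_le_log_of_three_le hz
  have h2 := H.boundA z
  have h3 := H.boundB z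
  have hC := H.three_le
  unfold growthMain
  calc |Real.log ‖z‖ * A z + B z| ≤ |Real.log ‖z‖| * |A z| + |B z| := by
        rw [← abs_mul]; exact abs_add_le _ _
    _ ≤ Real.log ‖z‖ * (C * ‖z‖) + C * ‖z‖ * Real.log ‖z‖ := by
        rw [abs_of_nonneg (by linarith)]
        have : C * ‖z‖ * 1 ≤ C * ‖z‖ * Real.log ‖z‖ := by gcongr
        gcongr
        linarith
    _ = _ := by ring

theorem poisson_lower {C R : ℝ} (hC : 1 ≤ C) (hR : C ^ 2 + 1 ≤ R) {z : ℂ} (hz : ‖z‖ = R)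
    (hre : |z.re| ≤ C) {y : ℝ} (hy : y = R - 1 ∧ 0 ≤ z.im ∨ y = -(R - 1) ∧ z.im ≤ 0) :
    R / (4 * C ^ 2 + 1) ≤ (‖z‖ ^ 2 - ‖(⟨C, y⟩ : ℂ)‖ ^ 2) / ‖z - ⟨C, y⟩‖ ^ 2 := by
  have hnum : ‖(⟨C, y⟩ : ℂ)‖ ^ 2 = C ^ 2 + (R - 1) ^ 2 := by
    rw [← normSq_eq_norm_sq, normSq_apply]
    rcases hy with ⟨rfl, -⟩ | ⟨rfl, -⟩ <;> ring
  have hzz : z.re ^ 2 + z.im ^ 2 = R ^ 2 := by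
    rw [← hz, ← normSq_eq_norm_sq, normSq_apply]; ring
  have hre2 := abs_le.1 hre
  have hx : z.re ^ 2 ≤ C ^ 2 := by nlinarith
  have hy1 : (z.im - y) ^ 2 ≤ 1 := by
    rcases hy with ⟨rfl, h⟩ | ⟨rfl, h⟩
    · have h1 : z.im ≤ R := by nlinarith
      have h2 : R - 1 ≤ z.im := by nlinarith
      nlinarith
    · have h1 : -R ≤ z.im := by nlinarith
      have h2 : z.im ≤ -(R - 1) := by nlinarith
      nlinarith
  have hden : ‖z - ⟨C, y⟩‖ ^ 2 = (z.re - C) ^ 2 + (z.im - y) ^ 2 := by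
    rw [← normSq_eq_norm_sq, normSq_apply]; simp; ring
  rw [hnum, hden, hz]
  have hpos : 0 < (z.re - C) ^ 2 + (z.im - y) ^ 2 := by
    rcases (by positivity : 0 ≤ (z.re - C) ^ 2 + (z.im - y) ^ 2).lt_or_eq with h | h
    · exact h
    · exfalso
      have h1 : z.re = C := by nlinarith [sq_nonneg (z.re - C), sq_nonneg (z.im - y)]
      have h2 : z.im = y := by nlinarith [sq_nonneg (z.re - C), sq_nonneg (z.im - y)]
      have h3 : y ^ 2 = (R - 1) ^ 2 := by rcases hy with ⟨rfl, -⟩ | ⟨rfl, -⟩ <;> ring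
      rw [h1, h2, h3] at hzz
      nlinarith
  have hb : (z.re - C) ^ 2 + (z.im - y) ^ 2 ≤ 4 * C ^ 2 + 1 := by nlinarith
  rw [div_le_div_iff₀ (by positivity) hpos]
  have h1 : R * ((z.re - C) ^ 2 + (z.im - y) ^ 2) ≤ R * (4 * C ^ 2 + 1) := by
    gcongr; nlinarith
  have h2 : R * (4 * C ^ 2 + 1) ≤ (R ^ 2 - (C ^ 2 + (R - 1) ^ 2)) * (4 * C ^ 2 + 1) := by
    gcongr; nlinarith
  exact h1.trans h2

/-- `log ‖f‖` is close to its main term on average over circles. -/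
theorem circleAverage_abs_sub_le (H : GrowthHyp f A B C) :
    ∃ K : ℝ, 3 ≤ K ∧ ∀ R, K ≤ R → (∀ z, ‖z‖ = R → f z ≠ 0) →
      Real.circleAverage (fun z => |Real.log ‖f z‖ - growthMain A B z|) 0 R
        ≤ K * Real.log R := by
  have hC := H.three_le
  refine ⟨C + (4 * C ^ 2 + 1) * (24 * C), by nlinarith, fun R hKR hs => ?_⟩
  have hR2 : C ^ 2 + 1 ≤ R := by nlinarith
  have hR3 : 3 ≤ R := by nlinarith
  have hR0 : 0 < R := by linarith
  have hlog := one_le_log_of_three_le hR3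
  set M := 3 * C * (R * Real.log R) with hM
  have hM0 : 0 ≤ M := by positivity
  have hlogR : Real.log R ≤ R * Real.log R := by nlinarith
  have hV : ∀ z : ℂ, ‖z‖ = R → |growthMain A B z| ≤ 2 * C * (R * Real.log R) := by
    intro z hz
    have := H.abs_growthMain_le (z := z) (by rwa [hz])
    rwa [hz] at this
  have hu : ∀ z : ℂ, ‖z‖ = R → Real.log ‖f z‖ ≤ M := by
    intro z hz
    rcases le_total |z.re| C with h | h
    · have := H.strip z h (by rw [hz]; nlinarith)
      rw [hz] at this
      nlinarith
    · have h1 := (abs_le.1 (H.out z h).2).2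
      have h2 := (abs_le.1 (hV z hz)).2
      rw [hz] at h1
      nlinarith
  set P : ℂ → ℂ → ℝ := fun p z => (‖z‖ ^ 2 - ‖p‖ ^ 2) / ‖z - p‖ ^ 2 with hP
  have hpoint : ∀ p : ℂ, p.re = C → ‖p‖ < R →
      Real.circleAverage (fun z => P p z * (3 * M - Real.log ‖f z‖)) 0 R ≤ 4 * M := by
    intro p hp hpR
    have hp3 : 3 ≤ ‖p‖ := by
      have := abs_re_le_norm p
      rw [hp, abs_of_nonneg (by linarith)] at this
      linarith
    obtain ⟨hfp, hfp2⟩ := H.out p (by rw [hp]; exact le_abs_self _)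
    have h1 := log_norm_le_circleAverage_poisson H.diff H.ne hR0 hs hpR hfp
    have hcP := continuousOn_poisson hpR
    have hcf := continuousOn_log_norm_sphere H.diff hs
    have e : (fun z => P p z * (3 * M - Real.log ‖f z‖)) =
        fun z => (3 * M) • P p z - P p z * Real.log ‖f z‖ := by
      ext z; simp only [smul_eq_mul]; ring
    have e2 : Real.circleAverage (fun z => (3 * M) • P p z - P p z * Real.log ‖f z‖) 0 R =
        Real.circleAverage (fun z => (3 * M) • P p z) 0 R -
          Real.circleAverage (fun z => P p z * Real.log ‖f z‖) 0 R :=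
      Real.circleAverage_fun_sub
        (ContinuousOn.circleIntegrable hR0.le (hcP.const_smul (3 * M)))
        (ContinuousOn.circleIntegrable hR0.le (hcP.mul hcf))
    rw [e, e2, Real.circleAverage_fun_smul, circleAverage_poisson hpR]
    have h2 := (abs_le.1 hfp2).1
    have h3 := (abs_le.1 (H.abs_growthMain_le hp3)).1
    have h4 : Real.log ‖p‖ ≤ Real.log R := Real.log_le_log (by linarith) hpR.le
    have h40 : 0 ≤ Real.log ‖p‖ := by linarith [one_le_log_of_three_le hp3]
    have h5 : ‖p‖ * Real.log ‖p‖ ≤ R * Real.log R := by gcongr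
    have h6 : C * Real.log ‖p‖ ≤ C * (R * Real.log R) := by
      gcongr; exact h4.trans hlogR
    have h7 : 2 * C * (‖p‖ * Real.log ‖p‖) ≤ 2 * C * (R * Real.log R) := by gcongr
    simp only [smul_eq_mul, mul_one]
    have h8 : -M ≤ Real.log ‖f p‖ := by linarith
    linarith
  set p : ℂ := ⟨C, R - 1⟩ with hp
  set q : ℂ := ⟨C, -(R - 1)⟩ with hq
  have hpR : ‖p‖ < R := by
    refine lt_of_pow_lt_pow_left₀ 2 hR0.le ?_
    rw [← normSq_eq_norm_sq, normSq_apply]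
    nlinarith
  have hqR : ‖q‖ < R := by
    refine lt_of_pow_lt_pow_left₀ 2 hR0.le ?_
    rw [← normSq_eq_norm_sq, normSq_apply]
    nlinarith
  have hPnn : ∀ p z : ℂ, ‖p‖ < R → ‖z‖ = R → 0 ≤ P p z := by
    intro p z hp hz
    refine div_nonneg ?_ (by positivity)
    rw [hz]; nlinarith [norm_nonneg p]
  have hcf := continuousOn_log_norm_sphere H.diff hs
  have hcV := continuousOn_growthMain H.contA H.contB hR0
  have hcp := continuousOn_poisson hpR
  have hcq := continuousOn_poisson hqR
  have hci : ∀ {p : ℂ}, ‖p‖ < R →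
      CircleIntegrable (fun z => P p z * (3 * M - Real.log ‖f z‖)) 0 R := fun hp =>
    ContinuousOn.circleIntegrable hR0.le
      ((continuousOn_poisson hp).mul (continuousOn_const.sub hcf))
  set K1 := 4 * C ^ 2 + 1 with hK1
  have hK1pos : 0 < K1 := by positivity
  have hmain : ∀ z ∈ Metric.sphere (0 : ℂ) |R|, |Real.log ‖f z‖ - growthMain A B z| ≤
      C * Real.log R + (K1 / R) • (P p z * (3 * M - Real.log ‖f z‖) +
        P q z * (3 * M - Real.log ‖f z‖)) := by
    intro z hz
    rw [abs_of_pos hR0] at hz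
    simp only [mem_sphere_iff_norm, sub_zero] at hz
    have hnn : 0 ≤ 3 * M - Real.log ‖f z‖ := by linarith [hu z hz]
    have h1 := mul_nonneg (hPnn p z hpR hz) hnn
    have h2 := mul_nonneg (hPnn q z hqR hz) hnn
    rw [smul_eq_mul]
    rcases le_total C |z.re| with h | h
    · have h3 := (H.out z h).2
      rw [hz] at h3
      have : 0 ≤ (K1 / R) * (P p z * (3 * M - Real.log ‖f z‖) +
        P q z * (3 * M - Real.log ‖f z‖)) := by positivity
      linarith
    · have h3 : |Real.log ‖f z‖ - growthMain A B z| ≤ 3 * M - Real.log ‖f z‖ := by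
        have := abs_le.1 (hV z hz)
        have := hu z hz
        rw [abs_le]
        constructor <;> nlinarith
      have h4 : R / K1 ≤ P p z + P q z := by
        rcases le_total 0 z.im with him | him
        · have := poisson_lower (by linarith) hR2 hz h (y := R - 1) (Or.inl ⟨rfl, him⟩)
          have h5 := hPnn q z hqR hz
          have h6 : R / K1 ≤ P p z := this
          linarith
        · have := poisson_lower (by linarith) hR2 hz h (y := -(R - 1)) (Or.inr ⟨rfl, him⟩)
          have h5 := hPnn p z hpR hz
          have h6 : R / K1 ≤ P q z := this
          linarith
      have h5 : 1 ≤ (K1 / R) * (P p z + P q z) := by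
        calc (1 : ℝ) = (K1 / R) * (R / K1) := by field_simp
          _ ≤ _ := by gcongr
      calc _ ≤ 3 * M - Real.log ‖f z‖ := h3
        _ = 0 + 1 * (3 * M - Real.log ‖f z‖) := by ring
        _ ≤ C * Real.log R + (K1 / R) * (P p z + P q z) * (3 * M - Real.log ‖f z‖) := by
          gcongr; positivity
        _ = _ := by ring
  have hI1 := hci hpR
  have hI2 := hci hqR
  have hI3 := hI1.fun_add hI2
  have hI4 : CircleIntegrable (fun z => (K1 / R) • (P p z * (3 * M - Real.log ‖f z‖) +
        P q z * (3 * M - Real.log ‖f z‖))) 0 R := hI3.const_fun_smul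
  have hIc : CircleIntegrable (fun _ : ℂ => C * Real.log R) 0 R :=
    ContinuousOn.circleIntegrable hR0.le continuousOn_const
  refine (Real.circleAverage_mono (ContinuousOn.circleIntegrable hR0.le (hcf.sub hcV).abs)
    (hIc.fun_add hI4) hmain).trans ?_
  rw [Real.circleAverage_fun_add hIc hI4, Real.circleAverage_fun_smul,
    Real.circleAverage_fun_add hI1 hI2, Real.circleAverage_const]
  have h1 := hpoint p rfl hpR
  have h2 := hpoint q rfl hqR
  calc _ ≤ C * Real.log R + (K1 / R) • (4 * M + 4 * M) := by
        simp only [smul_eq_mul]; gcongr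
    _ = _ := by
        simp only [smul_eq_mul, hM]; field_simp; ring

end GrowthHyp

/-- The integrated counting function of the zeros of `f`, as in Jensen's formula. -/
def jensenCount (f : ℂ → ℂ) (R : ℝ) : ℝ :=
  Real.log ‖f 0‖ + ∑ a ∈ zerosBall f R, (analyticOrderNatAt f a : ℝ) * Real.log (R / ‖a‖)

theorem exists_radius_ne_zero {f : ℂ → ℂ} (hf : Differentiable ℂ f) (h0 : f 0 ≠ 0) {x y : ℝ}
    (hxy : x < y) : ∃ R, x < R ∧ R < y ∧ ∀ z, ‖z‖ = R → f z ≠ 0 := by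
  have hfin : ((fun z : ℂ => ‖z‖) '' {z : ℂ | f z = 0 ∧ ‖z‖ ≤ y}).Finite :=
    (finite_zeros_closedBall hf h0 y).image _
  obtain ⟨R, hR, hRn⟩ := (Set.Ioo_infinite hxy).exists_notMem_finite hfin
  refine ⟨R, hR.1, hR.2, fun z hz hfz => hRn ⟨z, ⟨hfz, hz.le.trans hR.2.le⟩, hz⟩⟩

theorem jensenCount_eq {f : ℂ → ℂ} (hf : Differentiable ℂ f) (h0 : f 0 ≠ 0) {R R' : ℝ}
    (hR : 0 < R) (hRR' : R ≤ R') : jensenCount f R = Real.log ‖f 0‖ +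
      ∑ a ∈ zerosBall f R', (analyticOrderNatAt f a : ℝ) * max 0 (Real.log (R / ‖a‖)) := by
  unfold jensenCount
  congr 1
  have hsub : zerosBall f R ⊆ zerosBall f R' := fun a ha => by
    rw [mem_zerosBall hf h0] at ha ⊢
    exact ⟨ha.1, ha.2.trans_le hRR'⟩
  rw [← Finset.sum_subset hsub]
  · refine Finset.sum_congr rfl fun a ha => ?_
    rw [mem_zerosBall hf h0] at ha
    have ha0 : 0 < ‖a‖ := norm_pos_iff.2 fun h => h0 (h ▸ ha.1)
    rw [max_eq_right (Real.log_nonneg ((one_le_div ha0).2 ha.2.le))]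
  · intro a ha' ha
    rw [mem_zerosBall hf h0] at ha ha'
    have ha0 : 0 < ‖a‖ := norm_pos_iff.2 fun h => h0 (h ▸ ha'.1)
    have : R ≤ ‖a‖ := not_lt.1 fun h => ha ⟨ha'.1, h⟩
    rw [max_eq_left (Real.log_nonpos (by positivity) ((div_le_one ha0).2 this)), mul_zero]

theorem jensenCount_mono {f : ℂ → ℂ} (hf : Differentiable ℂ f) (h0 : f 0 ≠ 0) {R R' : ℝ}
    (hR : 0 < R) (hRR' : R ≤ R') : jensenCount f R ≤ jensenCount f R' := by
  rw [jensenCount_eq hf h0 hR hRR', jensenCount_eq hf h0 (hR.trans_le hRR') le_rfl]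
  gcongr with a ha
  · rw [mem_zerosBall hf h0] at ha
    exact div_pos hR (norm_pos_iff.2 fun h => h0 (h ▸ ha.1))

theorem circleAverage_growthMain {A B : ℂ → ℝ} (hA : Continuous A) (hB : Continuous B)
    (homA : ∀ (t : ℝ) (z : ℂ), 0 < t → A (t * z) = t * A z)
    (homB : ∀ (t : ℝ) (z : ℂ), 0 < t → B (t * z) = t * B z) {R : ℝ} (hR : 0 < R) :
    Real.circleAverage (growthMain A B) 0 R = Real.circleAverage A 0 1 * (R * Real.log R) +
      Real.circleAverage B 0 1 * R := by
  rw [Real.circleAverage_eq_circleAverage_zero_one]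
  have e : Set.EqOn (fun z : ℂ => growthMain A B (R * z + 0))
      (fun z => (R * Real.log R) • A z + R • B z) (Metric.sphere 0 |1|) := by
    intro z hz
    simp only [mem_sphere_iff_norm, sub_zero, abs_one] at hz
    simp only [growthMain, add_zero, homA R z hR, homB R z hR, norm_mul, norm_real, hz,
      Real.norm_of_nonneg hR.le, smul_eq_mul]
    ring_nf
  rw [Real.circleAverage_congr_sphere e, Real.circleAverage_fun_add,
    Real.circleAverage_fun_smul, Real.circleAverage_fun_smul]
  · simp only [smul_eq_mul]; ring
  · exact (hA.const_smul (R * Real.log R)).continuousOn.circleIntegrable zero_le_one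
  · exact (hB.const_smul R).continuousOn.circleIntegrable zero_le_one

namespace GrowthHyp

variable {f : ℂ → ℂ} {A B : ℂ → ℝ} {C : ℝ}

theorem abs_jensenCount_sub_le_of_ne_zero (H : GrowthHyp f A B C) :
    ∃ K : ℝ, 3 ≤ K ∧ ∀ R, K ≤ R → (∀ z, ‖z‖ = R → f z ≠ 0) →
      |jensenCount f R - (Real.circleAverage A 0 1 * (R * Real.log R) +
      Real.circleAverage B 0 1 * R)| ≤ K * Real.log R := by
  obtain ⟨K, hK3, hK⟩ := H.circleAverage_abs_sub_le
  refine ⟨K, hK3, fun R hKR hs => le_trans ?_ (hK R hKR hs)⟩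
  have hR : 0 < R := by linarith
  rw [jensenCount, ← circleAverage_log_norm_eq H.diff H.ne hR hs,
    ← circleAverage_growthMain H.contA H.contB H.homA H.homB hR,
    ← Real.circleAverage_fun_sub]
  · exact Real.abs_circleAverage_le_circleAverage_abs
  · exact (continuousOn_log_norm_sphere H.diff hs).circleIntegrable hR.le
  · exact (continuousOn_growthMain H.contA H.contB hR).circleIntegrable hR.le

theorem log_add_one_sub_log_le {x : ℝ} (hx : 0 < x) : Real.log (x + 1) - Real.log x ≤ 1 / x := by
  rw [← Real.log_div (by positivity) hx.ne']
  refine (Real.log_le_sub_one_of_pos (by positivity)).trans (le_of_eq ?_)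
  field_simp
  ring

/-- The main term `a x log x + b x` varies by `O(log x)` over an interval of length at most one. -/
theorem abs_mainTerm_sub_le {a b x y : ℝ} (hx : 3 ≤ x) (hxy : x ≤ y) (hyx : y ≤ x + 1) :
    |(a * (y * Real.log y) + b * y) - (a * (x * Real.log x) + b * x)| ≤
      (3 * |a| + |b|) * Real.log x := by
  have hlog := one_le_log_of_three_le hx
  have h1 : Real.log y - Real.log x ≤ 1 / x :=
    (sub_le_sub_right (Real.log_le_log (by linarith) hyx) _).trans
      (log_add_one_sub_log_le (by linarith))
  have h2 : Real.log x ≤ Real.log y := Real.log_le_log (by linarith) hxy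
  have h3 : y * Real.log y - x * Real.log x ≤ 3 * Real.log x := by
    have e1 : y * Real.log y - x * Real.log x =
      y * (Real.log y - Real.log x) + (y - x) * Real.log x := by ring
    have e2 : y * (Real.log y - Real.log x) ≤ (x + 1) * (1 / x) := by
      apply mul_le_mul hyx h1 (by linarith) (by linarith)
    have e3 : (x + 1) * (1 / x) ≤ 2 := by
      rw [mul_one_div, div_le_iff₀ (by linarith)]; linarith
    have e4 : (y - x) * Real.log x ≤ 1 * Real.log x := by gcongr; linarith
    linarith
  have h4 : 0 ≤ y * Real.log y - x * Real.log x := by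
    have hy : 0 ≤ y := by linarith
    have : x * Real.log x ≤ y * Real.log y := by gcongr
    linarith
  calc _ = |a * (y * Real.log y - x * Real.log x) + b * (y - x)| := by ring_nf
    _ ≤ |a| * |y * Real.log y - x * Real.log x| + |b| * |y - x| := by
      rw [← abs_mul, ← abs_mul]; exact abs_add_le _ _
    _ ≤ |a| * (3 * Real.log x) + |b| * Real.log x := by
      rw [abs_of_nonneg h4, abs_of_nonneg (by linarith : 0 ≤ y - x)]
      gcongr; linarith
    _ = _ := by ring

theorem abs_jensenCount_sub_le (H : GrowthHyp f A B C) :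
    ∃ a b K : ℝ, 3 ≤ K ∧ ∀ R, K ≤ R →
      |jensenCount f R - (a * (R * Real.log R) + b * R)| ≤ K * Real.log R := by
  obtain ⟨K, hK3, hK⟩ := H.abs_jensenCount_sub_le_of_ne_zero
  set a := Real.circleAverage A 0 1
  set b := Real.circleAverage B 0 1
  have hab : 0 ≤ 3 * |a| + |b| := by positivity
  refine ⟨a, b, 2 * K + 1 + (3 * |a| + |b|), by linarith, fun R hR => ?_⟩
  have hlogR := one_le_log_of_three_le (by linarith : 3 ≤ R)
  obtain ⟨R1, h1, h1', hs1⟩ := exists_radius_ne_zero H.diff H.ne (by linarith : R - 1 < R)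
  obtain ⟨R2, h2, h2', hs2⟩ := exists_radius_ne_zero H.diff H.ne (by linarith : R < R + 1)
  have e1 := abs_le.1 (hK R1 (by linarith) hs1)
  have e2 := abs_le.1 (hK R2 (by linarith) hs2)
  have m1 := jensenCount_mono H.diff H.ne (by linarith : 0 < R1) h1'.le
  have m2 := jensenCount_mono H.diff H.ne (by linarith : 0 < R) h2.le
  have d1 := abs_le.1 (abs_mainTerm_sub_le (a := a) (b := b) (by linarith : 3 ≤ R1) h1'.le
    (by linarith))
  have d2 := abs_le.1 (abs_mainTerm_sub_le (a := a) (b := b) (by linarith : 3 ≤ R) h2.le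
    (by linarith))
  have l1 : Real.log R1 ≤ Real.log R := Real.log_le_log (by linarith) h1'.le
  have l2 : Real.log R2 ≤ 2 * Real.log R := by
    rw [← Real.log_rpow (by linarith)]
    refine Real.log_le_log (by linarith) ?_
    norm_num
    nlinarith
  have k1 : K * Real.log R1 ≤ K * Real.log R := by gcongr
  have k2 : K * Real.log R2 ≤ K * (2 * Real.log R) := by gcongr
  have k3 : (3 * |a| + |b|) * Real.log R1 ≤ (3 * |a| + |b|) * Real.log R := by gcongr
  have e : (2 * K + 1 + (3 * |a| + |b|)) * Real.log R =
    2 * (K * Real.log R) + Real.log R + (3 * |a| + |b|) * Real.log R := by ring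
  have k4 : 0 ≤ K * Real.log R := by positivity
  rw [abs_le, e]
  constructor <;> linarith [e1.1, e1.2, e2.1, e2.2, d1.1, d1.2, d2.1, d2.2]

/-- The number of zeros in a disc, with multiplicity. -/
theorem sum_order_le (H : GrowthHyp f A B C) : ∃ K : ℝ, 3 ≤ K ∧ ∀ R, K ≤ R →
    ∑ a ∈ zerosBall f R, (analyticOrderNatAt f a : ℝ) ≤ K * (R * Real.log R) := by
  obtain ⟨a, b, K, hK3, hK⟩ := H.abs_jensenCount_sub_le
  refine ⟨|Real.log ‖f 0‖| + 6 * |a| + 3 * |b| + 2 * K, ?_, fun R hR => ?_⟩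
  · have : 0 ≤ |Real.log ‖f 0‖| + 6 * |a| + 3 * |b| := by positivity
    linarith
  have hpos : 0 ≤ |Real.log ‖f 0‖| + 6 * |a| + 3 * |b| := by positivity
  have hR3 : 3 ≤ R := by linarith
  have hlogR := one_le_log_of_three_le hR3
  have l2 : Real.log (3 * R) ≤ 2 * Real.log R := by
    rw [Real.log_mul (by norm_num) (by linarith)]
    linarith [Real.log_le_log (by norm_num) hR3]
  have l3 : 0 ≤ Real.log (3 * R) := Real.log_nonneg (by linarith)
  have hle : Real.log ‖f 0‖ + ∑ a ∈ zerosBall f R, (analyticOrderNatAt f a : ℝ) ≤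
      jensenCount f (3 * R) := by
    rw [jensenCount]
    gcongr
    have hsub : zerosBall f R ⊆ zerosBall f (3 * R) := fun a ha => by
      rw [mem_zerosBall H.diff H.ne] at ha ⊢
      exact ⟨ha.1, ha.2.trans_le (by linarith)⟩
    have hn0 : ∀ a ∈ zerosBall f (3 * R), 0 < ‖a‖ ∧ ‖a‖ < 3 * R := fun a ha => by
      rw [mem_zerosBall H.diff H.ne] at ha
      exact ⟨norm_pos_iff.2 fun h => H.ne (h ▸ ha.1), ha.2⟩
    refine le_trans ?_ (Finset.sum_le_sum_of_subset_of_nonneg hsub fun a ha _ =>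
      mul_nonneg (Nat.cast_nonneg _) (Real.log_nonneg ?_))
    · refine Finset.sum_le_sum fun a ha => ?_
      have ha' := hn0 a (hsub ha)
      rw [mem_zerosBall H.diff H.ne] at ha
      refine le_mul_of_one_le_right (Nat.cast_nonneg _) (one_le_log_of_three_le ?_)
      rw [le_div_iff₀ ha'.1]
      linarith [ha.2]
    · exact (one_le_div (hn0 a ha).1).2 (hn0 a ha).2.le
  have h1 := (abs_le.1 (hK (3 * R) (by linarith))).2
  have h2 := neg_abs_le (Real.log ‖f 0‖)
  have hRl : 1 ≤ R * Real.log R := by nlinarith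
  have hRl' : Real.log R ≤ R * Real.log R := by nlinarith
  have hRl'' : R ≤ R * Real.log R := by nlinarith
  have g1 : a * (3 * R * Real.log (3 * R)) ≤ |a| * (6 * (R * Real.log R)) := by
    calc _ ≤ |a| * (3 * R * Real.log (3 * R)) := by gcongr; exact le_abs_self a
      _ ≤ |a| * (3 * R * (2 * Real.log R)) := by gcongr
      _ = _ := by ring
  have g2 : b * (3 * R) ≤ |b| * (3 * (R * Real.log R)) := by
    calc _ ≤ |b| * (3 * R) := by gcongr; exact le_abs_self b
      _ ≤ _ := by gcongr
  have g3 : K * Real.log (3 * R) ≤ K * (2 * (R * Real.log R)) := by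
    gcongr; linarith
  have g4 : |Real.log ‖f 0‖| * 1 ≤ |Real.log ‖f 0‖| * (R * Real.log R) := by gcongr
  linarith

/-- A second difference of the main term `a x log x + b x` in the logarithmic scale. -/
theorem mainTerm_secondDiff_le {a b R δ : ℝ} (hR : 3 ≤ R) (hδ : 0 < δ) (hδ1 : δ ≤ 1) :
    (a * ((1 + δ) ^ 3 * R * Real.log ((1 + δ) ^ 3 * R)) + b * ((1 + δ) ^ 3 * R)) -
      2 * (a * ((1 + δ) * R * Real.log ((1 + δ) * R)) + b * ((1 + δ) * R)) +
      (a * (R / (1 + δ) * Real.log (R / (1 + δ))) + b * (R / (1 + δ))) ≤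
      (48 * |a| + 9 * |b|) * (R * Real.log R * δ ^ 2) := by
  set q := 1 + δ with hq
  have hq0 : 0 < q := by linarith
  have hq1 : 1 ≤ q := by linarith
  have hR0 : 0 < R := by linarith
  have hlogR := one_le_log_of_three_le hR
  have hh1 : 0 ≤ Real.log q := Real.log_nonneg hq1
  have hh2 : Real.log q ≤ δ := by
    have := Real.log_le_sub_one_of_pos hq0; linarith
  rw [Real.log_mul (by positivity) hR0.ne', Real.log_mul hq0.ne' hR0.ne',
    Real.log_div hR0.ne' hq0.ne', Real.log_pow]
  set L := Real.log R
  set h := Real.log q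
  have e : (a * (q ^ 3 * R * ((3 : ℕ) * h + L)) + b * (q ^ 3 * R)) -
      2 * (a * (q * R * (h + L)) + b * (q * R)) + (a * (R / q * (L - h)) + b * (R / q)) =
      a * (R * L * ((q ^ 2 - 1) ^ 2 / q) + R * h * ((3 * q ^ 2 + 1) * (q ^ 2 - 1) / q)) +
        b * (R * ((q ^ 2 - 1) ^ 2 / q)) := by
    field_simp
    push_cast
    ring
  rw [e]
  have b1 : (q ^ 2 - 1) ^ 2 / q ≤ 9 * δ ^ 2 := by
    rw [div_le_iff₀ hq0]
    have : q ^ 2 - 1 = δ * (2 + δ) := by rw [hq]; ring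
    rw [this]
    have : (2 + δ) ^ 2 ≤ 9 := by nlinarith
    calc (δ * (2 + δ)) ^ 2 = δ ^ 2 * (2 + δ) ^ 2 := by ring
      _ ≤ δ ^ 2 * 9 := by gcongr
      _ ≤ δ ^ 2 * 9 * q := le_mul_of_one_le_right (by positivity) hq1
      _ = _ := by ring
  have b2 : (3 * q ^ 2 + 1) * (q ^ 2 - 1) / q ≤ 39 * δ := by
    rw [div_le_iff₀ hq0]
    have : q ^ 2 - 1 = δ * (2 + δ) := by rw [hq]; ring
    rw [this]
    have h3 : 3 * q ^ 2 + 1 ≤ 13 := by nlinarith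
    calc (3 * q ^ 2 + 1) * (δ * (2 + δ)) ≤ 13 * (δ * 3) := by gcongr; linarith
      _ = 39 * δ := by ring
      _ ≤ 39 * δ * q := le_mul_of_one_le_right (by positivity) hq1
  have n1 : 0 ≤ (q ^ 2 - 1) ^ 2 / q := by positivity
  have n2 : 0 ≤ (3 * q ^ 2 + 1) * (q ^ 2 - 1) / q := by
    have : 0 ≤ q ^ 2 - 1 := by nlinarith
    positivity
  have c1 : R * L * ((q ^ 2 - 1) ^ 2 / q) + R * h * ((3 * q ^ 2 + 1) * (q ^ 2 - 1) / q) ≤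
      48 * (R * L * δ ^ 2) := by
    calc _ ≤ R * L * (9 * δ ^ 2) + R * δ * (39 * δ) := by gcongr
      _ = 9 * (R * L * δ ^ 2) + 39 * (R * 1 * δ ^ 2) := by ring
      _ ≤ 9 * (R * L * δ ^ 2) + 39 * (R * L * δ ^ 2) := by gcongr
      _ = _ := by ring
  have c2 : R * ((q ^ 2 - 1) ^ 2 / q) ≤ 9 * (R * L * δ ^ 2) := by
    calc _ ≤ R * 1 * (9 * δ ^ 2) := by rw [mul_one]; gcongr
      _ ≤ R * L * (9 * δ ^ 2) := by gcongr
      _ = _ := by ring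
  calc _ ≤ |a| * (R * L * ((q ^ 2 - 1) ^ 2 / q) + R * h * ((3 * q ^ 2 + 1) * (q ^ 2 - 1) / q)) +
        |b| * (R * ((q ^ 2 - 1) ^ 2 / q)) := by
          gcongr
          · exact le_abs_self a
          · exact le_abs_self b
    _ ≤ |a| * (48 * (R * L * δ ^ 2)) + |b| * (9 * (R * L * δ ^ 2)) := by gcongr
    _ = _ := by ring

theorem log_le_secondDiff {R q r : ℝ} (hR : 0 < R) (hq : 1 ≤ q) (hr : 0 < r) :
    (if R ≤ r ∧ r < q * R then Real.log q else 0) ≤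
      max 0 (Real.log (q ^ 3 * R / r)) - 2 * max 0 (Real.log (q * R / r)) +
        max 0 (Real.log (R / q / r)) := by
  have hq0 : 0 < q := by linarith
  have hh : 0 ≤ Real.log q := Real.log_nonneg hq
  have e1 : Real.log (q ^ 3 * R / r) = 3 * Real.log q + Real.log (R / r) := by
    rw [mul_div_assoc, Real.log_mul (by positivity) (by positivity), Real.log_pow]; norm_num
  have e2 : Real.log (q * R / r) = Real.log q + Real.log (R / r) := by
    rw [mul_div_assoc, Real.log_mul (by positivity) (by positivity)]
  have e3 : Real.log (R / q / r) = Real.log (R / r) - Real.log q := by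
    rw [div_right_comm, Real.log_div (by positivity) (by positivity)]
  rw [e1, e2, e3]
  set h := Real.log q
  set x := Real.log (R / r) with hx
  split_ifs with hc
  · have hx0 : x ≤ 0 := Real.log_nonpos (by positivity) ((div_le_one hr).2 hc.1)
    have hx1 : 0 ≤ h + x := by
      rw [← e2]; exact Real.log_nonneg ((one_le_div hr).2 hc.2.le)
    rw [max_eq_right (by linarith : 0 ≤ 3 * h + x), max_eq_right hx1,
      max_eq_left (by linarith : x - h ≤ 0)]
    linarith
  · rcases le_total (h + x) 0 with h1 | h1
    · rw [max_eq_left h1]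
      have := le_max_left 0 (3 * h + x)
      have := le_max_left 0 (x - h)
      linarith
    · rw [max_eq_right h1]
      have := le_max_right 0 (3 * h + x)
      have := le_max_right 0 (x - h)
      linarith

/-- The number of zeros with `R ≤ ‖a‖ < R + √R` is `O(√R log R)`. -/
theorem sum_order_shell_le (H : GrowthHyp f A B C) : ∃ K : ℝ, 3 ≤ K ∧ ∀ R, K ≤ R →
    ∑ a ∈ zerosBall f (R + √R) with R ≤ ‖a‖, (analyticOrderNatAt f a : ℝ) ≤
      K * (√R * Real.log R) := by
  obtain ⟨a, b, K, hK3, hK⟩ := H.abs_jensenCount_sub_le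
  have hpos : 0 ≤ 48 * |a| + 9 * |b| := by positivity
  refine ⟨2 * (48 * |a| + 9 * |b| + 20 * K), by linarith, fun R hR => ?_⟩
  have hR3 : 3 ≤ R := by linarith
  have hR0 : 0 < R := by linarith
  have hlogR := one_le_log_of_three_le hR3
  set δ := 1 / √R with hδ
  have hsq : √R * √R = R := Real.mul_self_sqrt hR0.le
  have hs0 : 0 < √R := Real.sqrt_pos.2 hR0
  have hs1 : 1 ≤ √R := Real.one_le_sqrt.2 (by linarith)
  have hδ0 : 0 < δ := by positivity
  have hδ1 : δ ≤ 1 := by rw [hδ, div_le_one hs0]; exact hs1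
  have hδ2 : δ ^ 2 = 1 / R := by rw [hδ, div_pow, one_pow, pow_two, hsq]
  set q := 1 + δ with hq
  have hq0 : 0 < q := by linarith
  have hqR : R + √R = q * R := by
    rw [hq, hδ, add_mul, one_mul, div_mul_eq_mul_div, one_mul]
    congr 1
    rw [eq_div_iff hs0.ne', hsq]
  have hq1 : 1 ≤ q := by linarith
  have hq2 : q ≤ 2 := by linarith
  have hqq : q ≤ q ^ 3 := by nlinarith [mul_nonneg hq0.le hδ0.le]
  have hq8 : q ^ 3 ≤ 8 := by
    calc q ^ 3 ≤ 2 ^ 3 := by gcongr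
      _ = 8 := by norm_num
  have hlog : δ / 2 ≤ Real.log q := by
    have := Real.one_sub_inv_le_log_of_pos hq0
    refine le_trans ?_ this
    rw [hq, ← one_div, le_sub_iff_add_le, ← le_sub_iff_add_le', div_le_iff₀ (by linarith)]
    nlinarith
  have r1 : R ≤ q * R := by nlinarith
  have r2 : q * R ≤ q ^ 3 * R := by gcongr
  have r3 : R / q ≤ q ^ 3 * R := (div_le_self hR0.le hq1).trans (r1.trans r2)
  have hlow : R / 2 ≤ R / q := by gcongr
  have key : (∑ a ∈ zerosBall f (R + √R) with R ≤ ‖a‖, (analyticOrderNatAt f a : ℝ)) *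
      Real.log q ≤ jensenCount f (q ^ 3 * R) - 2 * jensenCount f (q * R) +
        jensenCount f (R / q) := by
    rw [jensenCount_eq H.diff H.ne (by positivity) le_rfl,
      jensenCount_eq H.diff H.ne (by positivity) r2,
      jensenCount_eq H.diff H.ne (by positivity) r3]
    have : ∀ x S1 S2 S3 : ℝ, x + S1 - 2 * (x + S2) + (x + S3) = S1 - 2 * S2 + S3 := by
      intros; ring
    rw [this, Finset.mul_sum, ← Finset.sum_sub_distrib, ← Finset.sum_add_distrib,
      Finset.sum_mul]
    have hsub : (zerosBall f (R + √R)).filter (fun a => R ≤ ‖a‖) ⊆ zerosBall f (q ^ 3 * R) := by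
      intro a ha
      rw [Finset.mem_filter, mem_zerosBall H.diff H.ne] at ha
      rw [mem_zerosBall H.diff H.ne]
      exact ⟨ha.1.1, ha.1.2.trans_le (hqR ▸ r2)⟩
    have hterm : ∀ a ∈ zerosBall f (q ^ 3 * R), (analyticOrderNatAt f a : ℝ) *
        (if R ≤ ‖a‖ ∧ ‖a‖ < q * R then Real.log q else 0) ≤
        (analyticOrderNatAt f a : ℝ) * max 0 (Real.log (q ^ 3 * R / ‖a‖)) -
          2 * ((analyticOrderNatAt f a : ℝ) * max 0 (Real.log (q * R / ‖a‖))) +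
          (analyticOrderNatAt f a : ℝ) * max 0 (Real.log (R / q / ‖a‖)) := by
      intro a ha
      rw [mem_zerosBall H.diff H.ne] at ha
      have ha0 : 0 < ‖a‖ := norm_pos_iff.2 fun h => H.ne (h ▸ ha.1)
      have := mul_le_mul_of_nonneg_left (log_le_secondDiff hR0 hq1 ha0)
        (Nat.cast_nonneg (α := ℝ) (analyticOrderNatAt f a))
      linarith
    refine le_trans ?_ (Finset.sum_le_sum hterm)
    refine le_trans ?_ (Finset.sum_le_sum_of_subset_of_nonneg hsub fun a ha _ => ?_)
    · refine le_of_eq (Finset.sum_congr rfl fun a ha => ?_)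
      rw [Finset.mem_filter, mem_zerosBall H.diff H.ne] at ha
      rw [if_pos ⟨ha.2, hqR ▸ ha.1.2⟩]
    · have := Real.log_nonneg hq1
      split_ifs <;> positivity
  have d1 := (abs_le.1 (hK (q ^ 3 * R) (by linarith))).2
  have d2 := (abs_le.1 (hK (q * R) (by linarith))).1
  have d3 := (abs_le.1 (hK (R / q) (by linarith))).2
  have d4 := mainTerm_secondDiff_le (a := a) (b := b) hR3 hδ0 hδ1
  rw [← hq] at d4
  have lb : ∀ x, 0 < x → x ≤ 8 * R → K * Real.log x ≤ K * (5 * Real.log R) := by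
    intro x hx hx8
    gcongr
    have e : Real.log (8 * R) = 3 * Real.log 2 + Real.log R := by
      rw [Real.log_mul (by norm_num) hR0.ne', show (8 : ℝ) = 2 ^ 3 by norm_num, Real.log_pow]
      norm_num
    have := Real.log_le_log hx hx8
    have := Real.log_two_lt_d9
    linarith
  have l1 := lb (q ^ 3 * R) (by positivity) (by gcongr)
  have l2 := lb (q * R) (by positivity) (by gcongr; linarith)
  have l3 := lb (R / q) (by positivity) ((div_le_self hR0.le hq1).trans (by linarith))
  have hmain : R * Real.log R * δ ^ 2 = Real.log R := by rw [hδ2]; field_simp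
  rw [hmain] at d4
  set n := ∑ a ∈ zerosBall f (R + √R) with R ≤ ‖a‖, (analyticOrderNatAt f a : ℝ) with hn
  have hn0 : 0 ≤ n := Finset.sum_nonneg fun _ _ => Nat.cast_nonneg _
  have f1 : n * (δ / 2) ≤ (48 * |a| + 9 * |b| + 20 * K) * Real.log R := by
    have : n * (δ / 2) ≤ n * Real.log q := by gcongr
    linarith
  calc n = n * (δ / 2) * (2 * √R) := by rw [hδ]; field_simp
    _ ≤ (48 * |a| + 9 * |b| + 20 * K) * Real.log R * (2 * √R) := by gcongr
    _ = _ := by ring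

end GrowthHyp

theorem norm_circleAverage_le_circleAverage_norm {u : ℂ → ℂ} {c : ℂ} {R : ℝ} :
    ‖Real.circleAverage u c R‖ ≤ Real.circleAverage (fun z => ‖u z‖) c R := by
  rw [Real.circleAverage, Real.circleAverage, norm_smul, smul_eq_mul,
    Real.norm_of_nonneg (by positivity)]
  gcongr
  exact intervalIntegral.norm_integral_le_integral_norm (by positivity)

theorem circleAverage_eq_zero_of_odd {u : ℂ → ℂ} {R : ℝ} (hu : ∀ z, u (-z) = -u z) :
    Real.circleAverage u 0 R = 0 := by
  have h1 : Real.circleAverage u 0 (-R) = Real.circleAverage u 0 R :=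
    Real.circleAverage_neg_radius
  rw [Real.circleAverage_eq_circleAverage_zero_one,
    Real.circleAverage_eq_circleAverage_zero_one (R := R)] at h1
  have e : (fun z : ℂ => u (((-R : ℝ) : ℂ) * z + 0)) =
      fun z : ℂ => (-1 : ℂ) • u ((R : ℂ) * z + 0) := by
    ext z
    rw [neg_one_smul, ← hu]
    congr 1
    push_cast; ring
  rw [e, Real.circleAverage_fun_smul, neg_one_smul] at h1
  rw [Real.circleAverage_eq_circleAverage_zero_one]
  exact self_eq_neg.1 h1.symm

theorem norm_div_pow_eq_one {R : ℝ} (hR : 0 < R) {z : ℂ} (hz : ‖z‖ = R) (k : ℕ) :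
    ‖((R : ℂ) / z) ^ k‖ = 1 := by
  rw [norm_pow, norm_div, hz, norm_real, Real.norm_of_nonneg hR.le, div_self hR.ne', one_pow]

theorem sqrt_mul_div_self {x : ℝ} (hx : 0 < x) (l : ℝ) : √x * l / x = l / √x := by
  have h := Real.mul_self_sqrt hx.le
  rw [div_eq_div_iff hx.ne' (Real.sqrt_pos.2 hx).ne']
  linear_combination l * h

theorem log_two_mul_le {x : ℝ} (hx : 3 ≤ x) : Real.log (2 * x) ≤ 2 * Real.log x := by
  rw [Real.log_mul (by norm_num) (by linarith)]
  have := Real.log_le_log (by norm_num) (by linarith : (2 : ℝ) ≤ x)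
  linarith

namespace GrowthHyp

variable {f : ℂ → ℂ} {A B : ℂ → ℝ} {C : ℝ}

theorem norm_circleAverage_log_mul_le (H : GrowthHyp f A B C) :
    ∃ K : ℝ, 3 ≤ K ∧ ∀ R, K ≤ R → (∀ z, ‖z‖ = R → f z ≠ 0) → ∀ k : ℕ,
      ‖Real.circleAverage (fun z => (Real.log ‖f z‖ : ℂ) * ((R : ℂ) / z) ^ (k + 1)) 0 R‖
        ≤ K * (R * Real.log R) := by
  obtain ⟨K, hK3, hK⟩ := H.circleAverage_abs_sub_le
  have hC := H.three_le
  refine ⟨K + 2 * C, by linarith, fun R hR hs k => ?_⟩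
  have hR3 : 3 ≤ R := by linarith
  have hR0 : 0 < R := by linarith
  have hlogR := one_le_log_of_three_le hR3
  have hI1 : CircleIntegrable (fun z => |Real.log ‖f z‖ - growthMain A B z|) 0 R :=
    ((continuousOn_log_norm_sphere H.diff hs).sub
      (continuousOn_growthMain H.contA H.contB hR0)).abs.circleIntegrable hR0.le
  have hIc : CircleIntegrable (fun _ : ℂ => 2 * C * (R * Real.log R)) 0 R :=
    ContinuousOn.circleIntegrable hR0.le continuousOn_const
  refine norm_circleAverage_le_circleAverage_norm.trans ?_
  have hle : Real.circleAverage
      (fun z => ‖(Real.log ‖f z‖ : ℂ) * ((R : ℂ) / z) ^ (k + 1)‖) 0 R ≤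
      Real.circleAverage (fun z => |Real.log ‖f z‖ - growthMain A B z| +
        2 * C * (R * Real.log R)) 0 R := by
    have e : Set.EqOn (fun z => ‖(Real.log ‖f z‖ : ℂ) * ((R : ℂ) / z) ^ (k + 1)‖)
        (fun z => |Real.log ‖f z‖|) (Metric.sphere 0 |R|) := by
      intro z hz
      rw [abs_of_pos hR0] at hz
      simp only [mem_sphere_iff_norm, sub_zero] at hz
      simp only
      rw [norm_mul, norm_div_pow_eq_one hR0 hz, mul_one, norm_real, Real.norm_eq_abs]
    rw [Real.circleAverage_congr_sphere e]
    refine Real.circleAverage_mono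
      ((continuousOn_log_norm_sphere H.diff hs).abs.circleIntegrable hR0.le)
      (hI1.fun_add hIc) fun z hz => ?_
    rw [abs_of_pos hR0] at hz
    simp only [mem_sphere_iff_norm, sub_zero] at hz
    have h1 := H.abs_growthMain_le (z := z) (by rwa [hz])
    rw [hz] at h1
    have h2 := abs_add_le (Real.log ‖f z‖ - growthMain A B z) (growthMain A B z)
    rw [sub_add_cancel] at h2
    linarith
  refine hle.trans ?_
  rw [Real.circleAverage_fun_add hI1 hIc, Real.circleAverage_const]
  have h1 := hK R (by linarith) hs
  have h2 : K * Real.log R ≤ K * (R * Real.log R) := by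
    gcongr; nlinarith
  linarith

theorem norm_circleAverage_log_mul_inv_le (H : GrowthHyp f A B C) :
    ∃ K : ℝ, 3 ≤ K ∧ ∀ R, K ≤ R → (∀ z, ‖z‖ = R → f z ≠ 0) →
      ‖Real.circleAverage (fun z => (Real.log ‖f z‖ : ℂ) * ((R : ℂ) / z) ^ 1) 0 R‖
        ≤ K * Real.log R := by
  obtain ⟨K, hK3, hK⟩ := H.circleAverage_abs_sub_le
  refine ⟨K, hK3, fun R hR hs => le_trans ?_ (hK R hR hs)⟩
  have hR0 : 0 < R := by linarith
  have hz0 : ∀ z ∈ Metric.sphere (0 : ℂ) R, z ≠ 0 := by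
    rintro z hz rfl
    simp only [mem_sphere_iff_norm, sub_zero, norm_zero] at hz
    exact hR0.ne hz
  have hodd : Real.circleAverage
      (fun z => (growthMain A B z : ℂ) * ((R : ℂ) / z) ^ 1) 0 R = 0 := by
    apply circleAverage_eq_zero_of_odd
    intro z
    simp only [growthMain, norm_neg, H.evenA, H.evenB, div_neg, pow_one, mul_neg]
  have hpow : ContinuousOn (fun z : ℂ => ((R : ℂ) / z) ^ 1) (Metric.sphere 0 R) :=
    (continuousOn_const.div continuousOn_id hz0).pow _
  have e1 : Real.circleAverage (fun z => (Real.log ‖f z‖ : ℂ) * ((R : ℂ) / z) ^ 1 -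
      (growthMain A B z : ℂ) * ((R : ℂ) / z) ^ 1) 0 R =
      Real.circleAverage (fun z => (Real.log ‖f z‖ : ℂ) * ((R : ℂ) / z) ^ 1) 0 R -
      Real.circleAverage (fun z => (growthMain A B z : ℂ) * ((R : ℂ) / z) ^ 1) 0 R :=
    Real.circleAverage_fun_sub
      (((continuous_ofReal.comp_continuousOn (continuousOn_log_norm_sphere H.diff hs)).mul
        hpow).circleIntegrable hR0.le)
      (((continuous_ofReal.comp_continuousOn (continuousOn_growthMain H.contA H.contB hR0)).mul
        hpow).circleIntegrable hR0.le)
  rw [hodd, sub_zero] at e1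
  rw [← e1]
  refine norm_circleAverage_le_circleAverage_norm.trans (le_of_eq ?_)
  refine Real.circleAverage_congr_sphere fun z hz => ?_
  rw [abs_of_pos hR0] at hz
  simp only [mem_sphere_iff_norm, sub_zero] at hz
  rw [← sub_mul, norm_mul, norm_div_pow_eq_one hR0 hz, mul_one, ← ofReal_sub, norm_real,
    Real.norm_eq_abs]

theorem sum_zerosBall_pow_close_of_pos (H : GrowthHyp f A B C) {k : ℕ} (hk : 1 ≤ k) :
    ∃ K : ℝ, 3 ≤ K ∧ ∀ R, K ≤ R → (∀ z, ‖z‖ = R → f z ≠ 0) →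
      ‖∑ a ∈ zerosBall f R, (analyticOrderNatAt f a : ℂ) * a⁻¹ ^ (k + 1) +
        iteratedDeriv k (fun z => deriv f z / f z) 0 / (k.factorial : ℂ)‖ ≤
        K * (Real.log R / √R) := by
  obtain ⟨K1, hK13, hK1⟩ := H.norm_circleAverage_log_mul_le
  obtain ⟨K2, hK23, hK2⟩ := H.sum_order_le
  refine ⟨2 * (k + 1) * K1 + K2, ?_, fun R hR hs => ?_⟩
  · have : 0 ≤ 2 * ((k : ℝ) + 1) * K1 := by positivity
    linarith
  have hk0 : (0 : ℝ) ≤ k := by positivity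
  have hRK1 : K1 ≤ R := by nlinarith
  have hRK2 : K2 ≤ R := by
    have : 0 ≤ 2 * ((k : ℝ) + 1) * K1 := by positivity
    linarith
  have hR3 : 3 ≤ R := by linarith
  have hR0 : 0 < R := by linarith
  have hlogR := one_le_log_of_three_le hR3
  have hsum := sum_zerosBall_pow_eq H.diff H.ne hR0 hs k
  have e : ∑ a ∈ zerosBall f R, (analyticOrderNatAt f a : ℂ) * a⁻¹ ^ (k + 1) +
        iteratedDeriv k (fun z => deriv f z / f z) 0 / (k.factorial : ℂ) =
      2 * (k + 1) / (R : ℂ) ^ (k + 1) *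
          Real.circleAverage (fun z => (Real.log ‖f z‖ : ℂ) * ((R : ℂ) / z) ^ (k + 1)) 0 R +
      ∑ a ∈ zerosBall f R, (analyticOrderNatAt f a : ℂ) *
        ((starRingEnd ℂ) a / (R : ℂ) ^ 2) ^ (k + 1) := by
    simp only [mul_sub, Finset.sum_sub_distrib] at hsum
    linear_combination hsum
  rw [e]
  have hs0 : 0 < √R := Real.sqrt_pos.2 hR0
  have hs1 : 1 ≤ √R := Real.one_le_sqrt.2 (by linarith)
  have hsR : √R ≤ R := by nlinarith [Real.mul_self_sqrt hR0.le]
  have hpow : R * R ≤ R ^ (k + 1) := by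
    rw [← pow_two]
    exact pow_le_pow_right₀ (by linarith) (by omega)
  have hq : R * Real.log R / R ^ (k + 1) ≤ Real.log R / √R := by
    calc R * Real.log R / R ^ (k + 1) ≤ R * Real.log R / (R * R) := by gcongr
      _ = Real.log R / R := by field_simp
      _ ≤ _ := by gcongr
  have b1 : ‖2 * ((k : ℂ) + 1) / (R : ℂ) ^ (k + 1) * Real.circleAverage
      (fun z => (Real.log ‖f z‖ : ℂ) * ((R : ℂ) / z) ^ (k + 1)) 0 R‖ ≤
      2 * (k + 1) * K1 * (Real.log R / √R) := by
    rw [norm_mul, norm_div, norm_pow, norm_real, Real.norm_of_nonneg hR0.le]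
    have : ‖(2 : ℂ) * ((k : ℂ) + 1)‖ = 2 * (k + 1) := by
      rw [norm_mul, Complex.norm_two, show (k : ℂ) + 1 = ((k + 1 : ℕ) : ℂ) by push_cast; rfl,
        Complex.norm_natCast]
      push_cast; rfl
    rw [this]
    calc _ ≤ 2 * ((k : ℝ) + 1) / R ^ (k + 1) * (K1 * (R * Real.log R)) := by
          gcongr; exact hK1 R hRK1 hs k
      _ = 2 * (k + 1) * K1 * (R * Real.log R / R ^ (k + 1)) := by ring
      _ ≤ _ := by gcongr
  have b2 : ‖∑ a ∈ zerosBall f R, (analyticOrderNatAt f a : ℂ) *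
        ((starRingEnd ℂ) a / (R : ℂ) ^ 2) ^ (k + 1)‖ ≤ K2 * (Real.log R / √R) := by
    have hterm : ∀ a ∈ zerosBall f R, ‖(analyticOrderNatAt f a : ℂ) *
        ((starRingEnd ℂ) a / (R : ℂ) ^ 2) ^ (k + 1)‖ ≤
        (analyticOrderNatAt f a : ℝ) * (1 / R ^ (k + 1)) := by
      intro a ha
      rw [mem_zerosBall H.diff H.ne] at ha
      rw [norm_mul, Complex.norm_natCast, norm_pow, norm_div, norm_conj, norm_pow, norm_real,
        Real.norm_of_nonneg hR0.le]
      have : ‖a‖ / R ^ 2 ≤ 1 / R := by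
        rw [div_le_div_iff₀ (by positivity) hR0]
        nlinarith [ha.2]
      rw [← one_div_pow]
      gcongr
    calc _ ≤ ∑ a ∈ zerosBall f R, (analyticOrderNatAt f a : ℝ) * (1 / R ^ (k + 1)) :=
          norm_sum_le_of_le _ hterm
      _ = (∑ a ∈ zerosBall f R, (analyticOrderNatAt f a : ℝ)) * (1 / R ^ (k + 1)) := by
          rw [Finset.sum_mul]
      _ ≤ K2 * (R * Real.log R) * (1 / R ^ (k + 1)) := by
          gcongr; exact hK2 R hRK2
      _ = K2 * (R * Real.log R / R ^ (k + 1)) := by ring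
      _ ≤ _ := by gcongr
  calc _ ≤ _ := norm_add_le _ _
    _ ≤ 2 * (k + 1) * K1 * (Real.log R / √R) + K2 * (Real.log R / √R) := add_le_add b1 b2
    _ = _ := by ring

theorem smoothed_sum_close (H : GrowthHyp f A B C) :
    ∃ K : ℝ, 3 ≤ K ∧ ∀ R, K ≤ R → (∀ z, ‖z‖ = R → f z ≠ 0) →
      ‖∑ a ∈ zerosBall f R, (analyticOrderNatAt f a : ℂ) * (((R : ℂ) ^ 2 - ‖a‖ ^ 2) * a⁻¹) +
        (R : ℂ) ^ 2 * (deriv f 0 / f 0)‖ ≤ K * (R * Real.log R) := by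
  obtain ⟨K1, hK13, hK1⟩ := H.norm_circleAverage_log_mul_inv_le
  refine ⟨2 * K1, by linarith, fun R hR hs => ?_⟩
  have hR0 : 0 < R := by linarith
  have hRC : (R : ℂ) ≠ 0 := by exact_mod_cast hR0.ne'
  have hsum := sum_zerosBall_pow_eq H.diff H.ne hR0 hs 0
  have e : ∑ a ∈ zerosBall f R, (analyticOrderNatAt f a : ℂ) * (((R : ℂ) ^ 2 - ‖a‖ ^ 2) * a⁻¹) +
        (R : ℂ) ^ 2 * (deriv f 0 / f 0) = 2 * R *
        Real.circleAverage (fun z => (Real.log ‖f z‖ : ℂ) * ((R : ℂ) / z) ^ 1) 0 R := by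
    have e1 : ∑ a ∈ zerosBall f R, (analyticOrderNatAt f a : ℂ) *
        (((R : ℂ) ^ 2 - ‖a‖ ^ 2) * a⁻¹) =
        (R : ℂ) ^ 2 * ∑ a ∈ zerosBall f R, (analyticOrderNatAt f a : ℂ) *
        (a⁻¹ ^ (0 + 1) - ((starRingEnd ℂ) a / (R : ℂ) ^ 2) ^ (0 + 1)) := by
      rw [Finset.mul_sum]
      refine Finset.sum_congr rfl fun a ha => ?_
      rw [mem_zerosBall H.diff H.ne] at ha
      have ha0 : a ≠ 0 := fun h => H.ne (h ▸ ha.1)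
      have : (‖a‖ : ℂ) ^ 2 = (starRingEnd ℂ) a * a := by
        rw [mul_comm, mul_conj, normSq_eq_norm_sq]; push_cast; rfl
      rw [this]
      simp only [zero_add, pow_one]
      field_simp
    rw [e1, hsum]
    simp only [iteratedDeriv_zero, Nat.factorial_zero, Nat.cast_one, div_one, zero_add,
      CharP.cast_eq_zero]
    field_simp
    ring
  rw [e, norm_mul, norm_mul, Complex.norm_two, norm_real, Real.norm_of_nonneg hR0.le]
  calc _ ≤ 2 * R * (K1 * Real.log R) := by gcongr; exact hK1 R (by linarith) hs
    _ = _ := by ring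

theorem sum_zerosBall_inv_close (H : GrowthHyp f A B C) :
    ∃ K : ℝ, 3 ≤ K ∧ ∀ R, K ≤ R → (∀ z, ‖z‖ = R → f z ≠ 0) →
      ‖∑ a ∈ zerosBall f R, (analyticOrderNatAt f a : ℂ) * a⁻¹ + deriv f 0 / f 0‖ ≤
        K * (Real.log R / √R) := by
  obtain ⟨K1, hK13, hK1⟩ := H.smoothed_sum_close
  obtain ⟨K2, hK23, hK2⟩ := H.sum_order_shell_le
  refine ⟨5 * K1 + K2, by linarith, fun R hR hs => ?_⟩
  have hR3 : 3 ≤ R := by linarith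
  have hR0 : 0 < R := by linarith
  have hlogR := one_le_log_of_three_le hR3
  have hs0 : 0 < √R := Real.sqrt_pos.2 hR0
  have hss : √R * √R = R := Real.mul_self_sqrt hR0.le
  have hs1 : 1 ≤ √R := Real.one_le_sqrt.2 (by linarith)
  have hsR : √R ≤ R := by nlinarith
  obtain ⟨R2, h2, h2', hs2⟩ := exists_radius_ne_zero H.diff H.ne
    (by linarith : R + √R / 2 < R + √R)
  set L := deriv f 0 / f 0
  have b1 := hK1 R (by linarith) hs
  have b2 := hK1 R2 (by linarith) hs2
  have hsub : zerosBall f R ⊆ zerosBall f R2 := fun a ha => by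
    rw [mem_zerosBall H.diff H.ne] at ha ⊢
    exact ⟨ha.1, ha.2.trans_le (by linarith)⟩
  have hd : R * √R ≤ R2 ^ 2 - R ^ 2 := by nlinarith
  have hdpos : 0 < R2 ^ 2 - R ^ 2 := lt_of_lt_of_le (by positivity) hd
  set Sh := zerosBall f R2 \ zerosBall f R with hSh
  have hShmem : ∀ a ∈ Sh, f a = 0 ∧ ‖a‖ < R2 ∧ R ≤ ‖a‖ := by
    intro a ha
    rw [hSh, Finset.mem_sdiff, mem_zerosBall H.diff H.ne, mem_zerosBall H.diff H.ne] at ha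
    exact ⟨ha.1.1, ha.1.2, not_lt.1 fun h => ha.2 ⟨ha.1.1, h⟩⟩
  have b3 : ‖∑ a ∈ Sh, (analyticOrderNatAt f a : ℂ) * (((R2 : ℂ) ^ 2 - ‖a‖ ^ 2) * a⁻¹)‖ ≤
      K2 * (√R * Real.log R) * ((R2 ^ 2 - R ^ 2) / R) := by
    have hterm : ∀ a ∈ Sh, ‖(analyticOrderNatAt f a : ℂ) *
        (((R2 : ℂ) ^ 2 - ‖a‖ ^ 2) * a⁻¹)‖ ≤
        (analyticOrderNatAt f a : ℝ) * ((R2 ^ 2 - R ^ 2) / R) := by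
      intro a ha
      obtain ⟨-, h3, h4⟩ := hShmem a ha
      have e : ‖((R2 : ℂ) ^ 2 - ‖a‖ ^ 2)‖ = R2 ^ 2 - ‖a‖ ^ 2 := by
        rw [show ((R2 : ℂ) ^ 2 - ‖a‖ ^ 2) = ((R2 ^ 2 - ‖a‖ ^ 2 : ℝ) : ℂ) by push_cast; rfl,
          norm_real, Real.norm_of_nonneg]
        nlinarith [norm_nonneg a]
      rw [norm_mul, Complex.norm_natCast, norm_mul, e, norm_inv, ← div_eq_mul_inv]
      gcongr
    calc _ ≤ ∑ a ∈ Sh, (analyticOrderNatAt f a : ℝ) * ((R2 ^ 2 - R ^ 2) / R) :=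
          norm_sum_le_of_le _ hterm
      _ = (∑ a ∈ Sh, (analyticOrderNatAt f a : ℝ)) * ((R2 ^ 2 - R ^ 2) / R) := by
          rw [Finset.sum_mul]
      _ ≤ _ := by
          gcongr
          refine le_trans ?_ (hK2 R (by linarith))
          refine Finset.sum_le_sum_of_subset_of_nonneg (fun a ha => ?_)
            fun _ _ _ => Nat.cast_nonneg _
          obtain ⟨h5, h3, h4⟩ := hShmem a ha
          rw [Finset.mem_filter, mem_zerosBall H.diff H.ne]
          exact ⟨⟨h5, by linarith⟩, h4⟩
  have ident : (((R2 ^ 2 - R ^ 2 : ℝ)) : ℂ) *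
      (∑ a ∈ zerosBall f R, (analyticOrderNatAt f a : ℂ) * a⁻¹ + L) =
      (∑ a ∈ zerosBall f R2, (analyticOrderNatAt f a : ℂ) * (((R2 : ℂ) ^ 2 - ‖a‖ ^ 2) * a⁻¹) +
        (R2 : ℂ) ^ 2 * L) -
      (∑ a ∈ zerosBall f R, (analyticOrderNatAt f a : ℂ) * (((R : ℂ) ^ 2 - ‖a‖ ^ 2) * a⁻¹) +
        (R : ℂ) ^ 2 * L) -
      ∑ a ∈ Sh, (analyticOrderNatAt f a : ℂ) * (((R2 : ℂ) ^ 2 - ‖a‖ ^ 2) * a⁻¹) := by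
    rw [← Finset.sum_sdiff hsub, ← hSh]
    have e1 : ∑ a ∈ zerosBall f R, (analyticOrderNatAt f a : ℂ) *
        (((R2 : ℂ) ^ 2 - ‖a‖ ^ 2) * a⁻¹) =
        ∑ a ∈ zerosBall f R, (analyticOrderNatAt f a : ℂ) * (((R : ℂ) ^ 2 - ‖a‖ ^ 2) * a⁻¹) +
        ((R2 : ℂ) ^ 2 - (R : ℂ) ^ 2) *
          ∑ a ∈ zerosBall f R, (analyticOrderNatAt f a : ℂ) * a⁻¹ := by
      rw [Finset.mul_sum, ← Finset.sum_add_distrib]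
      refine Finset.sum_congr rfl fun a _ => ?_
      ring
    rw [e1]
    push_cast
    ring
  have hl2 : Real.log R2 ≤ 2 * Real.log R :=
    (Real.log_le_log (by linarith) (by linarith)).trans (log_two_mul_le hR3)
  have b2' : K1 * (R2 * Real.log R2) ≤ K1 * (4 * (R * Real.log R)) := by
    have h0 : 0 ≤ Real.log R2 := Real.log_nonneg (by linarith)
    have h1 : R2 * Real.log R2 ≤ 4 * (R * Real.log R) := by
      calc R2 * Real.log R2 ≤ (2 * R) * (2 * Real.log R) := by gcongr; linarith
        _ = _ := by ring
    exact mul_le_mul_of_nonneg_left h1 (by linarith)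
  have hn := congrArg norm ident
  rw [norm_mul, norm_real, Real.norm_of_nonneg hdpos.le] at hn
  set X := ‖∑ a ∈ zerosBall f R, (analyticOrderNatAt f a : ℂ) * a⁻¹ + L‖
  have hX : (R2 ^ 2 - R ^ 2) * X ≤ 5 * K1 * (R * Real.log R) +
      K2 * (√R * Real.log R) * ((R2 ^ 2 - R ^ 2) / R) := by
    rw [hn]
    refine (norm_sub_le _ _).trans (add_le_add ((norm_sub_le _ _).trans ?_) b3)
    linarith
  have hX2 : X ≤ 5 * K1 * (R * Real.log R) / (R2 ^ 2 - R ^ 2) +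
      K2 * (√R * Real.log R) / R := by
    rw [← mul_le_mul_iff_right₀ hdpos]
    refine hX.trans (le_of_eq ?_)
    field_simp
  refine hX2.trans ?_
  have f1 : 5 * K1 * (R * Real.log R) / (R2 ^ 2 - R ^ 2) ≤ 5 * K1 * (Real.log R / √R) := by
    calc _ ≤ 5 * K1 * (R * Real.log R) / (R * √R) := by gcongr
      _ = _ := by field_simp
  have f2 : K2 * (√R * Real.log R) / R = K2 * (Real.log R / √R) := by
    rw [mul_div_assoc, sqrt_mul_div_self hR0]
  rw [f2]
  linarith

theorem sum_zerosBall_pow_close (H : GrowthHyp f A B C) (k : ℕ) :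
    ∃ K : ℝ, 3 ≤ K ∧ ∀ R, K ≤ R → (∀ z, ‖z‖ = R → f z ≠ 0) →
      ‖∑ a ∈ zerosBall f R, (analyticOrderNatAt f a : ℂ) * a⁻¹ ^ (k + 1) +
        iteratedDeriv k (fun z => deriv f z / f z) 0 / (k.factorial : ℂ)‖ ≤
        K * (Real.log R / √R) := by
  rcases Nat.eq_zero_or_pos k with rfl | hk
  · simpa using H.sum_zerosBall_inv_close
  · exact H.sum_zerosBall_pow_close_of_pos hk

theorem finite_zeros_strip (H : GrowthHyp f A B C) (T : ℝ) :
    {a : ℂ | f a = 0 ∧ |a.im| ≤ T}.Finite := by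
  refine (finite_zeros_closedBall H.diff H.ne (C + T)).subset fun a ha => ⟨ha.1, ?_⟩
  have h1 : |a.re| < C := not_le.1 fun h => (H.out a h).1 ha.1
  exact (norm_le_abs_re_add_abs_im a).trans (add_le_add h1.le ha.2)

/-- Power sums over the zeros with `|Im a| ≤ T` converge to Taylor coefficients of `f'/f`. -/
theorem tendsto_sum_zeros_strip (H : GrowthHyp f A B C) (k : ℕ) :
    Tendsto (fun T : ℝ => ∑ a ∈ (H.finite_zeros_strip T).toFinset,
        (analyticOrderNatAt f a : ℂ) * a⁻¹ ^ (k + 1)) atTop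
      (nhds (-(iteratedDeriv k (fun z => deriv f z / f z) 0 / (k.factorial : ℂ)))) := by
  obtain ⟨K1, hK13, hK1⟩ := H.sum_zerosBall_pow_close k
  obtain ⟨K2, hK23, hK2⟩ := H.sum_order_shell_le
  have hC := H.three_le
  have hlim : Tendsto (fun T : ℝ => (2 * K1 + K2) * (Real.log T / √T)) atTop (nhds 0) := by
    have h1 : Tendsto (fun T : ℝ => Real.log T / √T) atTop (nhds 0) := by
      have := (isLittleO_log_rpow_atTop (r := 1 / 2) (by norm_num)).tendsto_div_nhds_zero
      simpa only [Real.sqrt_eq_rpow] using this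
    simpa using h1.const_mul (2 * K1 + K2)
  rw [tendsto_iff_norm_sub_tendsto_zero]
  refine squeeze_zero' (Eventually.of_forall fun _ => norm_nonneg _) ?_ hlim
  filter_upwards [eventually_ge_atTop (C ^ 2 + K1 + K2 + 4)] with T hT
  have hT3 : 3 ≤ T := by nlinarith
  have hT0 : 0 < T := by linarith
  have hlogT := one_le_log_of_three_le hT3
  have hs0 : 0 < √T := Real.sqrt_pos.2 hT0
  have hss : √T * √T = T := Real.mul_self_sqrt hT0.le
  have hs2 : 2 ≤ √T := Real.le_sqrt_of_sq_le (by nlinarith)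
  obtain ⟨R, h1, h2, hs⟩ := exists_radius_ne_zero H.diff H.ne (by linarith : T + 1 < T + 2)
  set Z := (H.finite_zeros_strip T).toFinset with hZ
  have hZmem : ∀ a, a ∈ Z ↔ f a = 0 ∧ |a.im| ≤ T := fun a => by simp [hZ]
  have hsub : Z ⊆ zerosBall f R := fun a ha => by
    rw [hZmem] at ha
    rw [mem_zerosBall H.diff H.ne]
    refine ⟨ha.1, lt_of_le_of_lt ?_ h1⟩
    have h3 : |a.re| < C := not_le.1 fun h => (H.out a h).1 ha.1
    refine le_of_sq_le_sq ?_ (by linarith) |> id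
    rw [← normSq_eq_norm_sq, normSq_apply]
    have h4 := abs_le.1 ha.2
    have h5 := abs_lt.1 h3
    nlinarith
  set L := iteratedDeriv k (fun z => deriv f z / f z) 0 / (k.factorial : ℂ)
  have b1 := hK1 R (by nlinarith) hs
  have b2 : ‖∑ a ∈ zerosBall f R \ Z, (analyticOrderNatAt f a : ℂ) * a⁻¹ ^ (k + 1)‖ ≤
      K2 * (Real.log T / √T) := by
    have hmem : ∀ a ∈ zerosBall f R \ Z, f a = 0 ∧ ‖a‖ < R ∧ T ≤ ‖a‖ := by
      intro a ha
      rw [Finset.mem_sdiff, mem_zerosBall H.diff H.ne, hZmem] at ha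
      refine ⟨ha.1.1, ha.1.2, ?_⟩
      exact (not_le.1 fun h => ha.2 ⟨ha.1.1, h⟩).le.trans (abs_im_le_norm a)
    have hterm : ∀ a ∈ zerosBall f R \ Z, ‖(analyticOrderNatAt f a : ℂ) * a⁻¹ ^ (k + 1)‖ ≤
        (analyticOrderNatAt f a : ℝ) * (1 / T) := by
      intro a ha
      obtain ⟨-, -, h3⟩ := hmem a ha
      rw [norm_mul, Complex.norm_natCast, norm_pow, norm_inv]
      gcongr
      have h4 : ‖a‖⁻¹ ≤ 1 / T := by rw [one_div]; gcongr
      have h5 : ‖a‖⁻¹ ≤ 1 := inv_le_one_of_one_le₀ (by linarith)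
      calc ‖a‖⁻¹ ^ (k + 1) = ‖a‖⁻¹ ^ k * ‖a‖⁻¹ := pow_succ _ _
        _ ≤ 1 * (1 / T) := by
          gcongr
          exact pow_le_one₀ (by positivity) h5
        _ = _ := one_mul _
    calc _ ≤ ∑ a ∈ zerosBall f R \ Z, (analyticOrderNatAt f a : ℝ) * (1 / T) :=
          norm_sum_le_of_le _ hterm
      _ = (∑ a ∈ zerosBall f R \ Z, (analyticOrderNatAt f a : ℝ)) * (1 / T) := by
          rw [Finset.sum_mul]
      _ ≤ K2 * (√T * Real.log T) * (1 / T) := by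
          gcongr
          refine le_trans ?_ (hK2 T (by nlinarith))
          refine Finset.sum_le_sum_of_subset_of_nonneg (fun a ha => ?_)
            fun _ _ _ => Nat.cast_nonneg _
          obtain ⟨h5, h3, h4⟩ := hmem a ha
          rw [Finset.mem_filter, mem_zerosBall H.diff H.ne]
          exact ⟨⟨h5, by linarith⟩, h4⟩
      _ = _ := by
          rw [← sqrt_mul_div_self hT0]; ring
  have e : ∑ a ∈ Z, (analyticOrderNatAt f a : ℂ) * a⁻¹ ^ (k + 1) - -L =
      (∑ a ∈ zerosBall f R, (analyticOrderNatAt f a : ℂ) * a⁻¹ ^ (k + 1) + L) -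
      ∑ a ∈ zerosBall f R \ Z, (analyticOrderNatAt f a : ℂ) * a⁻¹ ^ (k + 1) := by
    rw [← Finset.sum_sdiff hsub]
    ring
  rw [e]
  have hlR : Real.log R ≤ 2 * Real.log T :=
    (Real.log_le_log (by linarith) (by linarith)).trans (log_two_mul_le hT3)
  have hb1 : K1 * (Real.log R / √R) ≤ 2 * K1 * (Real.log T / √T) := by
    have : √T ≤ √R := Real.sqrt_le_sqrt (by linarith)
    calc K1 * (Real.log R / √R) ≤ K1 * (2 * Real.log T / √T) := by gcongr
      _ = _ := by ring
  calc _ ≤ _ := norm_sub_le _ _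
    _ ≤ 2 * K1 * (Real.log T / √T) + K2 * (Real.log T / √T) := add_le_add (b1.trans hb1) b2
    _ = _ := by ring

end GrowthHyp

/-- The real part of `z log z`, the main term in Stirling's formula. -/
def reMulLog (z : ℂ) : ℝ := (z * Complex.log z).re

theorem log_norm_prod {ι : Type*} (s : Finset ι) (g : ι → ℂ) (hg : ∀ i ∈ s, g i ≠ 0) :
    Real.log ‖∏ i ∈ s, g i‖ = ∑ i ∈ s, Real.log ‖g i‖ := by
  rw [norm_prod, Real.log_prod fun i hi => norm_ne_zero_iff.2 (hg i hi)]

theorem add_ofReal_mem_slitPlane {z : ℂ} (hz : 1 ≤ z.re) {t : ℝ} (ht : 0 ≤ t) :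
    z + t ∈ slitPlane := by
  left
  simp only [add_re, ofReal_re]
  linarith

theorem hasDerivAt_reMulLog_add {z : ℂ} (hz : 1 ≤ z.re) {t : ℝ} (ht : 0 ≤ t) :
    HasDerivAt (fun t : ℝ => reMulLog (z + t)) (Real.log ‖z + t‖ + 1) t := by
  have hm := add_ofReal_mem_slitPlane hz ht
  have h1 : HasDerivAt (fun t : ℝ => z + (t : ℂ)) 1 t := (ofRealCLM.hasDerivAt (x := t)).const_add z
  have h2 := h1.mul (h1.clog_real hm)
  have h3 := (reCLM.hasFDerivAt.comp_hasDerivAt t h2)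
  refine h3.congr_deriv ?_
  rw [reCLM_apply]
  have h0 : z + (t : ℂ) ≠ 0 := slitPlane_ne_zero hm
  rw [mul_one_div, div_self h0, one_mul, add_re, log_re, one_re]

/-- The summand of `log ‖Γ‖` in Gauss's product formula. -/
def gaussTerm (z : ℂ) (t : ℝ) : ℝ := Real.log t - Real.log ‖z + t‖

theorem gaussTerm_monotoneOn {z : ℂ} (hz : 1 ≤ z.re) :
    MonotoneOn (gaussTerm z) (Set.Ici 1) := by
  intro t ht u hu htu
  rw [Set.mem_Ici] at ht hu
  have hn : ∀ t : ℝ, 1 ≤ t → 0 < ‖z + t‖ := fun t ht =>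
    norm_pos_iff.2 (slitPlane_ne_zero (add_ofReal_mem_slitPlane hz (by linarith)))
  unfold gaussTerm
  have h1 := hn t ht
  have h2 := hn u hu
  have key : t * ‖z + u‖ ≤ u * ‖z + t‖ := by
    calc t * ‖z + u‖ = ‖(t : ℂ) * (z + u)‖ := by
          rw [norm_mul, norm_real, Real.norm_of_nonneg (by linarith)]
      _ ≤ ‖(u : ℂ) * (z + t)‖ := by
          rw [norm_def, norm_def]
          refine Real.sqrt_le_sqrt ?_
          rw [normSq_mul, normSq_mul, normSq_ofReal, normSq_ofReal, normSq_apply, normSq_apply]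
          simp only [add_re, add_im, ofReal_re, ofReal_im, add_zero]
          have h3 : t * (z.re + u) ≤ u * (z.re + t) := by nlinarith
          have h4 : (t * (z.re + u)) ^ 2 ≤ (u * (z.re + t)) ^ 2 :=
            pow_le_pow_left₀ (mul_nonneg (by linarith) (by linarith)) h3 2
          have h5 : t ^ 2 * z.im ^ 2 ≤ u ^ 2 * z.im ^ 2 := by gcongr
          nlinarith
      _ = u * ‖z + t‖ := by rw [norm_mul, norm_real, Real.norm_of_nonneg (by linarith)]
  have := Real.log_le_log (by positivity) key
  rw [Real.log_mul (by linarith) h2.ne', Real.log_mul (by linarith) h1.ne'] at this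
  linarith

theorem gaussTerm_nonpos {z : ℂ} (hz : 1 ≤ z.re) {t : ℝ} (ht : 1 ≤ t) : gaussTerm z t ≤ 0 := by
  unfold gaussTerm
  have : t ≤ ‖z + t‖ := by
    refine le_trans ?_ (re_le_norm _)
    simp only [add_re, ofReal_re]
    linarith
  have := Real.log_le_log (by linarith) this
  linarith

theorem integral_gaussTerm {z : ℂ} (hz : 1 ≤ z.re) {b : ℝ} (hb : 1 ≤ b) :
    ∫ t in (1 : ℝ)..b, gaussTerm z t = b * Real.log b - reMulLog (z + b) + reMulLog (z + 1) := by
  have hd : ∀ t ∈ Set.uIcc 1 b, HasDerivAt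
      (fun t : ℝ => t * Real.log t - reMulLog (z + t)) (gaussTerm z t) t := by
    intro t ht
    rw [Set.uIcc_of_le hb] at ht
    have ht0 : 0 < t := by linarith [ht.1]
    refine ((Real.hasDerivAt_mul_log ht0.ne').sub
      (hasDerivAt_reMulLog_add hz ht0.le)).congr_deriv ?_
    unfold gaussTerm
    ring
  rw [intervalIntegral.integral_eq_sub_of_hasDerivAt hd]
  · simp only [Real.log_one, mul_zero, ofReal_one]
    ring
  · refine MonotoneOn.intervalIntegrable ((gaussTerm_monotoneOn hz).mono fun t ht => ?_)
    rw [Set.uIcc_of_le hb] at ht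
    exact ht.1

theorem sum_gaussTerm_bounds {z : ℂ} (hz : 1 ≤ z.re) (n : ℕ) :
    ∫ t in (1 : ℝ)..(n + 1 : ℕ), gaussTerm z t ≤
      ∑ j ∈ range (n + 1), gaussTerm z (j + 1 : ℕ) + Real.log ‖z + 1‖ ∧
    ∑ j ∈ range (n + 1), gaussTerm z (j + 1 : ℕ) ≤ ∫ t in (1 : ℝ)..(n + 1 : ℕ), gaussTerm z t := by
  have hm : MonotoneOn (gaussTerm z) (Set.Icc (1 : ℝ) (1 + (n : ℕ))) :=
    (gaussTerm_monotoneOn hz).mono Set.Icc_subset_Ici_self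
  have h1 := hm.sum_le_integral
  have h2 := hm.integral_le_sum
  have e : (1 : ℝ) + (n : ℕ) = (n + 1 : ℕ) := by push_cast; ring
  rw [e] at h1 h2
  constructor
  · refine h2.trans ?_
    rw [Finset.sum_range_succ' (n := n)]
    have : ∀ j ∈ range n, gaussTerm z (1 + ((j + 1 : ℕ) : ℝ)) =
        gaussTerm z ((j + 1 + 1 : ℕ) : ℝ) := fun j _ => by
      congr 1; push_cast; ring
    rw [Finset.sum_congr rfl this]
    have h3 : gaussTerm z ((0 + 1 : ℕ) : ℝ) = - Real.log ‖z + 1‖ := by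
      simp [gaussTerm]
    rw [h3]
    linarith
  · rw [Finset.sum_range_succ]
    have : ∀ j ∈ range n, gaussTerm z ((j + 1 : ℕ) : ℝ) = gaussTerm z (1 + (j : ℝ)) :=
      fun j _ => by congr 1; push_cast; ring
    rw [Finset.sum_congr rfl this]
    have h3 : gaussTerm z ((n + 1 : ℕ) : ℝ) ≤ 0 :=
      gaussTerm_nonpos hz (by push_cast; linarith [n.cast_nonneg (α := ℝ)])
    linarith

theorem log_norm_GammaSeq {z : ℂ} (hz : 1 ≤ z.re) (n : ℕ) :
    Real.log ‖GammaSeq z (n + 1)‖ = z.re * Real.log (n + 1 : ℕ) - Real.log ‖z‖ +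
      ∑ j ∈ range (n + 1), gaussTerm z (j + 1 : ℕ) := by
  have hne : ∀ j : ℕ, z + j ≠ 0 := fun j => by
    have := slitPlane_ne_zero (add_ofReal_mem_slitPlane hz (t := j) (Nat.cast_nonneg j))
    simpa using this
  have hn0 : (0 : ℝ) < (n + 1 : ℕ) := by positivity
  have hp : ∏ j ∈ range (n + 1 + 1), (z + j) ≠ 0 := Finset.prod_ne_zero_iff.2 fun j _ => hne j
  have hc : ((n + 1 : ℕ) : ℂ) ^ z ≠ 0 := by
    rw [Ne, cpow_eq_zero_iff]
    push Not
    intro h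
    exact absurd h (by exact_mod_cast n.succ_ne_zero)
  have hf : ((n + 1).factorial : ℂ) ≠ 0 := by exact_mod_cast (n + 1).factorial_ne_zero
  unfold GammaSeq
  rw [norm_div, norm_mul, Real.log_div, Real.log_mul, log_norm_prod _ _ fun j _ => hne j,
    Finset.sum_range_succ', Complex.norm_natCast]
  rotate_left
  · exact norm_ne_zero_iff.2 hc
  · exact norm_ne_zero_iff.2 hf
  · exact mul_ne_zero (norm_ne_zero_iff.2 hc) (norm_ne_zero_iff.2 hf)
  · exact norm_ne_zero_iff.2 hp
  rw [norm_natCast_cpow_of_pos (Nat.succ_pos n), Real.log_rpow hn0,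
    ← Finset.prod_range_add_one_eq_factorial, Nat.cast_prod, Real.log_prod]
  · simp only [gaussTerm, Finset.sum_sub_distrib]
    push_cast
    simp only [add_zero]
    ring
  · intro j _
    exact_mod_cast j.succ_ne_zero

theorem tendsto_reMulLog_add_nat {z : ℂ} (hz : 1 ≤ z.re) :
    Tendsto (fun n : ℕ => reMulLog (z + (n : ℝ)) - (z.re + n) * Real.log n) atTop
      (nhds z.re) := by
  have h0 : Tendsto (fun n : ℕ => z / (n : ℂ)) atTop (nhds 0) :=
    tendsto_const_div_atTop_nhds_zero_nat z
  have h1 : Tendsto (fun n : ℕ => (n : ℂ) * Complex.log (1 + z / n)) atTop (nhds z) := by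
    refine tendsto_nat_mul_log_one_add_of_tendsto ?_
    refine tendsto_const_nhds.congr' ?_
    filter_upwards [eventually_ne_atTop 0] with n hn
    have : (n : ℂ) ≠ 0 := by exact_mod_cast hn
    field_simp
  have h2 : Tendsto (fun n : ℕ => z * Complex.log (1 + z / n)) atTop (nhds 0) := by
    have h3 : Tendsto (fun n : ℕ => Complex.log (1 + z / n)) atTop (nhds (Complex.log (1 + 0))) :=
      (h0.const_add 1).clog (by simp)
    simpa using h3.const_mul z
  have h3 := (continuous_re.tendsto _).comp (h2.add h1)
  rw [zero_add] at h3
  refine h3.congr' ?_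
  filter_upwards [eventually_ne_atTop 0] with n hn
  have hnR : (0 : ℝ) < n := by exact_mod_cast Nat.pos_of_ne_zero hn
  have hnC : (n : ℂ) ≠ 0 := by exact_mod_cast hn
  have hne : (1 : ℂ) + z / n ≠ 0 := by
    refine slitPlane_ne_zero (Or.inl ?_)
    rw [add_re, one_re, div_natCast_re]
    have : 0 ≤ z.re / n := by positivity
    linarith
  have e : z + ((n : ℝ) : ℂ) = ((n : ℝ) : ℂ) * (1 + z / n) := by
    push_cast; field_simp; ring
  have hl : Complex.log (z + ((n : ℝ) : ℂ)) = Real.log n + Complex.log (1 + z / n) := by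
    rw [e, log_ofReal_mul hnR hne]
  simp only [Function.comp_apply, reMulLog, hl]
  rw [mul_add, add_re ((z + ((n : ℝ) : ℂ)) * _), re_mul_ofReal, ← add_mul]
  simp only [add_re, ofReal_natCast, natCast_re]
  ring

/-- Stirling's formula for `log ‖Γ‖` in `1 ≤ Re z`, up to a logarithm. -/
theorem abs_log_norm_Gamma_sub_le {z : ℂ} (hz : 1 ≤ z.re) :
    |Real.log ‖Gamma z‖ - (reMulLog (z + 1) - z.re)| ≤ Real.log ‖z‖ + Real.log ‖z + 1‖ := by
  have hG : Gamma z ≠ 0 := Gamma_ne_zero_of_re_pos (by linarith)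
  have hT : Tendsto (fun n : ℕ => Real.log ‖GammaSeq z (n + 1)‖) atTop
      (nhds (Real.log ‖Gamma z‖)) :=
    (((GammaSeq_tendsto_Gamma z).comp (tendsto_add_atTop_nat 1)).norm).log
      (norm_ne_zero_iff.2 hG)
  have hW := (tendsto_reMulLog_add_nat hz).comp (tendsto_add_atTop_nat 1)
  have hI : Tendsto (fun n : ℕ => z.re * Real.log (n + 1 : ℕ) - Real.log ‖z‖ +
      ∫ t in (1 : ℝ)..(n + 1 : ℕ), gaussTerm z t) atTop
      (nhds (reMulLog (z + 1) - Real.log ‖z‖ - z.re)) := by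
    refine (hW.const_sub (reMulLog (z + 1) - Real.log ‖z‖)).congr fun n => ?_
    rw [integral_gaussTerm hz (by push_cast; linarith [n.cast_nonneg (α := ℝ)])]
    simp only [Function.comp_apply]
    ring
  have hz0 : 0 ≤ Real.log ‖z‖ := Real.log_nonneg (hz.trans (re_le_norm z))
  have hz1 : 0 ≤ Real.log ‖z + 1‖ := Real.log_nonneg (by
    refine le_trans ?_ (re_le_norm _)
    rw [add_re, one_re]; linarith)
  have hu : Real.log ‖Gamma z‖ ≤ reMulLog (z + 1) - Real.log ‖z‖ - z.re :=
    le_of_tendsto_of_tendsto' hT hI fun n => by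
      rw [log_norm_GammaSeq hz]
      linarith [(sum_gaussTerm_bounds hz n).2]
  have hl : reMulLog (z + 1) - Real.log ‖z‖ - z.re ≤ Real.log ‖Gamma z‖ + Real.log ‖z + 1‖ :=
    le_of_tendsto_of_tendsto' hI (hT.add_const _) fun n => by
      rw [log_norm_GammaSeq hz]
      linarith [(sum_gaussTerm_bounds hz n).1]
  rw [abs_le]
  constructor <;> linarith

theorem abs_reMulLog_add_sub_le {z d : ℂ} (hz : 1 ≤ z.re) (hzd : 1 ≤ (z + d).re) :
    |reMulLog (z + d) - reMulLog z| ≤ ‖d‖ * (Real.log (‖z‖ + ‖d‖) + 5) := by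
  set S : Set ℂ := {w | 1 ≤ w.re} ∩ Metric.closedBall 0 (‖z‖ + ‖d‖)
  have hS : Convex ℝ S := (convex_halfSpace_re_ge 1).inter (convex_closedBall _ _)
  have hd : ∀ w ∈ S, HasDerivWithinAt (fun w : ℂ => w * Complex.log w)
      (Complex.log w + 1) S w := by
    intro w hw
    have hw1 : 1 ≤ w.re := hw.1
    have hm : w ∈ slitPlane := Or.inl (by linarith)
    have h := ((hasDerivAt_id w).mul ((hasDerivAt_id w).clog hm)).hasDerivWithinAt (s := S)
    refine h.congr_deriv ?_
    have h0 : w ≠ 0 := slitPlane_ne_zero hm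
    simp only [id]
    field_simp
  have hb : ∀ w ∈ S, ‖Complex.log w + 1‖ ≤ Real.log (‖z‖ + ‖d‖) + 5 := by
    intro w hw
    have hw1 : 1 ≤ w.re := hw.1
    have hw2 : ‖w‖ ≤ ‖z‖ + ‖d‖ := by simpa using hw.2
    have hn : 1 ≤ ‖w‖ := hw1.trans (re_le_norm w)
    have h1 := norm_le_abs_re_add_abs_im (Complex.log w)
    rw [log_re, log_im, abs_of_nonneg (Real.log_nonneg hn)] at h1
    have h2 : |arg w| ≤ Real.pi := abs_arg_le_pi w
    have h3 := Real.pi_lt_four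
    have h4 := Real.log_le_log (by linarith) hw2
    have h5 := norm_add_le (Complex.log w) 1
    rw [norm_one] at h5
    linarith
  have := hS.norm_image_sub_le_of_norm_hasDerivWithin_le hd hb (x := z) (y := z + d)
    ⟨hz, by simp⟩ ⟨hzd, by simpa using norm_add_le z d⟩
  rw [add_sub_cancel_left] at this
  calc |reMulLog (z + d) - reMulLog z| ≤
      ‖(z + d) * Complex.log (z + d) - z * Complex.log z‖ := by
        rw [reMulLog, reMulLog, ← sub_re]; exact abs_re_le_norm _
    _ ≤ _ := by rw [mul_comm ‖d‖]; exact this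

theorem reMulLog_ofReal_mul {l : ℝ} (hl : 0 < l) {z : ℂ} (hz : z ≠ 0) :
    reMulLog (l * z) = l * reMulLog z + l * Real.log l * z.re := by
  rw [reMulLog, log_ofReal_mul hl hz, reMulLog]
  have : (l : ℂ) * z * (Real.log l + Complex.log z) =
      l * (z * Complex.log z) + ((l * Real.log l : ℝ) : ℂ) * z := by push_cast; ring
  rw [this, add_re, re_ofReal_mul, re_ofReal_mul]

/-- The filter of neighbourhoods of `Re s = +∞`. -/
def reAtTop : Filter ℂ := comap re atTop

theorem tendsto_re_reAtTop : Tendsto re reAtTop atTop := tendsto_comap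

theorem eventually_re_ge (c : ℝ) : ∀ᶠ s in reAtTop, c ≤ s.re :=
  tendsto_re_reAtTop.eventually_ge_atTop c

theorem tendsto_reAtTop_iff {α : Type*} {l : Filter α} {u : α → ℂ} :
    Tendsto u l reAtTop ↔ Tendsto (fun x => (u x).re) l atTop := tendsto_comap_iff

theorem tendsto_mul_add_reAtTop {l : ℝ} (hl : 0 < l) (d : ℂ) :
    Tendsto (fun s : ℂ => (l : ℂ) * s + d) reAtTop reAtTop := by
  rw [tendsto_reAtTop_iff]
  simp only [add_re, re_ofReal_mul]
  exact tendsto_atTop_add_const_right _ _ (tendsto_re_reAtTop.const_mul_atTop hl)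

theorem tendsto_add_reAtTop (d : ℂ) : Tendsto (fun s : ℂ => s + d) reAtTop reAtTop := by
  simpa using tendsto_mul_add_reAtTop one_pos d

theorem eventually_ne_reAtTop (p : ℂ) : ∀ᶠ s in reAtTop, s ≠ p := by
  filter_upwards [eventually_re_ge (p.re + 1)] with s hs h
  rw [h] at hs
  linarith

theorem isBigO_const_log (c : ℝ) : (fun _ : ℂ => c) =O[reAtTop] fun s => Real.log ‖s‖ := by
  refine Asymptotics.IsBigO.of_bound |c| ?_
  filter_upwards [eventually_re_ge 3] with s hs
  have h1 := one_le_log_of_three_le (hs.trans (re_le_norm s))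
  rw [Real.norm_eq_abs, Real.norm_eq_abs, abs_of_nonneg (by linarith : 0 ≤ Real.log ‖s‖)]
  nlinarith [abs_nonneg c]

theorem isBigO_log_mul_add {l : ℝ} (hl : 0 < l) (d : ℂ) :
    (fun s : ℂ => Real.log ‖(l : ℂ) * s + d‖) =O[reAtTop] fun s => Real.log ‖s‖ := by
  have h := (isBigO_const_log (Real.log (l + ‖d‖))).add
    (Asymptotics.isBigO_refl (fun s : ℂ => Real.log ‖s‖) reAtTop)
  refine (Asymptotics.IsBigO.of_bound 1 ?_).trans h
  filter_upwards [eventually_re_ge 1,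
    (tendsto_mul_add_reAtTop hl d).eventually (eventually_re_ge 1)] with s hs hs'
  have h1 := hs.trans (re_le_norm s)
  have h2 := hs'.trans (re_le_norm _)
  have h3 : ‖(l : ℂ) * s + d‖ ≤ (l + ‖d‖) * ‖s‖ := by
    refine (norm_add_le _ _).trans ?_
    rw [norm_mul, norm_real, Real.norm_of_nonneg hl.le, add_mul]
    gcongr
    exact le_mul_of_one_le_right (norm_nonneg d) h1
  have h4 := Real.log_le_log (by linarith) h3
  rw [Real.log_mul (by positivity) (by linarith)] at h4
  rw [one_mul, Real.norm_eq_abs, Real.norm_eq_abs, abs_of_nonneg (Real.log_nonneg h2)]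
  exact h4.trans (le_abs_self _)

theorem isBigO_log_add (d : ℂ) :
    (fun s : ℂ => Real.log ‖s + d‖) =O[reAtTop] fun s => Real.log ‖s‖ := by
  simpa using isBigO_log_mul_add one_pos d

theorem isBigO_reMulLog_add_sub (d : ℂ) :
    (fun s : ℂ => reMulLog (s + d) - reMulLog s) =O[reAtTop] fun s => Real.log ‖s‖ := by
  have h := ((isBigO_log_mul_add (l := 1) one_pos (0 : ℂ)).add
    (isBigO_const_log (Real.log (1 + ‖d‖) + 5))).const_mul_left ‖d‖
  refine (Asymptotics.IsBigO.of_bound 1 ?_).trans h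
  filter_upwards [eventually_re_ge 1,
    (tendsto_add_reAtTop d).eventually (eventually_re_ge 1)] with s hs hs'
  have h1 := hs.trans (re_le_norm s)
  have h2 := abs_reMulLog_add_sub_le hs hs'
  have h3 : Real.log (‖s‖ + ‖d‖) ≤ Real.log ‖s‖ + Real.log (1 + ‖d‖) := by
    rw [← Real.log_mul (by linarith) (by positivity)]
    refine Real.log_le_log (by positivity) ?_
    nlinarith [norm_nonneg d]
  rw [Real.norm_eq_abs, Real.norm_eq_abs, one_mul]
  refine h2.trans (le_trans ?_ (le_abs_self _))
  simp only [ofReal_one, one_mul, add_zero]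
  exact mul_le_mul_of_nonneg_left (by linarith) (norm_nonneg d)

theorem isBigO_log_norm_Gamma_sub {l : ℝ} (hl : 0 < l) (d : ℂ) :
    (fun s : ℂ => Real.log ‖Gamma ((l : ℂ) * s + d)‖ -
      (l * reMulLog s + (l * Real.log l - l) * s.re)) =O[reAtTop] fun s => Real.log ‖s‖ := by
  have h1 : (fun s : ℂ => Real.log ‖Gamma ((l : ℂ) * s + d)‖ -
      (reMulLog ((l : ℂ) * s + d + 1) - ((l : ℂ) * s + d).re)) =O[reAtTop]
      fun s => Real.log ‖s‖ := by
    refine (Asymptotics.IsBigO.of_bound 1 ?_).trans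
      ((isBigO_log_mul_add hl d).add (isBigO_log_mul_add hl (d + 1)))
    filter_upwards [(tendsto_mul_add_reAtTop hl d).eventually (eventually_re_ge 1)] with s hs
    rw [one_mul, Real.norm_eq_abs, Real.norm_eq_abs]
    refine (abs_log_norm_Gamma_sub_le hs).trans (le_trans (le_of_eq ?_) (le_abs_self _))
    rw [add_assoc]
  have h2 : (fun s : ℂ => reMulLog ((l : ℂ) * s + (d + 1)) - reMulLog ((l : ℂ) * s)) =O[reAtTop]
      fun s => Real.log ‖s‖ := by
    have h3 : Tendsto (fun s : ℂ => (l : ℂ) * s) reAtTop reAtTop := by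
      simpa using tendsto_mul_add_reAtTop hl 0
    refine ((isBigO_reMulLog_add_sub (d + 1)).comp_tendsto h3).trans ?_
    simpa [Function.comp_def] using isBigO_log_mul_add hl 0
  refine ((h1.add h2).add (isBigO_const_log (-d.re))).congr' ?_ EventuallyEq.rfl
  filter_upwards [eventually_ne_reAtTop 0] with s hs
  rw [reMulLog_ofReal_mul hl hs, add_re, re_ofReal_mul, add_assoc ((l : ℂ) * s) d 1]
  ring

/-- A nonzero Dirichlet series is asymptotic to its leading term as `Re s → ∞`. -/
theorem exists_log_norm_dirichletSeries_isBigO {σ0 : ℝ} {a : ℕ → ℂ} {F : ℂ → ℂ}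
    (hDir : ∀ s : ℂ, σ0 < s.re →
      HasSum (fun n : ℕ => a (n + 1) * ((n + 1 : ℕ) : ℂ) ^ (-s)) (F s))
    (hDirAbs : ∀ s : ℂ, σ0 < s.re →
      Summable (fun n : ℕ => ‖a (n + 1) * ((n + 1 : ℕ) : ℂ) ^ (-s)‖))
    (ha : ∃ n, a (n + 1) ≠ 0) :
    ∃ b : ℝ, (∀ᶠ s in reAtTop, F s ≠ 0) ∧
      (fun s : ℂ => Real.log ‖F s‖ - b * s.re) =O[reAtTop] fun _ => (1 : ℝ) := by
  classical
  set k := Nat.find ha with hk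
  have hak : a (k + 1) ≠ 0 := Nat.find_spec ha
  have hlt : ∀ n < k, a (n + 1) = 0 := fun n hn => by
    by_contra h
    exact Nat.find_min ha hn h
  set c : ℝ := σ0 + 1 with hc
  have hnorm : ∀ (n : ℕ) (s : ℂ), ‖((n + 1 : ℕ) : ℂ) ^ s‖ = ((n + 1 : ℕ) : ℝ) ^ s.re :=
    fun n s => norm_natCast_cpow_of_pos n.succ_pos s
  have hsum := hDirAbs (c : ℂ) (by simp [hc])
  set S := ∑' n : ℕ, ‖a (n + 1) * ((n + 1 : ℕ) : ℂ) ^ (-(c : ℂ))‖ with hS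
  have hS0 : 0 ≤ S := tsum_nonneg fun _ => norm_nonneg _
  have hk1 : (0 : ℝ) < (k + 1 : ℕ) := by positivity
  have hk2 : (0 : ℝ) < (k + 2 : ℕ) := by positivity
  have hbound : ∀ s : ℂ, c ≤ s.re → ‖F s * ((k + 1 : ℕ) : ℂ) ^ s - a (k + 1)‖ ≤
      S * ((k + 2 : ℕ) : ℝ) ^ c * (((k + 1 : ℕ) : ℝ) / (k + 2 : ℕ)) ^ s.re := by
    intro s hs
    have hs0 : σ0 < s.re := by linarith
    have h1 := (hDir s hs0).sub (hasSum_ite_eq k (a (k + 1) * ((k + 1 : ℕ) : ℂ) ^ (-s)))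
    have hterm : ∀ n : ℕ, ‖a (n + 1) * ((n + 1 : ℕ) : ℂ) ^ (-s) -
        (if n = k then a (k + 1) * ((k + 1 : ℕ) : ℂ) ^ (-s) else 0)‖ ≤
        ‖a (n + 1) * ((n + 1 : ℕ) : ℂ) ^ (-(c : ℂ))‖ * ((k + 2 : ℕ) : ℝ) ^ (c - s.re) := by
      intro n
      rcases lt_trichotomy n k with h | h | h
      · rw [if_neg h.ne, hlt n h]
        simp
      · rw [if_pos h, h, sub_self, norm_zero]
        positivity
      · rw [if_neg h.ne', sub_zero, norm_mul, norm_mul, hnorm, hnorm, mul_assoc, neg_re, neg_re,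
          ofReal_re]
        refine mul_le_mul_of_nonneg_left ?_ (norm_nonneg _)
        have hn0 : (0 : ℝ) < (n + 1 : ℕ) := by positivity
        calc ((n + 1 : ℕ) : ℝ) ^ (-s.re) =
            ((n + 1 : ℕ) : ℝ) ^ (-c) * ((n + 1 : ℕ) : ℝ) ^ (c - s.re) := by
              rw [← Real.rpow_add hn0]; congr 1; ring
          _ ≤ _ := by
              refine mul_le_mul_of_nonneg_left ?_ (by positivity)
              refine Real.rpow_le_rpow_of_nonpos hk2 ?_ (by linarith)
              exact_mod_cast (by omega : k + 2 ≤ n + 1)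
    have h2 := tsum_of_norm_bounded (hsum.hasSum.mul_right (((k + 2 : ℕ) : ℝ) ^ (c - s.re))) hterm
    rw [h1.tsum_eq] at h2
    have hkC : ((k + 1 : ℕ) : ℂ) ≠ 0 := by exact_mod_cast k.succ_ne_zero
    have e : F s * ((k + 1 : ℕ) : ℂ) ^ s - a (k + 1) =
        (F s - a (k + 1) * ((k + 1 : ℕ) : ℂ) ^ (-s)) * ((k + 1 : ℕ) : ℂ) ^ s := by
      rw [sub_mul, mul_assoc, ← cpow_add _ _ hkC, neg_add_cancel, cpow_zero, mul_one]
    rw [e, norm_mul, hnorm]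
    calc _ ≤ S * ((k + 2 : ℕ) : ℝ) ^ (c - s.re) * ((k + 1 : ℕ) : ℝ) ^ s.re := by gcongr
      _ = _ := by
        rw [Real.rpow_sub hk2, Real.div_rpow hk1.le hk2.le]
        ring
  have hlim : Tendsto (fun s : ℂ => F s * ((k + 1 : ℕ) : ℂ) ^ s) reAtTop
      (nhds (a (k + 1))) := by
    rw [tendsto_iff_norm_sub_tendsto_zero]
    have hq : Tendsto (fun s : ℂ => S * ((k + 2 : ℕ) : ℝ) ^ c *
        (((k + 1 : ℕ) : ℝ) / (k + 2 : ℕ)) ^ s.re) reAtTop (nhds 0) := by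
      have h3 : ((k + 1 : ℕ) : ℝ) / (k + 2 : ℕ) < 1 := by
        rw [div_lt_one hk2]; exact_mod_cast (by omega : k + 1 < k + 2)
      have h4 := (tendsto_rpow_atTop_of_base_lt_one (((k + 1 : ℕ) : ℝ) / (k + 2 : ℕ))
        (by have : 0 < ((k + 1 : ℕ) : ℝ) / (k + 2 : ℕ) := by positivity
            linarith) h3).comp tendsto_re_reAtTop
      simpa using h4.const_mul (S * ((k + 2 : ℕ) : ℝ) ^ c)
    refine squeeze_zero' (Eventually.of_forall fun _ => norm_nonneg _) ?_ hq
    filter_upwards [eventually_re_ge c] with s hs using hbound s hs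
  have hne := hlim.eventually_ne hak
  refine ⟨-Real.log (k + 1 : ℕ), ?_, ?_⟩
  · filter_upwards [hne] with s hs h
    exact hs (by rw [h, zero_mul])
  · have h5 := (hlim.norm.log (norm_ne_zero_iff.2 hak)).isBigO_one ℝ
    refine h5.congr' ?_ EventuallyEq.rfl
    filter_upwards [hne] with s hs
    rw [norm_mul, Real.log_mul, hnorm, Real.log_rpow hk1]
    · ring
    · exact norm_ne_zero_iff.2 (left_ne_zero_of_mul hs)
    · exact norm_ne_zero_iff.2 (right_ne_zero_of_mul hs)

namespace SSF

variable {σ0 σ1 : ℝ}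

theorem eventually_xi_eq (D : SSF σ0 σ1) : ∀ᶠ s in reAtTop,
    (∀ i, s ≠ D.pole i) ∧ (∀ j, 1 ≤ ((D.lam j : ℂ) * s + D.mu j).re) ∧
    D.xi s = D.F s * (D.Q : ℂ) ^ s * (∏ j, Complex.Gamma ((D.lam j : ℂ) * s + D.mu j)) *
      (∏ i, (s - D.pole i) ^ D.m i) *
      ∏ i : Fin D.N, (if 2 * D.M + D.dlt ≤ (i : ℕ) then
        ((σ1 : ℂ) - s - (starRingEnd ℂ) (D.pole i)) ^ D.m i else 1) := by
  filter_upwards [eventually_all.2 fun i => eventually_ne_reAtTop (D.pole i),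
    eventually_all.2 fun j =>
      (tendsto_mul_add_reAtTop (D.hlam j) (D.mu j)).eventually (eventually_re_ge 1)] with s h1 h2
  refine ⟨h1, h2, D.hxiEq s h1 fun j k h => ?_⟩
  have h3 := h2 j
  rw [h, neg_re, natCast_re] at h3
  linarith [k.cast_nonneg (α := ℝ)]

theorem exists_coeff_ne_zero (D : SSF σ0 σ1) {s0 : ℂ} (h0 : D.xi s0 ≠ 0) :
    ∃ n, D.a (n + 1) ≠ 0 := by
  by_contra! hcon
  have hF : ∀ s : ℂ, σ0 < s.re → D.F s = 0 := fun s hs => by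
    refine (D.hDir s hs).unique ?_
    simp only [hcon, zero_mul]
    exact hasSum_zero
  have hxi : ∀ᶠ s in reAtTop, D.xi s = 0 := by
    filter_upwards [D.eventually_xi_eq, eventually_re_ge (σ0 + 1)] with s hs hs'
    rw [hs.2.2, hF s (by linarith)]
    simp only [zero_mul]
  obtain ⟨c, hc⟩ : ∃ c : ℝ, ∀ s : ℂ, c ≤ s.re → D.xi s = 0 := by
    rw [reAtTop, eventually_comap, eventually_atTop] at hxi
    obtain ⟨c, hc⟩ := hxi
    exact ⟨c, fun s hs => hc s.re hs s rfl⟩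
  have hev : D.xi =ᶠ[nhds ((c + 1 : ℝ) : ℂ)] 0 := by
    have hopen : IsOpen {s : ℂ | c < s.re} := isOpen_lt continuous_const continuous_re
    filter_upwards [hopen.mem_nhds (show ((c + 1 : ℝ) : ℂ) ∈ {s : ℂ | c < s.re} by
      simp)] with s hs
    exact hc s (le_of_lt hs)
  have han : AnalyticOnNhd ℂ D.xi Set.univ := fun z _ => D.hxiDiff.analyticAt z
  have := han.eqOn_zero_of_preconnected_of_eventuallyEq_zero isPreconnected_univ
    (Set.mem_univ _) hev
  exact h0 (this (Set.mem_univ s0))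

/-- Stirling asymptotics of the completed function as `Re s → ∞`. -/
theorem exists_log_norm_xi_isBigO (D : SSF σ0 σ1) {s0 : ℂ} (h0 : D.xi s0 ≠ 0) :
    ∃ b : ℝ, (∀ᶠ s in reAtTop, D.xi s ≠ 0) ∧
      (fun s : ℂ => Real.log ‖D.xi s‖ - ((∑ j, D.lam j) * reMulLog s + b * s.re)) =O[reAtTop]
        fun s => Real.log ‖s‖ := by
  obtain ⟨b, hFne, hF⟩ := exists_log_norm_dirichletSeries_isBigO D.hDir D.hDirAbs
    (D.exists_coeff_ne_zero h0)
  have hF' := hF.trans (isBigO_const_log 1)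
  have hQ0 : (D.Q : ℂ) ≠ 0 := by exact_mod_cast D.hQ.ne'
  set w : Fin D.N → ℂ → ℂ := fun i s => if 2 * D.M + D.dlt ≤ (i : ℕ) then
        ((σ1 : ℂ) - s - (starRingEnd ℂ) (D.pole i)) ^ D.m i else 1 with hw
  have hwne : ∀ᶠ s in reAtTop, ∀ i, w i s ≠ 0 := by
    refine eventually_all.2 fun i => ?_
    filter_upwards [eventually_ne_reAtTop ((σ1 : ℂ) - (starRingEnd ℂ) (D.pole i))] with s hs
    simp only [hw]
    split_ifs
    · refine pow_ne_zero _ fun h => hs ?_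
      linear_combination -h
    · exact one_ne_zero
  have hwO : ∀ i, (fun s => Real.log ‖w i s‖) =O[reAtTop] fun s : ℂ => Real.log ‖s‖ := by
    intro i
    simp only [hw]
    split_ifs
    · refine ((isBigO_log_add ((starRingEnd ℂ) (D.pole i) - σ1)).const_mul_left
        (D.m i : ℝ)).congr_left fun s => ?_
      rw [norm_pow, Real.log_pow, ← norm_neg]
      congr 3
      ring
    · simpa using isBigO_const_log 0
  have hpO : ∀ i, (fun s => (D.m i : ℝ) * Real.log ‖s - D.pole i‖) =O[reAtTop]
      fun s : ℂ => Real.log ‖s‖ := fun i =>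
    (isBigO_log_add (-D.pole i)).const_mul_left _
  have hne : ∀ᶠ s in reAtTop, D.xi s ≠ 0 ∧ Real.log ‖D.xi s‖ =
      Real.log ‖D.F s‖ + s.re * Real.log D.Q +
      ∑ j, Real.log ‖Complex.Gamma ((D.lam j : ℂ) * s + D.mu j)‖ +
      ∑ i, D.m i * Real.log ‖s - D.pole i‖ + ∑ i, Real.log ‖w i s‖ := by
    filter_upwards [D.eventually_xi_eq, hFne, hwne] with s hs hFs hws
    obtain ⟨h1, h2, h3⟩ := hs
    have hG : ∀ j, Complex.Gamma ((D.lam j : ℂ) * s + D.mu j) ≠ 0 := fun j =>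
      Gamma_ne_zero_of_re_pos (by linarith [h2 j])
    have hp : ∀ i, (s - D.pole i) ^ D.m i ≠ 0 := fun i => pow_ne_zero _ (sub_ne_zero.2 (h1 i))
    have hQs : (D.Q : ℂ) ^ s ≠ 0 := by simp [cpow_eq_zero_iff, hQ0]
    have hGp := Finset.prod_ne_zero_iff.2 fun j (_ : j ∈ Finset.univ) => hG j
    have hpp := Finset.prod_ne_zero_iff.2 fun j (_ : j ∈ Finset.univ) => hp j
    have hwp := Finset.prod_ne_zero_iff.2 fun j (_ : j ∈ Finset.univ) => hws j
    have n1 := mul_ne_zero hFs hQs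
    have n2 := mul_ne_zero n1 hGp
    have n3 := mul_ne_zero n2 hpp
    rw [h3]
    refine ⟨mul_ne_zero n3 hwp, ?_⟩
    rw [norm_mul, norm_mul, norm_mul, norm_mul,
      Real.log_mul (by simpa only [← norm_mul] using norm_ne_zero_iff.2 n3)
        (norm_ne_zero_iff.2 hwp),
      Real.log_mul (by simpa only [← norm_mul] using norm_ne_zero_iff.2 n2)
        (norm_ne_zero_iff.2 hpp),
      Real.log_mul (by simpa only [← norm_mul] using norm_ne_zero_iff.2 n1)
        (norm_ne_zero_iff.2 hGp),
      Real.log_mul (norm_ne_zero_iff.2 hFs) (norm_ne_zero_iff.2 hQs),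
      log_norm_prod _ _ fun j _ => hG j, log_norm_prod _ _ fun j _ => hp j,
      log_norm_prod _ _ fun j _ => hws j, norm_cpow_eq_rpow_re_of_pos D.hQ, Real.log_rpow D.hQ]
    simp only [norm_pow, Real.log_pow]
  refine ⟨b + Real.log D.Q + ∑ j, (D.lam j * Real.log (D.lam j) - D.lam j),
    hne.mono fun s hs => hs.1, ?_⟩
  have hsumG := Asymptotics.IsBigO.sum (s := Finset.univ) fun j _ =>
    isBigO_log_norm_Gamma_sub (D.hlam j) (D.mu j)
  have hsump := Asymptotics.IsBigO.sum (s := Finset.univ) fun i _ => hpO i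
  have hsumw := Asymptotics.IsBigO.sum (s := Finset.univ) fun i _ => hwO i
  refine (((hF'.add hsumG).add hsump).add hsumw).congr' ?_ EventuallyEq.rfl
  filter_upwards [hne] with s hs
  rw [hs.2]
  simp only [Finset.sum_apply, Finset.sum_sub_distrib, Finset.sum_add_distrib, Finset.sum_mul,
    sub_mul, add_mul]
  ring

/-- Stirling asymptotics of a translate of the completed function as `Re s → ∞`. -/
theorem exists_log_norm_xi_add_isBigO (D : SSF σ0 σ1) {s0 : ℂ} (h0 : D.xi s0 ≠ 0) :
    ∃ b : ℝ, ∀ d : ℝ, (∀ᶠ s in reAtTop, D.xi (s + d) ≠ 0) ∧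
      (fun s : ℂ => Real.log ‖D.xi (s + d)‖ -
        ((∑ j, D.lam j) * reMulLog s + b * s.re)) =O[reAtTop] fun s => Real.log ‖s‖ := by
  obtain ⟨b, hne, hO⟩ := D.exists_log_norm_xi_isBigO h0
  refine ⟨b, fun d => ⟨(tendsto_add_reAtTop d).eventually hne, ?_⟩⟩
  have h1 := (hO.comp_tendsto (tendsto_add_reAtTop d)).trans (isBigO_log_add (d : ℂ))
  have h2 := (isBigO_reMulLog_add_sub (d : ℂ)).const_mul_left (∑ j, D.lam j)
  refine ((h1.add h2).add (isBigO_const_log (b * d))).congr_left fun s => ?_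
  simp only [Function.comp_apply, add_re, ofReal_re]
  ring

end SSF

theorem norm_Gamma_le_Gamma_re {w : ℂ} (hw : 0 < w.re) : ‖Gamma w‖ ≤ Real.Gamma w.re := by
  rw [Complex.Gamma_eq_integral hw, GammaIntegral, Real.Gamma_eq_integral hw]
  refine (norm_integral_le_integral_norm _).trans (le_of_eq ?_)
  refine setIntegral_congr_fun measurableSet_Ioi fun x hx => ?_
  rw [Set.mem_Ioi] at hx
  rw [norm_mul, norm_real, Real.norm_of_nonneg (Real.exp_pos _).le,
    norm_cpow_eq_rpow_re_of_pos hx, sub_re, one_re]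

theorem norm_Gamma_le_norm_Gamma_add_nat {w : ℂ} (hw : 1 ≤ |w.im|) (n : ℕ) :
    ‖Gamma w‖ ≤ ‖Gamma (w + n)‖ := by
  induction n with
  | zero => simp
  | succ n ih =>
    have h1 : 1 ≤ ‖w + n‖ := by
      refine le_trans ?_ (abs_im_le_norm _)
      simpa using hw
    have h2 : w + n ≠ 0 := norm_pos_iff.1 (by linarith)
    refine ih.trans ?_
    push_cast
    rw [← add_assoc, Complex.Gamma_add_one _ h2, norm_mul]
    exact le_mul_of_one_le_left (norm_nonneg _) h1

theorem exists_norm_Gamma_le (b : ℝ) :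
    ∃ M : ℝ, ∀ w : ℂ, 1 ≤ |w.im| → |w.re| ≤ b → ‖Gamma w‖ ≤ M := by
  obtain ⟨n, hn⟩ := exists_nat_ge (b + 1)
  have hcont : ContinuousOn Real.Gamma (Set.Icc 1 (b + n)) := fun x hx =>
    (Real.differentiableAt_Gamma fun m h => by
      have := hx.1
      rw [h] at this
      linarith [m.cast_nonneg (α := ℝ)]).continuousAt.continuousWithinAt
  obtain ⟨M, hM⟩ := isCompact_Icc.exists_bound_of_continuousOn hcont
  refine ⟨M, fun w h1 h2 => ?_⟩
  rw [abs_le] at h2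
  have hre : (w + n).re = w.re + n := by simp
  have hmem : w.re + n ∈ Set.Icc 1 (b + n) := ⟨by linarith, by linarith⟩
  refine (norm_Gamma_le_norm_Gamma_add_nat h1 n).trans
    ((norm_Gamma_le_Gamma_re (by rw [hre]; linarith [hmem.1])).trans ?_)
  rw [hre]
  exact (le_abs_self _).trans (hM _ hmem)

/-- Growth at most doubly exponential of type `c` along a filter on `ℂ`. -/
def DoubleExpBound (l : Filter ℂ) (c : ℝ) (u : ℂ → ℂ) : Prop :=
  ∃ B : ℝ, u =O[l] fun z => Real.exp (B * Real.exp (c * |z.im|))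

namespace DoubleExpBound

variable {l : Filter ℂ} {c : ℝ} {u v : ℂ → ℂ}

theorem of_bounded {M : ℝ} (h : ∀ᶠ z in l, ‖u z‖ ≤ M) : DoubleExpBound l c u := by
  refine ⟨0, Asymptotics.IsBigO.of_bound M ?_⟩
  filter_upwards [h] with z hz
  simpa using hz

theorem mul (hu : DoubleExpBound l c u) (hv : DoubleExpBound l c v) :
    DoubleExpBound l c fun z => u z * v z := by
  obtain ⟨B1, h1⟩ := hu
  obtain ⟨B2, h2⟩ := hv
  refine ⟨B1 + B2, (h1.mul h2).congr_right fun z => ?_⟩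
  rw [← Real.exp_add]
  ring_nf

theorem prod {ι : Type*} {s : Finset ι} {u : ι → ℂ → ℂ}
    (h : ∀ i ∈ s, DoubleExpBound l c (u i)) : DoubleExpBound l c fun z => ∏ i ∈ s, u i z := by
  classical
  induction s using Finset.induction_on with
  | empty => exact of_bounded (M := 1) (by simp)
  | insert a s ha ih =>
    simp only [Finset.prod_insert ha]
    exact (h a (Finset.mem_insert_self a s)).mul
      (ih fun i hi => h i (Finset.mem_insert_of_mem hi))

theorem pow (hu : DoubleExpBound l c u) (n : ℕ) : DoubleExpBound l c fun z => u z ^ n := by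
  simpa using prod (s := Finset.range n) (u := fun _ => u) fun _ _ => hu

theorem of_le_add {K : ℝ} (hc : 0 < c) (h : ∀ᶠ z in l, ‖u z‖ ≤ K + |z.im|) :
    DoubleExpBound l c u := by
  refine ⟨1, Asymptotics.IsBigO.of_bound (|K| + 1 / c) ?_⟩
  filter_upwards [h] with z hz
  refine hz.trans ?_
  rw [Real.norm_of_nonneg (Real.exp_pos _).le, one_mul, add_mul]
  have h1 : c * |z.im| ≤ Real.exp (Real.exp (c * |z.im|)) := by
    have h3 := Real.add_one_le_exp (c * |z.im|)
    have h4 := Real.add_one_le_exp (Real.exp (c * |z.im|))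
    linarith
  have h2 : 1 ≤ Real.exp (Real.exp (c * |z.im|)) := Real.one_le_exp (Real.exp_pos _).le
  refine add_le_add ((le_abs_self K).trans (le_mul_of_one_le_right (abs_nonneg K) h2)) ?_
  rw [one_div, inv_mul_eq_div, le_div_iff₀ hc, mul_comm]
  exact h1

end DoubleExpBound

/-- The filter `|Im z| → ∞` in the open strip `|Re z| < a`. -/
def stripFilter (a : ℝ) : Filter ℂ :=
  comap (_root_.abs ∘ im) atTop ⊓ 𝓟 (re ⁻¹' Set.Ioo (-a) a)

theorem eventually_stripFilter_re (a : ℝ) : ∀ᶠ z in stripFilter a, |z.re| < a := by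
  refine Filter.mem_inf_of_right ?_
  rw [mem_principal]
  intro z hz
  exact abs_lt.2 hz

theorem tendsto_abs_im_stripFilter (a : ℝ) :
    Tendsto (fun z : ℂ => |z.im|) (stripFilter a) atTop :=
  tendsto_comap.mono_left inf_le_left

/-- An entire function of polynomial growth on the boundary of a vertical strip and of moderate
growth inside has polynomial growth in the strip. -/
theorem norm_le_pow_of_strip {f : ℂ → ℂ} (hf : Differentiable ℂ f) {a c K : ℝ} {D : ℕ}
    (ha : 0 < a) (hc : c < Real.pi / (2 * a)) (hK : 0 ≤ K)
    (hgrow : DoubleExpBound (stripFilter a) c f)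
    (hbd : ∀ z : ℂ, |z.re| = a → ‖f z‖ ≤ K * (‖z‖ + 1) ^ D) {z : ℂ} (hz : |z.re| ≤ a) :
    ‖f z‖ ≤ K * (a + 3) ^ D * (‖z‖ + a + 1) ^ D := by
  set q : ℂ → ℂ := fun z => z + (a + 1 : ℝ) with hq
  have hq1 : ∀ z : ℂ, |z.re| ≤ a → 1 ≤ ‖q z‖ := by
    intro z hz
    refine le_trans ?_ (re_le_norm _)
    simp only [hq, add_re, ofReal_re]
    linarith [(abs_le.1 hz).1]
  have hq0 : ∀ z : ℂ, |z.re| ≤ a → q z ≠ 0 := fun z hz =>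
    norm_pos_iff.1 (by linarith [hq1 z hz])
  have hqn : ∀ z : ℂ, |z.re| ≤ a → ‖z‖ + 1 ≤ (a + 3) * ‖q z‖ := by
    intro z hz
    have h1 := hq1 z hz
    have h2 : ‖z‖ ≤ ‖q z‖ + (a + 1) := by
      calc ‖z‖ = ‖q z - (a + 1 : ℝ)‖ := by rw [hq]; simp only [add_sub_cancel_right]
        _ ≤ ‖q z‖ + ‖((a + 1 : ℝ) : ℂ)‖ := norm_sub_le _ _
        _ = _ := by rw [norm_real, Real.norm_of_nonneg (by linarith)]
    nlinarith
  have hq2 : ‖q z‖ ≤ ‖z‖ + a + 1 := by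
    calc ‖q z‖ ≤ ‖z‖ + ‖((a + 1 : ℝ) : ℂ)‖ := norm_add_le _ _
      _ = _ := by rw [norm_real, Real.norm_of_nonneg (by linarith)]; ring
  have hbd' : ∀ w : ℂ, |w.re| = a → ‖f w / q w ^ D‖ ≤ K * (a + 3) ^ D := by
    intro w hw
    rw [norm_div, norm_pow, div_le_iff₀ (pow_pos (by linarith [hq1 w hw.le]) D), mul_assoc,
      ← mul_pow]
    refine (hbd w hw).trans ?_
    have := hqn w hw.le
    gcongr
  have hdiff : DiffContOnCl ℂ (fun w => f w / q w ^ D) (re ⁻¹' Set.Ioo (-a) a) := by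
    refine DifferentiableOn.diffContOnCl fun w hw => ?_
    have hcl : w ∈ re ⁻¹' Set.Icc (-a) a := by
      refine closure_minimal (Set.preimage_mono Set.Ioo_subset_Icc_self)
        (isClosed_Icc.preimage continuous_re) hw
    have hw' : |w.re| ≤ a := abs_le.2 hcl
    refine DifferentiableAt.differentiableWithinAt ?_
    refine (hf w).div ?_ (pow_ne_zero _ (hq0 w hw'))
    simp only [hq]
    fun_prop
  have hB : ∃ c < Real.pi / (a - -a), ∃ B, (fun w => f w / q w ^ D)
      =O[comap (_root_.abs ∘ im) atTop ⊓ 𝓟 (re ⁻¹' Set.Ioo (-a) a)]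
      fun z => Real.exp (B * Real.exp (c * |z.im|)) := by
    obtain ⟨B, hB⟩ := hgrow
    refine ⟨c, by convert hc using 2; ring, B, ?_⟩
    refine (Asymptotics.IsBigO.of_bound 1 ?_).trans hB
    filter_upwards [eventually_stripFilter_re a] with w hw
    rw [norm_div, one_mul, norm_pow]
    exact div_le_self (norm_nonneg _) (one_le_pow₀ (hq1 w hw.le))
  have key := PhragmenLindelof.vertical_strip hdiff hB (C := K * (a + 3) ^ D)
    (fun w hw => hbd' w (by rw [hw, abs_neg, abs_of_pos ha]))
    (fun w hw => hbd' w (by rw [hw, abs_of_pos ha])) (abs_le.1 hz).1 (abs_le.1 hz).2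
  rw [norm_div, norm_pow, div_le_iff₀ (pow_pos (by linarith [hq1 z hz]) D)] at key
  refine key.trans ?_
  gcongr

namespace SSF

variable {σ0 σ1 : ℝ}

theorem doubleExpBound_xi_add (S : SSF σ0 σ1) (d a : ℝ) {c : ℝ} (hc : 0 < c) :
    DoubleExpBound (stripFilter a) c fun z => S.xi (z + d) := by
  have hre := eventually_stripFilter_re a
  have him := tendsto_abs_im_stripFilter a
  have hnorm : ∀ᶠ z : ℂ in stripFilter a, ‖z + d‖ ≤ (a + |d|) + |z.im| := by
    filter_upwards [hre] with z hz
    refine (norm_add_le _ _).trans ?_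
    rw [norm_real, Real.norm_eq_abs]
    linarith [norm_le_abs_re_add_abs_im z]
  have hG : DoubleExpBound (stripFilter a) c fun z => S.G (z + d) := by
    obtain ⟨c1, B, hB⟩ := S.hGord
    set K := a + |d| with hK
    have hlim : Tendsto (fun t : ℝ => t ^ |B| / Real.exp (c / 2 * t)) atTop (nhds 0) := by
      have := (isLittleO_rpow_exp_pos_mul_atTop |B| (half_pos hc)).tendsto_div_nhds_zero
      exact this
    refine ⟨1, Asymptotics.IsBigO.of_bound |c1| ?_⟩
    filter_upwards [hnorm, him.eventually_ge_atTop (|K| + 1),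
      him.eventually ((tendsto_atTop_add_const_left _ |K| tendsto_id).eventually
        (hlim.eventually_lt_const (by norm_num : (0 : ℝ) < 1)))] with z h1 h2 h3
    rw [Real.norm_of_nonneg (Real.exp_pos _).le, one_mul]
    refine (hB _).trans ?_
    have h5 : 1 ≤ ‖z + d‖ := by
      refine le_trans ?_ (abs_im_le_norm _)
      simp only [add_im, ofReal_im, add_zero]
      linarith [abs_nonneg K]
    have h6 : ‖z + d‖ ^ B ≤ Real.exp (c * |z.im|) := by
      simp only [id] at h3
      rw [div_lt_one (Real.exp_pos _)] at h3
      calc ‖z + d‖ ^ B ≤ ‖z + d‖ ^ |B| := Real.rpow_le_rpow_of_exponent_le h5 (le_abs_self B)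
        _ ≤ (|K| + |z.im|) ^ |B| := Real.rpow_le_rpow (norm_nonneg _)
            (h1.trans (by linarith [le_abs_self K])) (abs_nonneg B)
        _ ≤ Real.exp (c / 2 * (|K| + |z.im|)) := h3.le
        _ ≤ _ := Real.exp_le_exp.2 (by nlinarith)
    calc c1 * Real.exp (‖z + d‖ ^ B) ≤ |c1| * Real.exp (‖z + d‖ ^ B) := by
          gcongr; exact le_abs_self c1
      _ ≤ _ := by gcongr
  have hQ : DoubleExpBound (stripFilter a) c fun z => (S.Q : ℂ) ^ (z + d) := by
    have hcont : ContinuousOn (fun x : ℝ => S.Q ^ (x + d)) (Set.Icc (-a) a) :=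
      (continuous_const.rpow (continuous_id.add continuous_const)
        fun _ => Or.inl S.hQ.ne').continuousOn
    obtain ⟨M, hM⟩ := isCompact_Icc.exists_bound_of_continuousOn hcont
    refine DoubleExpBound.of_bounded (M := M) ?_
    filter_upwards [hre] with z hz
    rw [norm_cpow_eq_rpow_re_of_pos S.hQ, add_re, ofReal_re]
    exact (le_abs_self _).trans (hM _ (abs_le.1 hz.le))
  have hGam : ∀ j, DoubleExpBound (stripFilter a) c fun z =>
      Complex.Gamma ((S.lam j : ℂ) * (z + d) + S.mu j) := by
    intro j
    obtain ⟨M, hM⟩ := exists_norm_Gamma_le (S.lam j * (a + |d|) + |(S.mu j).re|)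
    refine DoubleExpBound.of_bounded (M := M) ?_
    have hl := S.hlam j
    filter_upwards [hre, him.eventually_ge_atTop ((1 + |(S.mu j).im|) / S.lam j)] with z h1 h2
    refine hM _ ?_ ?_
    · simp only [add_im, im_ofReal_mul, ofReal_im, add_zero]
      rw [div_le_iff₀ hl] at h2
      have h3 := abs_sub_abs_le_abs_sub (S.lam j * z.im) (-(S.mu j).im)
      rw [abs_mul, abs_of_pos hl, abs_neg, sub_neg_eq_add] at h3
      linarith
    · simp only [add_re, re_ofReal_mul, ofReal_re]
      refine (abs_add_le _ _).trans (add_le_add ?_ le_rfl)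
      rw [abs_mul, abs_of_pos hl]
      exact mul_le_mul_of_nonneg_left ((abs_add_le _ _).trans (by linarith)) hl.le
  have hw : ∀ i : Fin S.N, DoubleExpBound (stripFilter a) c fun z =>
      (if 2 * S.M + S.dlt ≤ (i : ℕ) then
        ((σ1 : ℂ) - (z + d) - (starRingEnd ℂ) (S.pole i)) ^ S.m i else 1) := by
    intro i
    split_ifs
    · refine DoubleExpBound.pow (DoubleExpBound.of_le_add (K := (a + |d|) +
        ‖(σ1 : ℂ) - (starRingEnd ℂ) (S.pole i)‖) hc ?_) _
      filter_upwards [hnorm] with z hz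
      rw [show (σ1 : ℂ) - (z + d) - (starRingEnd ℂ) (S.pole i) =
        ((σ1 : ℂ) - (starRingEnd ℂ) (S.pole i)) - (z + d) by ring]
      exact (norm_sub_le _ _).trans (by linarith)
    · exact DoubleExpBound.of_bounded (M := 1) (by simp)
  obtain ⟨B, hB⟩ := ((hG.mul hQ).mul (DoubleExpBound.prod (s := Finset.univ) fun j _ => hGam j)).mul
    (DoubleExpBound.prod (s := Finset.univ) fun i _ => hw i)
  refine ⟨B, hB.congr' ?_ EventuallyEq.rfl⟩
  have hp : ∀ᶠ z : ℂ in stripFilter a, ∀ i, z + d ≠ S.pole i := by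
    refine eventually_all.2 fun i => ?_
    filter_upwards [him.eventually_gt_atTop |(S.pole i).im|] with z hz h
    rw [← h] at hz
    simp at hz
  have hg : ∀ᶠ z : ℂ in stripFilter a, ∀ (j : Fin S.r) (k : ℕ),
      (S.lam j : ℂ) * (z + d) + S.mu j ≠ -(k : ℂ) := by
    refine eventually_all.2 fun j => ?_
    have hl := S.hlam j
    filter_upwards [him.eventually_gt_atTop (|(S.mu j).im| / S.lam j)] with z hz k h
    have h1 := congrArg im h
    simp only [add_im, im_ofReal_mul, ofReal_im, add_zero, neg_im, natCast_im, neg_zero] at h1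
    rw [div_lt_iff₀ hl, show (S.mu j).im = -(S.lam j * z.im) by linarith, abs_neg, abs_mul,
      abs_of_pos hl, mul_comm] at hz
    exact lt_irrefl _ hz
  filter_upwards [hp, hg] with z h1 h2
  rw [S.hxiEq _ h1 h2, S.hGF _ h1]
  ring

end SSF

/-- The even extension of the secondary Stirling term `b Re z - L Im z arg z`. -/
def stirlingSecondary (L b : ℝ) (z : ℂ) : ℝ :=
  b * |z.re| - L * (z.im * Real.arcsin (z.im / ‖z‖))

theorem abs_im_mul_arcsin_le (z : ℂ) : |z.im * Real.arcsin (z.im / ‖z‖)| ≤ 2 * ‖z‖ := by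
  rw [abs_mul]
  have h1 : |Real.arcsin (z.im / ‖z‖)| ≤ 2 := by
    have h2 := abs_le.2 ⟨Real.neg_pi_div_two_le_arcsin (z.im / ‖z‖),
      Real.arcsin_le_pi_div_two (z.im / ‖z‖)⟩
    linarith [Real.pi_lt_four]
  calc |z.im| * |Real.arcsin (z.im / ‖z‖)| ≤ ‖z‖ * 2 := by
        gcongr; exact abs_im_le_norm z
    _ = _ := mul_comm _ _

theorem im_mul_arcsin_nonneg (z : ℂ) : 0 ≤ z.im * Real.arcsin (z.im / ‖z‖) := by
  rcases le_total 0 z.im with h | h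
  · exact mul_nonneg h (Real.arcsin_nonneg.2 (div_nonneg h (norm_nonneg z)))
  · exact mul_nonneg_of_nonpos_of_nonpos h
      (Real.arcsin_nonpos.2 (div_nonpos_of_nonpos_of_nonneg h (norm_nonneg z)))

theorem continuous_stirlingSecondary (L b : ℝ) : Continuous (stirlingSecondary L b) := by
  have h : Continuous fun z : ℂ => z.im * Real.arcsin (z.im / ‖z‖) := by
    rw [continuous_iff_continuousAt]
    intro z
    rcases eq_or_ne z 0 with rfl | hz
    · rw [ContinuousAt]
      simp only [zero_im, zero_mul]
      refine squeeze_zero_norm (a := fun z : ℂ => 2 * ‖z‖) (fun z => abs_im_mul_arcsin_le z) ?_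
      have : Continuous fun z : ℂ => 2 * ‖z‖ := by fun_prop
      simpa using this.tendsto 0
    · refine continuous_im.continuousAt.mul (Real.continuous_arcsin.continuousAt.comp ?_)
      exact continuous_im.continuousAt.div continuous_norm.continuousAt (norm_ne_zero_iff.2 hz)
  unfold stirlingSecondary
  fun_prop

theorem stirlingSecondary_ofReal_mul (L b : ℝ) {t : ℝ} (ht : 0 < t) (z : ℂ) :
    stirlingSecondary L b (t * z) = t * stirlingSecondary L b z := by
  unfold stirlingSecondary
  rw [re_ofReal_mul, im_ofReal_mul, norm_mul, norm_real, Real.norm_of_nonneg ht.le,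
    mul_div_mul_left _ _ ht.ne', abs_mul, abs_of_pos ht]
  ring

theorem stirlingSecondary_neg (L b : ℝ) (z : ℂ) :
    stirlingSecondary L b (-z) = stirlingSecondary L b z := by
  unfold stirlingSecondary
  rw [neg_re, neg_im, norm_neg, abs_neg, neg_div, Real.arcsin_neg, neg_mul_neg]

theorem abs_stirlingSecondary_le {L : ℝ} (hL : 0 ≤ L) (b : ℝ) (z : ℂ) :
    |stirlingSecondary L b z| ≤ (|b| + 2 * L) * ‖z‖ := by
  unfold stirlingSecondary
  refine (abs_sub _ _).trans ?_
  rw [abs_mul, abs_abs, abs_mul L, abs_of_nonneg hL]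
  have h1 := mul_le_mul_of_nonneg_left (abs_re_le_norm z) (abs_nonneg b)
  have h2 := mul_le_mul_of_nonneg_left (abs_im_mul_arcsin_le z) hL
  linarith

theorem growthMain_eq_reMulLog (L b : ℝ) {z : ℂ} (hz : 0 ≤ z.re) :
    growthMain (fun z => L * |z.re|) (stirlingSecondary L b) z = L * reMulLog z + b * z.re := by
  rw [growthMain, stirlingSecondary, reMulLog, mul_re, log_re, log_im, arg_of_re_nonneg hz,
    abs_of_nonneg hz]
  ring

theorem growthMain_neg_conj (L b : ℝ) (z : ℂ) :
    growthMain (fun z => L * |z.re|) (stirlingSecondary L b) (-(starRingEnd ℂ) z) =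
      growthMain (fun z => L * |z.re|) (stirlingSecondary L b) z := by
  simp only [growthMain, stirlingSecondary, norm_neg, norm_conj, neg_re, conj_re, abs_neg, neg_im,
    conj_im, neg_neg]

namespace SSF

variable {σ0 σ1 : ℝ}

theorem sum_lam_nonneg (S : SSF σ0 σ1) : 0 ≤ ∑ j, S.lam j :=
  Finset.sum_nonneg fun j _ => (S.hlam j).le

theorem norm_xi_reflect (S : SSF σ0 σ1) (s : ℂ) :
    ‖S.xi s‖ = ‖S.xi ((σ1 : ℂ) - (starRingEnd ℂ) s)‖ := by
  conv_lhs => rw [S.hFE s]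
  rw [norm_mul, S.hω, one_mul, norm_conj]

/-- Growth of the completed function outside a vertical strip. -/
theorem exists_growth_outside (S : SSF σ0 σ1) (τ : ℝ) (hτ : S.xi τ ≠ 0) :
    ∃ b c : ℝ, 3 ≤ c ∧ ∀ z : ℂ, c ≤ |z.re| → S.xi (z + τ) ≠ 0 ∧
      |Real.log ‖S.xi (z + τ)‖ -
        growthMain (fun z => (∑ j, S.lam j) * |z.re|) (stirlingSecondary (∑ j, S.lam j) b) z| ≤
        c * Real.log ‖z‖ := by
  obtain ⟨b, hb⟩ := S.exists_log_norm_xi_add_isBigO hτ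
  have hev : ∀ d : ℝ, ∃ c : ℝ, 3 ≤ c ∧ ∀ z : ℂ, c ≤ z.re → S.xi (z + d) ≠ 0 ∧
      |Real.log ‖S.xi (z + d)‖ - growthMain (fun z => (∑ j, S.lam j) * |z.re|)
        (stirlingSecondary (∑ j, S.lam j) b) z| ≤ c * Real.log ‖z‖ := by
    intro d
    obtain ⟨hne, hO⟩ := hb d
    obtain ⟨K, hK⟩ := hO.bound
    have h1 := hne.and hK
    rw [reAtTop, eventually_comap, eventually_atTop] at h1
    obtain ⟨c, hc⟩ := h1
    refine ⟨max 3 (max c K), le_max_left _ _, fun z hz => ?_⟩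
    have h3 : 3 ≤ z.re := (le_max_left _ _).trans hz
    have hcz : c ≤ z.re := ((le_max_left _ _).trans (le_max_right _ _)).trans hz
    obtain ⟨h4, h5⟩ := hc z.re hcz z rfl
    have hlog := one_le_log_of_three_le (h3.trans (re_le_norm z))
    refine ⟨h4, ?_⟩
    rw [growthMain_eq_reMulLog _ _ (by linarith)]
    rw [Real.norm_eq_abs, Real.norm_eq_abs, abs_of_nonneg (by linarith : 0 ≤ Real.log ‖z‖)] at h5
    refine h5.trans ?_
    gcongr
    exact (le_max_right _ _).trans (le_max_right _ _)
  obtain ⟨c1, h13, hc1⟩ := hev τ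
  obtain ⟨c2, -, hc2⟩ := hev (σ1 - τ)
  refine ⟨b, max c1 c2, h13.trans (le_max_left _ _), fun z hz => ?_⟩
  have hlog : 0 ≤ Real.log ‖z‖ := by
    have := h13.trans ((le_max_left _ _).trans (hz.trans (abs_re_le_norm z)))
    exact Real.log_nonneg (by linarith)
  rcases le_total 0 z.re with h | h
  · rw [abs_of_nonneg h] at hz
    obtain ⟨h1, h2⟩ := hc1 z ((le_max_left _ _).trans hz)
    exact ⟨h1, h2.trans (by gcongr; exact le_max_left _ _)⟩
  · rw [abs_of_nonpos h] at hz
    have hw : (-(starRingEnd ℂ) z).re = -z.re := by simp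
    obtain ⟨h1, h2⟩ := hc2 (-(starRingEnd ℂ) z) (by rw [hw]; exact (le_max_right _ _).trans hz)
    have e : ‖S.xi (z + τ)‖ = ‖S.xi (-(starRingEnd ℂ) z + ((σ1 - τ : ℝ) : ℂ))‖ := by
      rw [S.norm_xi_reflect, map_add, conj_ofReal]
      congr 2
      push_cast
      ring
    rw [growthMain_neg_conj, norm_neg, norm_conj, ← e] at h2
    refine ⟨norm_ne_zero_iff.1 (by rw [e]; exact norm_ne_zero_iff.2 h1), h2.trans ?_⟩
    gcongr
    exact le_max_right _ _

theorem log_le_of_le_pow {x K y : ℝ} {D : ℕ} (hK : 1 ≤ K) (hy : 3 ≤ y) (hx : 0 ≤ x)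
    (h : x ≤ K * (2 * y) ^ D) : Real.log x ≤ (Real.log K + 2 * D) * (y * Real.log y) := by
  have h1 := one_le_log_of_three_le hy
  have hlK := Real.log_nonneg hK
  have h0 : 1 ≤ y * Real.log y := by nlinarith
  rcases hx.eq_or_lt with rfl | hx
  · rw [Real.log_zero]
    positivity
  · refine (Real.log_le_log hx h).trans ?_
    rw [Real.log_mul (by positivity) (by positivity), Real.log_pow, add_mul]
    have h2 := log_two_mul_le hy
    have h3 : (D : ℝ) * Real.log (2 * y) ≤ D * (2 * (y * Real.log y)) := by
      refine mul_le_mul_of_nonneg_left (h2.trans ?_) (Nat.cast_nonneg D)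
      nlinarith
    nlinarith

/-- Growth of the completed function inside a vertical strip. -/
theorem exists_growth_inside (S : SSF σ0 σ1) (τ : ℝ) {b a : ℝ} (ha : 3 ≤ a)
    (hout : ∀ z : ℂ, a ≤ |z.re| → S.xi (z + τ) ≠ 0 ∧
      |Real.log ‖S.xi (z + τ)‖ -
        growthMain (fun z => (∑ j, S.lam j) * |z.re|) (stirlingSecondary (∑ j, S.lam j) b) z| ≤
        a * Real.log ‖z‖) :
    ∃ K : ℝ, 3 ≤ K ∧ ∀ z : ℂ, |z.re| ≤ a → K ≤ ‖z‖ →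
      Real.log ‖S.xi (z + τ)‖ ≤ K * (‖z‖ * Real.log ‖z‖) := by
  set L := ∑ j, S.lam j
  have hL : 0 ≤ L := S.sum_lam_nonneg
  obtain ⟨D, hD⟩ := exists_nat_ge (L * a + a)
  have hdiff : Differentiable ℂ fun z : ℂ => S.xi (z + τ) :=
    S.hxiDiff.comp (differentiable_id.add_const _)
  have hbd : ∀ z : ℂ, |z.re| = a →
      ‖S.xi (z + τ)‖ ≤ Real.exp (|b| * a) * (‖z‖ + 1) ^ D := by
    intro z hz
    obtain ⟨h1, h2⟩ := hout z hz.ge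
    have hz3 : 3 ≤ ‖z‖ := (ha.trans hz.ge).trans (abs_re_le_norm z)
    have hlog := one_le_log_of_three_le hz3
    have h3 := (abs_le.1 h2).2
    have h4 := mul_nonneg hL (im_mul_arcsin_nonneg z)
    have h5 : b * a ≤ |b| * a := by gcongr; exact le_abs_self b
    simp only [growthMain, stirlingSecondary, hz] at h3
    have h6 : (L * a + a) * Real.log ‖z‖ ≤ D * Real.log ‖z‖ := by gcongr
    have h7 : Real.log ‖S.xi (z + τ)‖ ≤ |b| * a + D * Real.log ‖z‖ := by nlinarith
    rw [Real.log_le_iff_le_exp (norm_pos_iff.2 h1), Real.exp_add, ← Real.log_pow,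
      Real.exp_log (by positivity)] at h7
    refine h7.trans ?_
    gcongr
    linarith
  have key := fun z hz => norm_le_pow_of_strip hdiff (c := Real.pi / (4 * a)) (z := z)
    (by linarith) (by gcongr; linarith [Real.pi_pos]) (Real.exp_pos (|b| * a)).le
    (S.doubleExpBound_xi_add τ a (div_pos Real.pi_pos (by linarith))) hbd hz
  set K := Real.exp (|b| * a) * (a + 3) ^ D with hKdef
  have hK : 1 ≤ K := by
    have h1 : 1 ≤ Real.exp (|b| * a) := Real.one_le_exp (by positivity)
    have h2 : 1 ≤ (a + 3) ^ D := one_le_pow₀ (by linarith)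
    nlinarith
  have hlK := Real.log_nonneg hK
  refine ⟨a + 1 + (Real.log K + 2 * D), ?_, fun z hz hzK => ?_⟩
  · have : (0 : ℝ) ≤ D := Nat.cast_nonneg D
    linarith
  · have hD0 : (0 : ℝ) ≤ D := Nat.cast_nonneg D
    have hza : a + 1 ≤ ‖z‖ := by linarith
    have hlog := one_le_log_of_three_le (by linarith : 3 ≤ ‖z‖)
    have h1 : ‖S.xi (z + τ)‖ ≤ K * (2 * ‖z‖) ^ D := by
      refine (key z hz).trans ?_
      gcongr
      linarith
    refine (log_le_of_le_pow hK (by linarith) (norm_nonneg _) h1).trans ?_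
    exact mul_le_mul_of_nonneg_right (by linarith) (by positivity)

theorem exists_growthHyp (S : SSF σ0 σ1) (τ : ℝ) (hτ : S.xi τ ≠ 0) :
    ∃ (A B : ℂ → ℝ) (C : ℝ), GrowthHyp (fun z => S.xi (z + τ)) A B C := by
  obtain ⟨b, a, ha, hout⟩ := S.exists_growth_outside τ hτ
  obtain ⟨K, hK3, hK⟩ := S.exists_growth_inside τ ha hout
  set L := ∑ j, S.lam j
  have hL : 0 ≤ L := S.sum_lam_nonneg
  have hb := abs_nonneg b
  refine ⟨fun z => L * |z.re|, stirlingSecondary L b, a + K + 2 * L + |b|, ?_⟩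
  refine
    { diff := S.hxiDiff.comp (differentiable_id.add_const _)
      ne := by simpa using hτ
      three_le := by linarith
      contA := by fun_prop
      contB := continuous_stirlingSecondary L b
      homA := fun t z ht => by
        rw [re_ofReal_mul, abs_mul, abs_of_pos ht]; ring
      homB := fun t z ht => stirlingSecondary_ofReal_mul L b ht z
      evenA := fun z => by rw [neg_re, abs_neg]
      evenB := stirlingSecondary_neg L b
      boundA := fun z => ?_
      boundB := fun z => ?_
      out := fun z hz => ?_
      strip := fun z hz hzC => ?_ }
  · rw [abs_mul, abs_abs, abs_of_nonneg hL]
    exact mul_le_mul (by linarith) (abs_re_le_norm z) (abs_nonneg _) (by linarith)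
  · refine (abs_stirlingSecondary_le hL b z).trans ?_
    exact mul_le_mul_of_nonneg_right (by linarith) (norm_nonneg z)
  · obtain ⟨h1, h2⟩ := hout z (by linarith)
    have h3 := one_le_log_of_three_le (by linarith [abs_re_le_norm z] : 3 ≤ ‖z‖)
    refine ⟨h1, h2.trans ?_⟩
    gcongr
    linarith
  · have h3 := one_le_log_of_three_le (by linarith : 3 ≤ ‖z‖)
    have h4 : 0 ≤ ‖z‖ * Real.log ‖z‖ := by positivity
    rcases le_total |z.re| a with h | h
    · refine (hK z h (by linarith)).trans ?_
      gcongr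
      linarith
    · obtain ⟨-, h2⟩ := hout z h
      have h5 := (abs_le.1 h2).2
      have h6 := mul_nonneg hL (im_mul_arcsin_nonneg z)
      simp only [growthMain, stirlingSecondary] at h5
      have h7 : L * |z.re| ≤ L * ‖z‖ := by gcongr; exact abs_re_le_norm z
      have h8 : Real.log ‖z‖ * (L * |z.re|) ≤ Real.log ‖z‖ * (L * ‖z‖) := by gcongr
      have h9 : b * |z.re| ≤ |b| * (‖z‖ * Real.log ‖z‖) := by
        refine mul_le_mul (le_abs_self b) ?_ (abs_nonneg _) hb
        exact (abs_re_le_norm z).trans (le_mul_of_one_le_right (norm_nonneg z) h3)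
      have h10 : a * Real.log ‖z‖ ≤ a * (‖z‖ * Real.log ‖z‖) := by
        gcongr
        exact le_mul_of_one_le_left (by linarith) (by linarith)
      have h11 : 0 ≤ (K + L) * (‖z‖ * Real.log ‖z‖) := by positivity
      linarith

end SSF

theorem zeroOrder_eq_analyticOrderNatAt {f : ℂ → ℂ} (hf : Differentiable ℂ f) {b : ℂ}
    (hb : f b ≠ 0) (ρ : ℂ) : zeroOrder f ρ = analyticOrderNatAt f ρ := by
  have h1 : analyticOrderAt f ρ = analyticOrderNatAt f ρ :=
    (Nat.cast_analyticOrderNatAt (analyticOrderAt_ne_top_of_entire hf hb ρ)).symm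
  obtain ⟨h2, h3⟩ :=
    (analyticOrderAt_eq_nat_iff_iteratedDeriv_eq_zero (hf.analyticAt ρ)).1 h1
  refine le_antisymm (Nat.sInf_le h3) (le_csInf ⟨_, h3⟩ fun k hk => ?_)
  by_contra! hlt
  exact hk (h2 k hlt)

theorem zeroOrder_comp_add_const (f : ℂ → ℂ) (c a : ℂ) :
    zeroOrder (fun z => f (z + c)) a = zeroOrder f (a + c) := by
  simp only [zeroOrder, iteratedDeriv_comp_add_const]

/-- Binomial expansion of the summand of the `τ`-Li coefficient at the zero `a + τ`. -/
theorem one_sub_div_pow_eq_sum {a : ℂ} (ha : a ≠ 0) (τ : ℂ) (n : ℕ) :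
    1 - ((a + τ) / (a + τ - τ)) ^ n =
      ∑ k ∈ Icc 1 n, -((n.choose k : ℂ) * τ ^ k) * a⁻¹ ^ (k - 1 + 1) := by
  have h1 : (a + τ) / (a + τ - τ) = τ * a⁻¹ + 1 := by
    rw [add_sub_cancel_right]; field_simp; ring
  rw [h1, add_pow, Finset.sum_range_succ', Finset.range_eq_Ico,
    Finset.sum_Ico_add' (fun k => (τ * a⁻¹) ^ k * 1 ^ (n - k) * (n.choose k : ℂ)) 0 n 1,
    sub_add_eq_sub_sub_swap]
  simp only [pow_zero, one_pow, mul_one, Nat.choose_zero_right, Nat.cast_one, sub_self, zero_sub]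
  rw [← Finset.sum_neg_distrib]
  refine Finset.sum_congr (by ext; simp) fun k hk => ?_
  rw [Nat.sub_add_cancel (Finset.mem_Icc.1 hk).1]
  ring

/-- For `F ∈ S^♯♭(σ₀,σ₁)` and `τ ∈ [σ₁, 2σ₀]` with `0, τ ∉ Z(F)`, for every
`n ≥ 1` the `τ`-Li coefficient equals
`∑_{k=1}^{n} binom(n,k)·(τ^k/(k−1)!)·D^{(k−1)}(ξ_F′/ξ_F)(τ)`. -/
theorem tauLi_eq_derivative_formula (σ0 σ1 : ℝ) (S : SSF σ0 σ1) (τ : ℝ)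
    (hτ1 : σ1 ≤ τ) (hτ2 : τ ≤ 2 * σ0)
    (h0 : S.xi 0 ≠ 0) (hτZ : S.xi (τ : ℂ) ≠ 0) (n : ℕ) (hn : 0 < n) :
    Filter.Tendsto (fun T : ℝ =>
        ∑' ρ : {ρ : ℂ // S.xi ρ = 0 ∧ |ρ.im| ≤ T},
          (zeroOrder S.xi ρ : ℂ) * (1 - ((ρ : ℂ) / ((ρ : ℂ) - τ)) ^ n))
      Filter.atTop
      (nhds (∑ k ∈ Finset.Icc 1 n, (n.choose k : ℂ) *
        ((τ : ℂ) ^ k / ((k - 1).factorial : ℂ)) *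
        iteratedDeriv (k - 1) (fun s : ℂ => deriv S.xi s / S.xi s) (τ : ℂ))) := by
  obtain ⟨A, B, C, H⟩ := S.exists_growthHyp τ hτZ
  have hshift : ∀ T : ℝ,
      ∑' ρ : {ρ : ℂ // S.xi ρ = 0 ∧ |ρ.im| ≤ T},
          (zeroOrder S.xi ρ : ℂ) * (1 - ((ρ : ℂ) / ((ρ : ℂ) - τ)) ^ n) =
        ∑ a ∈ (H.finite_zeros_strip T).toFinset,
          (analyticOrderNatAt (fun z => S.xi (z + τ)) a : ℂ) *
            (1 - ((a + τ) / (a + τ - τ)) ^ n) := by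
    intro T
    let e : {a // a ∈ (H.finite_zeros_strip T).toFinset} ≃ {ρ : ℂ // S.xi ρ = 0 ∧ |ρ.im| ≤ T} :=
      (Equiv.addRight (τ : ℂ)).subtypeEquiv fun a => by simp
    rw [← e.tsum_eq, tsum_fintype, Finset.univ_eq_attach, ← Finset.sum_attach _ fun a =>
      (analyticOrderNatAt (fun z => S.xi (z + τ)) a : ℂ) * (1 - ((a + τ) / (a + τ - τ)) ^ n)]
    refine Finset.sum_congr rfl fun a _ => ?_
    rw [← zeroOrder_eq_analyticOrderNatAt H.diff H.ne, zeroOrder_comp_add_const]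
    rfl
  have hexp : ∀ T : ℝ,
      ∑' ρ : {ρ : ℂ // S.xi ρ = 0 ∧ |ρ.im| ≤ T},
          (zeroOrder S.xi ρ : ℂ) * (1 - ((ρ : ℂ) / ((ρ : ℂ) - τ)) ^ n) =
        ∑ k ∈ Icc 1 n, -((n.choose k : ℂ) * (τ : ℂ) ^ k) *
          ∑ a ∈ (H.finite_zeros_strip T).toFinset,
            (analyticOrderNatAt (fun z => S.xi (z + τ)) a : ℂ) * a⁻¹ ^ (k - 1 + 1) := by
    intro T
    simp_rw [Finset.mul_sum]
    rw [hshift, Finset.sum_comm]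
    refine Finset.sum_congr rfl fun a ha => ?_
    have ha0 : a ≠ 0 := by
      rintro rfl
      exact H.ne ((H.finite_zeros_strip T).mem_toFinset.1 ha).1
    rw [one_sub_div_pow_eq_sum ha0, Finset.mul_sum]
    exact Finset.sum_congr rfl fun k _ => by ring
  simp_rw [hexp]
  refine tendsto_finsetSum _ fun k _ => ?_
  convert (H.tendsto_sum_zeros_strip (k - 1)).const_mul
    (-((n.choose k : ℂ) * (τ : ℂ) ^ k)) using 2
  have hd : (fun z : ℂ => deriv (fun z => S.xi (z + τ)) z / S.xi (z + τ)) =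
      fun z => (fun s => deriv S.xi s / S.xi s) (z + τ) := by
    ext z
    rw [deriv_comp_add_const]
  rw [hd, iteratedDeriv_comp_add_const (k - 1) (fun s => deriv S.xi s / S.xi s)]
  simp only [zero_add]
  ring

end
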